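/- Every combinatorial pseudo-triangulation with the generalized Laman property can be stretched, i.e., it admits a non-crossing straight-line realization with the given embedding in which angles labelled big are greater than 180 degrees and angles labelled small are less than 180 degrees, making the drawing a pseudo-triangulation. -/

import Mathlib

/-! ## Combinatorial plane graphs via rotation systems -/

/-- The permutation of darts of a simple graph reversing each dart. -/
def dartSymmPerm {V : Type} (G : SimpleGraph V) : Equiv.Perm G.Dart where
  toFun := SimpleGraph.Dart.symm
  invFun := SimpleGraph.Dart.symm
  left_inv d := SimpleGraph.Dart.symm_symm d
  right_inv d := SimpleGraph.Dart.symm_symm d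

/-- The setoid on `α` whose classes are the cycles (orbits) of a permutation `σ`. -/
def faceSetoid {α : Type} (σ : Equiv.Perm α) : Setoid α :=
  ⟨σ.SameCycle, ⟨fun x => Equiv.Perm.SameCycle.refl σ x,
    fun h => h.symm, fun h h' => h.trans h'⟩⟩

/-- A (topological, non-crossing) embedding of a connected graph `G` in the plane, encoded
combinatorially: a rotation system (the counterclockwise cyclic order of the darts around
each vertex), which is planar in the sense of Euler's formula (the number of orbits of the
face permutation `rot * symm` is the number of faces), together with a distinguished
outer (unbounded) face.  A *plane graph* is a graph `G` together with such a structure. -/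
structure PlaneEmb {V : Type} (G : SimpleGraph V) where
  rot : Equiv.Perm G.Dart
  rot_fst : ∀ d : G.Dart, (rot d).fst = d.fst
  rot_vertex : ∀ d d' : G.Dart, d.fst = d'.fst → ∃ n : ℕ, (rot ^ n) d = d'
  connected : G.Connected
  outer : Quotient (faceSetoid (rot * dartSymmPerm G))
  euler : Nat.card V + Nat.card (Quotient (faceSetoid (rot * dartSymmPerm G)))
      = Nat.card G.edgeSet + 2

namespace PlaneEmb

variable {V : Type} {G : SimpleGraph V}

/-- The faces of a plane graph: orbits of the face permutation. -/
abbrev Face (E : PlaneEmb G) : Type := Quotient (faceSetoid (E.rot * dartSymmPerm G))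

/-- The face having the dart `d` on its contour. -/
def dartFace (E : PlaneEmb G) (d : G.Dart) : E.Face :=
  Quotient.mk (faceSetoid (E.rot * dartSymmPerm G)) d

/-- Each dart `d` determines an *angle* of the plane graph, namely the angle at the vertex
`d.fst` between the edges of `d` and `rot d`; `E.angleFace d` is the face this angle lies in. -/
def angleFace (E : PlaneEmb G) (d : G.Dart) : E.Face :=
  Quotient.mk (faceSetoid (E.rot * dartSymmPerm G)) d.symm

end PlaneEmb

/-- A vertex is *pointed* (w.r.t. an assignment `big` of which angles are labelled big)
if some angle at it is labelled big. -/
def PointedVx {V : Type} {G : SimpleGraph V} (big : G.Dart → Prop) (v : V) : Prop :=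
  ∃ d : G.Dart, big d ∧ d.fst = v

/-- A *combinatorial pseudo-triangulation labelling* (CPT-labelling): every bounded face has
exactly three small angles, all angles of the unbounded face are big, and no vertex is
incident to more than one big angle. -/
structure IsCPTLabelling {V : Type} {G : SimpleGraph V} (E : PlaneEmb G)
    (big : G.Dart → Prop) : Prop where
  bounded_small : ∀ F : E.Face, F ≠ E.outer →
    Nat.card {d : G.Dart | E.angleFace d = F ∧ ¬ big d} = 3
  outer_big : ∀ d : G.Dart, E.angleFace d = E.outer → big d
  one_big : ∀ d d' : G.Dart, big d → big d' → d.fst = d'.fst → d = d'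

/-- The generalized Laman property of a combinatorial pseudo-triangulation: any `x` non-pointed
plus `y` pointed vertices, with `x + y ≥ 2`, induce at most `3x + 2y - 3` edges. -/
def GenLaman {V : Type} (G : SimpleGraph V) (big : G.Dart → Prop) : Prop :=
  ∀ S : Set V, 2 ≤ Nat.card S →
    (Nat.card ((G.induce S).edgeSet) : ℤ) ≤
      3 * Nat.card {v ∈ S | ¬ PointedVx big v} + 2 * Nat.card {v ∈ S | PointedVx big v} - 3

/-! ## Rigidity -/

/-- Dot product in the plane. -/
def dot2 (u w : ℝ × ℝ) : ℝ := u.1 * w.1 + u.2 * w.2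

/-- Rotation by 90 degrees. -/
def rot90 (u : ℝ × ℝ) : ℝ × ℝ := (-u.2, u.1)

/-- `q` is an infinitesimal motion of the bar-and-joint framework `(G, p)`. -/
def IsInfMotion {V : Type} (G : SimpleGraph V) (p q : V → ℝ × ℝ) : Prop :=
  ∀ u v : V, G.Adj u v → dot2 (p u - p v) (q u - q v) = 0

/-- Trivial infinitesimal motions: those coming from rigid motions of the plane
(infinitesimal rotations and translations). -/
def IsTrivialMotion {V : Type} (p q : V → ℝ × ℝ) : Prop :=
  ∃ (a : ℝ) (t : ℝ × ℝ), ∀ v : V, q v = a • rot90 (p v) + t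

/-- The framework `(G, p)` is infinitesimally rigid: it has no non-trivial infinitesimal
motions. -/
def InfRigid {V : Type} (G : SimpleGraph V) (p : V → ℝ × ℝ) : Prop :=
  ∀ q : V → ℝ × ℝ, IsInfMotion G p q → IsTrivialMotion p q

/-- A configuration of points is *generic* if its coordinates are algebraically
independent over `ℚ`. -/
def GenericConf {V : Type} (p : V → ℝ × ℝ) : Prop :=
  AlgebraicIndependent ℚ (fun x : V ⊕ V => Sum.elim (fun v => (p v).1) (fun v => (p v).2) x)

/-- A graph is *generically rigid in the plane* if every generic framework on it has no
non-trivial infinitesimal motions. -/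
def GenRigid {V : Type} (G : SimpleGraph V) : Prop :=
  ∀ p : V → ℝ × ℝ, GenericConf p → InfRigid G p

/-- A graph is *isostatic* (generically minimally rigid) if it is generically rigid and
removing any edge destroys generic rigidity. -/
def Isostatic {V : Type} (G : SimpleGraph V) : Prop :=
  GenRigid G ∧ ∀ e ∈ G.edgeSet, ¬ GenRigid (G.deleteEdges {e})

/-- Laman's condition: exactly `2n - 3` edges, and every `k ≥ 2` vertices span at most
`2k - 3` edges. -/
def LamanGraph {V : Type} (L : SimpleGraph V) : Prop :=
  (Nat.card L.edgeSet : ℤ) = 2 * Nat.card V - 3 ∧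
  ∀ S : Set V, 2 ≤ Nat.card S →
    (Nat.card ((L.induce S).edgeSet) : ℤ) ≤ 2 * Nat.card S - 3

/-! ## Geometry: straight-line drawings, angles, stretching -/

/-- The counterclockwise angle from the direction `u` to the direction `w`,
normalized to lie in `(0, 2π]` (a full turn for `w` pointing in the direction of `u`). -/
noncomputable def ccwAngle (u w : ℝ × ℝ) : ℝ :=
  if 0 < Complex.arg ((⟨w.1, w.2⟩ : ℂ) / (⟨u.1, u.2⟩ : ℂ)) then
    Complex.arg ((⟨w.1, w.2⟩ : ℂ) / (⟨u.1, u.2⟩ : ℂ))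
  else Complex.arg ((⟨w.1, w.2⟩ : ℂ) / (⟨u.1, u.2⟩ : ℂ)) + 2 * Real.pi

/-- The (counterclockwise) geometric angle, in the straight-line drawing `p`, of the angle of
the dart `d`, i.e. the angle at `d.fst` between the edge of `d` and the edge of `rot d`. -/
noncomputable def dartAngle {V : Type} {G : SimpleGraph V} (E : PlaneEmb G)
    (p : V → ℝ × ℝ) (d : G.Dart) : ℝ :=
  ccwAngle (p d.snd - p d.fst) (p (E.rot d).snd - p (E.rot d).fst)

/-- A straight-line drawing is non-crossing: distinct edges meet only in common endpoints,
and no vertex lies on an edge not incident to it. -/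
def NonCrossing {V : Type} (G : SimpleGraph V) (p : V → ℝ × ℝ) : Prop :=
  (∀ a b c d : V, G.Adj a b → G.Adj c d → ({a, b} : Set V) ≠ {c, d} →
    segment ℝ (p a) (p b) ∩ segment ℝ (p c) (p d) ⊆ p '' ({a, b} ∩ {c, d} : Set V)) ∧
  (∀ x a b : V, G.Adj a b → x ≠ a → x ≠ b → p x ∉ segment ℝ (p a) (p b))

/-- The points of the drawing are in general position: no three of them are collinear. -/
def GenPos {V : Type} (p : V → ℝ × ℝ) : Prop :=
  ∀ u v w : V, u ≠ v → u ≠ w → v ≠ w → ¬ Collinear ℝ ({p u, p v, p w} : Set (ℝ × ℝ))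

/-- The straight-line drawing `p` realizes the plane graph `(G, E)`: it is injective and
non-crossing, and around every (non-isolated) vertex the counterclockwise angles between
rotation-consecutive darts sum to `2π`, so the drawing induces the given rotation system. -/
def RealizesEmb {V : Type} [Fintype V] [DecidableEq V] (G : SimpleGraph V)
    [DecidableRel G.Adj] (E : PlaneEmb G) (p : V → ℝ × ℝ) : Prop :=
  Function.Injective p ∧ NonCrossing G p ∧
  ∀ v : V, (∃ d : G.Dart, d.fst = v) →
    ∑ d ∈ Finset.univ.filter (fun d : G.Dart => d.fst = v), dartAngle E p d = 2 * Real.pi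

/-- The drawing `p` *stretches* the angle labelling `big` of the plane graph `(G, E)`:
it realizes the embedding, has its (finitely many) vertices in general position, and every
angle labelled big is reflex (> 180°) while every angle labelled small is convex (< 180°).
If `big` is a CPT-labelling this makes `p` a pseudo-triangulation of its vertex set:
every bounded face is a pseudo-triangle and the convex hull edges are present. -/
def Stretches {V : Type} [Fintype V] [DecidableEq V] (G : SimpleGraph V)
    [DecidableRel G.Adj] (E : PlaneEmb G) (big : G.Dart → Prop) (p : V → ℝ × ℝ) : Prop :=
  RealizesEmb G E p ∧ GenPos p ∧
  ∀ d : G.Dart, (big d → Real.pi < dartAngle E p d) ∧ (¬ big d → dartAngle E p d < Real.pi)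

/-- The drawing `p` makes the plane graph `(G, E)` a pseudo-triangulation of its vertex set
(with the given embedding): for the labelling of the angles of the drawing as big (reflex)
or small (convex), every bounded face has exactly three small angles (is a pseudo-triangle)
and all outer angles are big (so the convex hull edges are present). -/
def StretchesToPT {V : Type} [Fintype V] [DecidableEq V] (G : SimpleGraph V)
    [DecidableRel G.Adj] (E : PlaneEmb G) (p : V → ℝ × ℝ) : Prop :=
  ∃ big : G.Dart → Prop, IsCPTLabelling E big ∧ Stretches G E big p

/-- A vertex `v` of a geometric straight-line drawing is *pointed* if all the edges at `v`
lie in a closed half-plane supported at `v`. -/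
def GeoPointed {V : Type} (G : SimpleGraph V) (p : V → ℝ × ℝ) (v : V) : Prop :=
  ∃ u : ℝ × ℝ, u ≠ 0 ∧ ∀ w : V, G.Adj v w → 0 ≤ dot2 u (p w - p v)

/-! ## Subgraphs, outer face, corners -/

/-- One step of dual connectivity avoiding the edge set `A`: the faces `F`, `F'` are the two
sides of some edge of `G` not belonging to `A`. -/
def FaceStep {V : Type} {G : SimpleGraph V} (E : PlaneEmb G) (A : Set (Sym2 V)) :
    E.Face → E.Face → Prop :=
  fun F F' => ∃ d : G.Dart, E.dartFace d = F ∧ E.dartFace d.symm = F' ∧ d.edge ∉ A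

/-- The face `F` of `G` is contained in the outer (unbounded) face of the plane subgraph of
`G` with edge set `A`: `F` can reach the outer face of `G` in the dual graph without
crossing the edges of `A`. -/
def InOuterOf {V : Type} {G : SimpleGraph V} (E : PlaneEmb G) (A : Set (Sym2 V))
    (F : E.Face) : Prop :=
  Relation.ReflTransGen (FaceStep E A) F E.outer

/-- `v` is a *corner* of the subgraph `H` of the combinatorial pseudo-triangulation
`(G, E, big)`: either `v` is pointed in `G` and its big angle is contained in the
outer face of `H`, or `v` is non-pointed in `G` and two consecutive (small) angles at `v`
are contained in the outer face of `H`. -/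
def IsCPTCorner {V : Type} {G : SimpleGraph V} (E : PlaneEmb G) (big : G.Dart → Prop)
    (H : G.Subgraph) (v : V) : Prop :=
  (v ∈ H.verts ∧ ∃ d : G.Dart, big d ∧ d.fst = v ∧ InOuterOf E H.edgeSet (E.angleFace d)) ∨
  (v ∈ H.verts ∧ ¬ PointedVx big v ∧ ∃ d : G.Dart, d.fst = v ∧
    InOuterOf E H.edgeSet (E.angleFace d) ∧ InOuterOf E H.edgeSet (E.angleFace (E.rot d)) ∧
    (E.rot d).edge ∉ H.edgeSet)

/-- A plane graph has *non-degenerate faces* if no edge appears twice on the contour cycle of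
a face, i.e. the edges incident to every face form a simple closed cycle. -/
def NonDegenerateFaces {V : Type} {G : SimpleGraph V} (E : PlaneEmb G) : Prop :=
  ∀ d : G.Dart, ¬ (E.rot * dartSymmPerm G).SameCycle d d.symm



/-! ## Triangulated maps -/

/-- A map refining a plane graph by diagonals. -/
structure TMap {V : Type} {G : SimpleGraph V} (E : PlaneEmb G) (big : G.Dart → Prop) where
  D : Type
  fin : Fintype D
  dec : DecidableEq D
  σ : Equiv.Perm D
  α : D → D
  ι : G.Dart → D
  ang : D → G.Dart
  own : D → Prop
  αα : ∀ x, α (α x) = x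
  α_ne : ∀ x, α x ≠ x
  ang_ι : ∀ d, ang (ι d) = d
  α_ι : ∀ d, α (ι d) = ι d.symm
  angσ : ∀ x, σ x = ι (E.rot (ang x)) ∨ (σ x ∉ Set.range ι ∧ ang (σ x) = ang x)
  reach : ∀ x, Relation.ReflTransGen (fun a b => b = σ a) (ι (ang x)) x
  fcψ : ∀ x, E.angleFace (ang (α (σ x))) = E.angleFace (ang x)
  out : ∀ x, E.angleFace (ang x) = E.outer → x = ι (ang x)
  own_or : ∀ x, x ∉ Set.range ι → own x ∨ own (α x)
  own_prop : ∀ x, own x → x ∉ Set.range ι ∧ big (ang x) ∧ E.angleFace (ang x) ≠ E.outer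
  own_uniq : ∀ x y, own x → own y → (ang x).fst = (ang y).fst → x = y

attribute [instance] TMap.fin TMap.dec

namespace TMap
variable {V : Type} {G : SimpleGraph V} {E : PlaneEmb G} {big : G.Dart → Prop}

/-- The face permutation on corners. -/
def ψ (T : TMap E big) (x : T.D) : T.D := T.α (T.σ x)

/-- The face of a corner. -/
def fc (T : TMap E big) (x : T.D) : E.Face := E.angleFace (T.ang x)

/-- Source vertex. -/
def src (T : TMap E big) (x : T.D) : V := (T.ang x).fst

/-- Target vertex. -/
def tgt (T : TMap E big) (x : T.D) : V := T.src (T.α x)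

end TMap

/-- The state of the triangulation procedure. -/
structure TSt {V : Type} {G : SimpleGraph V} (E : PlaneEmb G) (big : G.Dart → Prop) extends
    TMap E big where
  Bg : D → Prop
  C : Type
  cell : D → C
  Bg_big : ∀ x, Bg x → big (ang x)
  Bg_uniq : ∀ x y, Bg x → Bg y → (ang x).fst = (ang y).fst → x = y
  Bg_own : ∀ x y, Bg x → own y → (ang x).fst = (ang y).fst → False
  cellψ : ∀ x, cell (α (σ x)) = cell x
  cell_trans : ∀ x y, cell x = cell y → Relation.ReflTransGen (fun a b => b = α (σ a)) x y
  three : ∀ x, E.angleFace (ang x) ≠ E.outer → Nat.card {y // cell y = cell x ∧ ¬ Bg y} = 3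
  cnt : ∀ P, P ≠ E.outer → Nat.card {x // E.angleFace (ang x) = P} +
    2 * Nat.card {x // E.angleFace (ang x) = P ∧ Bg x} =
      3 + 3 * Nat.card {d // E.angleFace d = P ∧ big d}

set_option linter.unusedSectionVars false

section build
variable {V : Type} [Fintype V] [DecidableEq V] {G : SimpleGraph V} [DecidableRel G.Adj]
  {E : PlaneEmb G} {big : G.Dart → Prop}

lemma angleFace_psi (d : G.Dart) : E.angleFace (E.rot d).symm = E.angleFace d := by
  unfold PlaneEmb.angleFace
  refine (Quotient.sound ?_).symm
  refine ⟨1, ?_⟩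
  simp [dartSymmPerm]

lemma angleFace_trans [Finite G.Dart] (d d' : G.Dart) (h : E.angleFace d = E.angleFace d') :
    Relation.ReflTransGen (fun a b => b = (E.rot a).symm) d d' := by
  have h1 := Quotient.exact h
  have h1 : (E.rot * dartSymmPerm G).SameCycle d.symm d'.symm := h1
  obtain ⟨n, hn⟩ := h1.exists_nat_pow_eq
  have key : ∀ n : ℕ, ∀ d : G.Dart, Relation.ReflTransGen (fun a b => b = (E.rot a).symm) d
      (((E.rot * dartSymmPerm G) ^ n) d.symm).symm := by
    intro n
    induction n with
    | zero => intro d; simp; exact Relation.ReflTransGen.refl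
    | succ n ih =>
      intro d
      refine (ih d).tail ?_
      rw [pow_succ']
      simp [dartSymmPerm]
  have := key n d
  rw [hn] at this
  simpa using this

/-- initial state -/
noncomputable def TSt.init (h : IsCPTLabelling E big) : TSt E big where
  D := G.Dart
  fin := inferInstance
  dec := inferInstance
  σ := E.rot
  α := SimpleGraph.Dart.symm
  ι := id
  ang := id
  own := fun _ => False
  αα := by intro x; simp
  α_ne := by
    intro x hx
    exact SimpleGraph.Dart.symm_ne x hx
  ang_ι := by simp
  α_ι := by simp
  angσ := by intro x; left; rfl
  reach := by intro x; exact Relation.ReflTransGen.refl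
  fcψ := by intro x; exact angleFace_psi x
  out := by simp
  own_or := by intro x hx; simp at hx
  own_prop := by simp
  own_uniq := by simp
  Bg := big
  C := E.Face
  cell := E.angleFace
  Bg_big := by simp
  Bg_uniq := h.one_big
  Bg_own := by simp
  cellψ := by intro x; exact angleFace_psi x
  cell_trans := by intro x y hxy; exact angleFace_trans x y hxy
  three := by intro x hx; exact h.bounded_small _ hx
  cnt := by
    intro P hP
    have := h.bounded_small P hP
    have h2 : Nat.card {x // E.angleFace x = P} = Nat.card {d // E.angleFace d = P ∧ big d} +
      Nat.card {d // E.angleFace d = P ∧ ¬ big d} := by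
      classical
      simp only [Nat.card_eq_fintype_card, Fintype.card_subtype]
      rw [← Finset.card_filter_add_card_filter_not (s := Finset.univ.filter (fun x => E.angleFace x = P)) (p := big)]
      simp [Finset.filter_filter]
    have h3 : Nat.card {d // E.angleFace d = P ∧ ¬ big d} = 3 := this
    simp only [id]
    omega

section step
variable (S : TSt E big) (x : S.D)

/-- the new rotation -/
def stepσ (x z : S.D) : Equiv.Perm (S.D ⊕ Bool) :=
  (Equiv.sumCongr S.σ (Equiv.refl Bool)) * Equiv.swap (Sum.inl x) (Sum.inr false) *
    Equiv.swap (Sum.inl z) (Sum.inr true)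

/-- the new involution -/
def stepα : S.D ⊕ Bool → S.D ⊕ Bool := Sum.map S.α not

lemma stepσ_of_ne {x z u : S.D} (h1 : u ≠ x) (h2 : u ≠ z) :
    stepσ S x z (Sum.inl u) = Sum.inl (S.σ u) := by
  simp [stepσ, Equiv.swap_apply_of_ne_of_ne, h1, h2]

lemma stepσ_x {x z : S.D} (h : x ≠ z) : stepσ S x z (Sum.inl x) = Sum.inr false := by
  simp [stepσ, Equiv.swap_apply_of_ne_of_ne, h]

lemma stepσ_z {x z : S.D} : stepσ S x z (Sum.inl z) = Sum.inr true := by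
  simp [stepσ, Equiv.swap_apply_of_ne_of_ne]

lemma stepσ_p {x z : S.D} : stepσ S x z (Sum.inr false) = Sum.inl (S.σ x) := by
  simp [stepσ, Equiv.swap_apply_of_ne_of_ne]

lemma stepσ_q {x z : S.D} (h : x ≠ z) : stepσ S x z (Sum.inr true) = Sum.inl (S.σ z) := by
  simp [stepσ, Equiv.swap_apply_of_ne_of_ne, h.symm]

set_option maxHeartbeats 2000000 in
lemma TSt.exists_step (hx : S.Bg x) (hb : S.fc x ≠ E.outer) (hy : ¬ S.Bg (S.ψ x)) :
    ∃ S' : TSt E big, Nat.card {x // S'.fc x ≠ E.outer ∧ S'.Bg x} <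
      Nat.card {x // S.fc x ≠ E.outer ∧ S.Bg x} := by
  classical
  obtain ⟨y, hyd⟩ : ∃ y, y = S.α (S.σ x) := ⟨_, rfl⟩
  obtain ⟨z, hzd⟩ : ∃ z, z = S.α (S.σ y) := ⟨_, rfl⟩
  have hy' : ¬ S.Bg y := by rw [hyd]; exact hy
  have hαinj : Function.Injective S.α := Function.LeftInverse.injective S.αα
  have hψinj : ∀ a b, S.α (S.σ a) = S.α (S.σ b) → a = b := fun a b h => S.σ.injective (hαinj h)
  have hxy : x ≠ y := fun h => hy' (h ▸ hx)
  have hyz : y ≠ z := by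
    intro h; rw [hzd] at h; nth_rw 1 [hyd] at h; exact hxy (hψinj _ _ h)
  have hcy : S.cell y = S.cell x := by rw [hyd]; exact S.cellψ x
  have hcz : S.cell z = S.cell x := by rw [hzd, S.cellψ, hcy]
  have hxz : x ≠ z := by
    intro h
    have hc : ∀ u, S.cell u = S.cell x → u = x ∨ u = y := by
      intro u hu
      have := S.cell_trans x u hu.symm
      induction this with
      | refl => left; rfl
      | tail hab hbc ih =>
        rename_i b c
        have hb : S.cell b = S.cell x := by rw [← hu, hbc, S.cellψ]
        rcases ih hb with rfl | rfl
        · right; rw [hbc, hyd]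
        · left; rw [hbc, ← hzd, h]
    have h3 := S.three x hb
    have : ∀ a b : {u // S.cell u = S.cell x ∧ ¬ S.Bg u}, a = b := by
      rintro ⟨a, ha, ha'⟩ ⟨b, hb, hb'⟩
      rcases hc a ha with rfl | rfl
      · exact absurd hx ha'
      rcases hc b hb with rfl | rfl
      · exact absurd hx hb'
      rfl
    have : Subsingleton {u // S.cell u = S.cell x ∧ ¬ S.Bg u} := ⟨this⟩
    have := Finite.card_le_one_iff_subsingleton.2 this
    omega
  have fcy : E.angleFace (S.ang y) = E.angleFace (S.ang x) := by rw [hyd, S.fcψ]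
  have fcz : E.angleFace (S.ang z) = E.angleFace (S.ang x) := by rw [hzd, S.fcψ, fcy]
  have hb' : E.angleFace (S.ang x) ≠ E.outer := hb
  obtain ⟨an, hand⟩ : ∃ an : S.D ⊕ Bool → G.Dart,
      an = Sum.elim S.ang (fun b => if b then S.ang z else S.ang x) := ⟨_, rfl⟩
  have an1 : ∀ u, an (Sum.inl u) = S.ang u := by simp [hand]
  have an2 : an (Sum.inr false) = S.ang x := by simp [hand]
  have an3 : an (Sum.inr true) = S.ang z := by simp [hand]
  obtain ⟨bg, bgd⟩ : ∃ bg : S.D ⊕ Bool → Prop,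
      bg = Sum.elim (fun u => S.Bg u ∧ u ≠ x ∧ u ≠ z) (fun b => b = true ∧ S.Bg z) := ⟨_, rfl⟩
  have bg1 : ∀ u, bg (Sum.inl u) ↔ S.Bg u ∧ u ≠ x ∧ u ≠ z := by simp [bgd]
  have bg2 : ¬ bg (Sum.inr false) := by simp [bgd]
  have bg3 : bg (Sum.inr true) ↔ S.Bg z := by simp [bgd]
  obtain ⟨ow, owd⟩ : ∃ ow : S.D ⊕ Bool → Prop,
      ow = Sum.elim S.own (fun b => b = false) := ⟨_, rfl⟩
  have ow1 : ∀ u, ow (Sum.inl u) ↔ S.own u := by simp [owd]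
  have ow2 : ow (Sum.inr false) := by simp [owd]
  have ow3 : ¬ ow (Sum.inr true) := by simp [owd]
  obtain ⟨ce, ced⟩ : ∃ ce : S.D ⊕ Bool → Option S.C,
      ce = Sum.elim (fun u => if u = y ∨ u = z then none else some (S.cell u))
        (fun b => if b then some (S.cell z) else none) := ⟨_, rfl⟩
  have ce1 : ∀ u, u ≠ y → u ≠ z → ce (Sum.inl u) = some (S.cell u) := by
    intro u h1 h2; simp [ced, h1, h2]
  have ce2 : ce (Sum.inr false) = none := by simp [ced]
  have ce3 : ce (Sum.inr true) = some (S.cell z) := by simp [ced]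
  have ce4 : ce (Sum.inl y) = none := by simp [ced]
  have ce5 : ce (Sum.inl z) = none := by simp [ced]
  have ψ1 : ∀ u, u ≠ x → u ≠ z → stepα S (stepσ S x z (Sum.inl u)) = Sum.inl (S.α (S.σ u)) := by
    intro u h1 h2; rw [stepσ_of_ne S h1 h2]; rfl
  have ψx : stepα S (stepσ S x z (Sum.inl x)) = Sum.inr true := by
    rw [stepσ_x S hxz]; rfl
  have ψz : stepα S (stepσ S x z (Sum.inl z)) = Sum.inr false := by
    rw [stepσ_z S]; rfl
  have ψp : stepα S (stepσ S x z (Sum.inr false)) = Sum.inl y := by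
    rw [stepσ_p S, hyd]; rfl
  have ψq : stepα S (stepσ S x z (Sum.inr true)) = Sum.inl (S.α (S.σ z)) := by
    rw [stepσ_q S hxz]; rfl
  have cases' : ∀ a : S.D ⊕ Bool, a = Sum.inl x ∨ a = Sum.inl y ∨ a = Sum.inl z ∨
      a = Sum.inr false ∨ a = Sum.inr true ∨ ∃ u, u ≠ x ∧ u ≠ y ∧ u ≠ z ∧ a = Sum.inl u := by
    rintro (u | b)
    · by_cases h1 : u = x
      · simp [h1]
      by_cases h2 : u = y
      · simp [h2]
      by_cases h3 : u = z
      · simp [h3]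
      right; right; right; right; right; exact ⟨u, h1, h2, h3, rfl⟩
    · cases b <;> simp
  obtain ⟨β, βd⟩ : ∃ β : S.D → S.D ⊕ Bool,
    β = fun u => if u = y then Sum.inl x else if u = z then Sum.inr true else Sum.inl u := ⟨_, rfl⟩
  have βy : β y = Sum.inl x := by simp [βd]
  have βz : β z = Sum.inr true := by simp [βd, hyz.symm]
  have βu : ∀ u, u ≠ y → u ≠ z → β u = Sum.inl u := by intro u h1 h2; simp [βd, h1, h2]
  have hlift : ∀ u w, Relation.ReflTransGen (fun a b => b = S.α (S.σ a)) u w →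
      Relation.ReflTransGen (fun a b => b = stepα S (stepσ S x z a)) (β u) (β w) := by
    intro u w h
    induction h with
    | refl => exact Relation.ReflTransGen.refl
    | tail hab hbc ih =>
      rename_i b c
      refine ih.trans ?_
      subst hbc
      by_cases h1 : b = x
      · rw [h1, ← hyd, βy, βu x hxy hxz]
      have h5 : S.α (S.σ b) ≠ y := by
        intro h; rw [hyd] at h; exact h1 (hψinj _ _ h)
      by_cases h2 : b = y
      · rw [h2, ← hzd, βy, βz]; exact Relation.ReflTransGen.single ψx.symm
      have h6 : S.α (S.σ b) ≠ z := by
        intro h; rw [hzd] at h; exact h2 (hψinj _ _ h)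
      rw [βu _ h5 h6]
      by_cases h3 : b = z
      · subst h3; rw [βz]; exact Relation.ReflTransGen.single ψq.symm
      rw [βu b h2 h3]; exact Relation.ReflTransGen.single (ψ1 b h1 h3).symm
  have hsome : ∀ a c, ce a = some c → ∃ u, S.cell u = c ∧ β u = a := by
    intro a c h
    rcases cases' a with rfl | rfl | rfl | rfl | rfl | ⟨u, h1, h2, h3, rfl⟩
    · rw [ce1 x hxy hxz] at h; exact ⟨x, by simpa using h, βu x hxy hxz⟩
    · simp [ce4] at h
    · simp [ce5] at h
    · simp [ce2] at h
    · rw [ce3] at h; exact ⟨z, by simpa using h, βz⟩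
    · rw [ce1 u h2 h3] at h; exact ⟨u, by simpa using h, βu u h2 h3⟩
  have hnone : ∀ a, ce a = none → a = Sum.inl y ∨ a = Sum.inl z ∨ a = Sum.inr false := by
    intro a h
    rcases cases' a with rfl | rfl | rfl | rfl | rfl | ⟨u, h1, h2, h3, rfl⟩
    · rw [ce1 x hxy hxz] at h; simp at h
    · simp
    · simp
    · simp
    · simp [ce3] at h
    · rw [ce1 u h2 h3] at h; simp at h
  have hβce : ∀ u, ce (β u) = some (S.cell u) := by
    intro u
    by_cases h1 : u = y
    · rw [h1, βy, ce1 x hxy hxz, hcy]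
    by_cases h2 : u = z
    · rw [h2, βz, ce3]
    rw [βu u h1 h2, ce1 u h1 h2]
  have c2 : ∀ Q : E.Face → Prop, Nat.card {a // Q (E.angleFace (an a)) ∧ bg a} +
      (if Q (E.angleFace (S.ang x)) then 1 else 0) =
      Nat.card {a // Q (E.angleFace (S.ang a)) ∧ S.Bg a} := by
    intro Q
    simp only [Nat.card_eq_fintype_card, Fintype.card_subtype, Finset.card_filter]
    rw [Fintype.sum_sum_type]
    simp only [an1, Fintype.sum_bool, an2, an3, fcz, bg1, bg2, bg3]
    rw [← Finset.add_sum_erase Finset.univ (fun a => if Q (E.angleFace (S.ang a)) ∧ S.Bg a then 1 else 0) (Finset.mem_univ x),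
      ← Finset.add_sum_erase (Finset.univ.erase x) (fun a => if Q (E.angleFace (S.ang a)) ∧ S.Bg a then 1 else 0) (a := z) (by simp [hxz.symm])]
    rw [← Finset.add_sum_erase Finset.univ _ (Finset.mem_univ x),
      ← Finset.add_sum_erase (Finset.univ.erase x) _ (a := z) (by simp [hxz.symm])]
    rw [Finset.sum_congr rfl (g := fun a => if Q (E.angleFace (S.ang a)) ∧ S.Bg a then 1 else 0)]
    · simp [hx, fcz]; ring
    · intro a ha
      simp only [Finset.mem_erase, Finset.mem_univ] at ha
      simp [ha.1, ha.2.1]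
  refine ⟨{
    D := S.D ⊕ Bool
    fin := inferInstance
    dec := inferInstance
    σ := stepσ S x z
    α := stepα S
    ι := fun d => Sum.inl (S.ι d)
    ang := an
    own := ow
    αα := ?_
    α_ne := ?_
    ang_ι := fun d => by rw [an1, S.ang_ι]
    α_ι := fun d => by simp [stepα, S.α_ι]
    angσ := ?_
    reach := ?_
    fcψ := ?_
    out := ?_
    own_or := ?_
    own_prop := ?_
    own_uniq := ?_
    Bg := bg
    C := Option S.C
    cell := ce
    Bg_big := ?_
    Bg_uniq := ?_
    Bg_own := ?_
    cellψ := ?_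
    cell_trans := ?_
    three := ?_
    cnt := ?_ }, ?_⟩
  · rintro (u | b) <;> simp [stepα, S.αα]
  · rintro (u | b) <;> simp [stepα, S.α_ne]
  · -- angσ
    have key : ∀ u, (Sum.inl (S.σ u) : S.D ⊕ Bool) = Sum.inl (S.ι (E.rot (S.ang u))) ∨
        ((Sum.inl (S.σ u) : S.D ⊕ Bool) ∉ Set.range (fun d => (Sum.inl (S.ι d) : S.D ⊕ Bool)) ∧
          an (Sum.inl (S.σ u)) = S.ang u) := by
      intro u
      rcases S.angσ u with h | ⟨h, h'⟩
      · left; rw [h]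
      · right; refine ⟨?_, by rw [an1, h']⟩
        rintro ⟨d, hd⟩; exact h ⟨d, by simpa using hd⟩
    intro a
    rcases cases' a with rfl | rfl | rfl | rfl | rfl | ⟨u, h1, h2, h3, rfl⟩
    · right; rw [stepσ_x S hxz, an1, an2]; simp
    · rw [stepσ_of_ne S hxy.symm hyz, an1]; exact key y
    · right; rw [stepσ_z S, an1, an3]; simp
    · rw [stepσ_p S, an2]; exact key x
    · rw [stepσ_q S hxz, an3]; exact key z
    · rw [stepσ_of_ne S h1 h3, an1]; exact key u
  · -- reach
    have key : ∀ u w, Relation.ReflTransGen (fun a b => b = S.σ a) u w →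
        Relation.ReflTransGen (fun a b => b = stepσ S x z a) (Sum.inl u) (Sum.inl w) := by
      intro u w h
      induction h with
      | refl => exact Relation.ReflTransGen.refl
      | tail hab hbc ih =>
        rename_i b c
        subst hbc
        by_cases h1 : b = x
        · subst h1; exact (ih.tail (stepσ_x S hxz).symm).tail (stepσ_p S).symm
        by_cases h2 : b = z
        · subst h2; exact (ih.tail (stepσ_z S).symm).tail (stepσ_q S hxz).symm
        exact ih.tail (stepσ_of_ne S h1 h2).symm
    rintro (u | b)
    · rw [an1]; exact key _ _ (S.reach u)
    · cases b
      · rw [an2]; exact (key _ _ (S.reach x)).tail (stepσ_x S hxz).symm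
      · rw [an3]; exact (key _ _ (S.reach z)).tail (stepσ_z S).symm
  · intro a
    rcases cases' a with rfl | rfl | rfl | rfl | rfl | ⟨u, h1, h2, h3, rfl⟩
    · rw [ψx, an3, an1, fcz]
    · rw [ψ1 y hxy.symm hyz, an1, an1, S.fcψ]
    · rw [ψz, an2, an1, fcz]
    · rw [ψp, an1, an2, fcy]
    · rw [ψq, an1, an3, S.fcψ]
    · rw [ψ1 u h1 h3, an1, an1, S.fcψ]
  · rintro (u | b) h
    · rw [an1] at h ⊢; rw [← S.out u h]
    · cases b
      · rw [an2] at h; exact absurd h hb'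
      · rw [an3, fcz] at h; exact absurd h hb'
  · rintro (u | b) h
    · have := S.own_or u (by rintro ⟨d, rfl⟩; exact h ⟨d, rfl⟩)
      rw [ow1]; simpa [stepα, ow1] using this
    · cases b
      · left; exact ow2
      · right; exact ow2
  · rintro (u | b) h
    · rw [ow1] at h
      obtain ⟨h1, h2, h3⟩ := S.own_prop u h
      rw [an1]; exact ⟨by rintro ⟨d, hd⟩; exact h1 ⟨d, by simpa using hd⟩, h2, h3⟩
    · cases b
      · rw [an2]; exact ⟨by rintro ⟨d, hd⟩; simp at hd, S.Bg_big x hx, hb'⟩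
      · exact absurd h ow3
  · rintro (u | b) (w | b') h h'
    · rw [ow1] at h h'; rw [an1, an1]; intro h''; rw [S.own_uniq u w h h' h'']
    · cases b'
      · rw [ow1] at h; rw [an1, an2]; intro h''; exact absurd h''.symm (fun e => S.Bg_own x u hx h e)
      · exact absurd h' ow3
    · cases b
      · rw [ow1] at h'; rw [an1, an2]; intro h''; exact absurd h'' (fun e => S.Bg_own x w hx h' e)
      · exact absurd h ow3
    · cases b
      · cases b'
        · intro; rfl
        · exact absurd h' ow3
      · exact absurd h ow3
  · rintro (u | b) h
    · rw [bg1] at h; rw [an1]; exact S.Bg_big u h.1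
    · cases b
      · exact absurd h bg2
      · rw [an3]; exact S.Bg_big z (bg3.1 h)
  · rintro (u | b) (w | b') h h'
    · rw [bg1] at h h'; rw [an1, an1]; intro h''; rw [S.Bg_uniq u w h.1 h'.1 h'']
    · cases b'
      · exact absurd h' bg2
      · rw [bg1] at h; rw [an1, an3]; intro h''
        exact absurd (S.Bg_uniq _ _ h.1 (bg3.1 h') h'') h.2.2
    · cases b
      · exact absurd h bg2
      · rw [bg1] at h'; rw [an1, an3]; intro h''
        exact absurd (S.Bg_uniq _ _ h'.1 (bg3.1 h) h''.symm) h'.2.2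
    · cases b
      · exact absurd h bg2
      · cases b'
        · exact absurd h' bg2
        · intro; rfl
  · rintro (u | b) (w | b') h h'
    · rw [bg1] at h; rw [ow1] at h'; rw [an1, an1]; exact S.Bg_own u w h.1 h'
    · cases b'
      · rw [bg1] at h; rw [an1, an2]; intro h''
        exact h.2.1 (S.Bg_uniq _ _ h.1 hx h'')
      · exact absurd h' ow3
    · cases b
      · exact absurd h bg2
      · rw [ow1] at h'; rw [an1, an3]; exact S.Bg_own z w (bg3.1 h) h'
    · cases b
      · exact absurd h bg2
      · cases b'
        · rw [an2, an3]; intro h''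
          exact hxz (S.Bg_uniq _ _ hx (bg3.1 h) h''.symm)
        · exact absurd h' ow3
  · intro a
    have key : ∀ u, u ≠ x → u ≠ y → ce (Sum.inl (S.α (S.σ u))) = some (S.cell u) := by
      intro u h1 h2
      rw [ce1, S.cellψ]
      · intro h; rw [hyd] at h; exact h1 (hψinj _ _ h)
      · intro h; rw [hzd] at h; exact h2 (hψinj _ _ h)
    rcases cases' a with rfl | rfl | rfl | rfl | rfl | ⟨u, h1, h2, h3, rfl⟩
    · rw [ψx, ce3, ce1 x hxy hxz, hcz]
    · rw [ψ1 y hxy.symm hyz, ← hzd, ce5, ce4]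
    · rw [ψz, ce2, ce5]
    · rw [ψp, ce2, ce4]
    · rw [ψq, ce3, key z hxz.symm hyz.symm]
    · rw [ψ1 u h1 h3, key u h1 h2, ce1 u h2 h3]
  · intro a b h
    rcases hc : ce a with _ | c
    · have r1 : Relation.ReflTransGen (fun a b => b = stepα S (stepσ S x z a)) (Sum.inl y) (Sum.inl z) :=
        Relation.ReflTransGen.single (by rw [ψ1 y hxy.symm hyz, ← hzd])
      have r2 : Relation.ReflTransGen (fun a b => b = stepα S (stepσ S x z a)) (Sum.inl z) (Sum.inr false) :=
        Relation.ReflTransGen.single ψz.symm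
      have r3 : Relation.ReflTransGen (fun a b => b = stepα S (stepσ S x z a)) (Sum.inr false) (Sum.inl y) :=
        Relation.ReflTransGen.single ψp.symm
      have hb := hnone b (by rw [← h, hc])
      have ha := hnone a hc
      rcases ha with rfl | rfl | rfl <;> rcases hb with rfl | rfl | rfl
      · exact Relation.ReflTransGen.refl
      · exact r1
      · exact r1.trans r2
      · exact r2.trans r3
      · exact Relation.ReflTransGen.refl
      · exact r2
      · exact r3
      · exact r3.trans r1
      · exact Relation.ReflTransGen.refl
    · obtain ⟨u, hu, rfl⟩ := hsome a c hc
      obtain ⟨w, hw, rfl⟩ := hsome b c (by rw [← h, hc])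
      exact hlift u w (S.cell_trans u w (by rw [hu, hw]))
  · intro a ha
    rcases hc : ce a with _ | c
    · have : {b | ce b = none ∧ ¬ bg b} = ((({Sum.inl y, Sum.inl z, Sum.inr false} : Finset (S.D ⊕ Bool))) : Set _) := by
        ext b
        simp only [Set.mem_ofPred_eq, Finset.coe_insert, Finset.coe_singleton, Set.mem_insert_iff,
          Set.mem_singleton_iff]
        constructor
        · rintro ⟨h, -⟩; exact hnone b h
        · rintro (rfl | rfl | rfl)
          · exact ⟨ce4, by rw [bg1]; tauto⟩
          · exact ⟨ce5, by rw [bg1]; tauto⟩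
          · exact ⟨ce2, bg2⟩
      have h2 : Nat.card {b | ce b = none ∧ ¬ bg b} = 3 := by
        rw [this]
        simp only [Nat.card_eq_fintype_card, Fintype.card_coe, SetLike.coe_sort_coe]
        rw [Finset.card_insert_of_notMem, Finset.card_insert_of_notMem, Finset.card_singleton]
        · simp
        · simp [hyz]
      exact h2
    · obtain ⟨u, hu, rfl⟩ := hsome a c hc
      have hfu : E.angleFace (S.ang u) ≠ E.outer := by
        by_cases h1 : u = y
        · rw [h1, fcy]; exact hb'
        by_cases h2 : u = z
        · rw [h2, fcz]; exact hb'
        rwa [βu u h1 h2, an1] at ha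
      rw [← S.three u hfu]
      have key : ∀ w, ¬ S.Bg w → ¬ bg (β w) := by
        intro w hw
        by_cases h1 : w = y
        · rw [h1, βy, bg1]; tauto
        by_cases h2 : w = z
        · rw [h2, βz, bg3, ← h2]; exact hw
        rw [βu w h1 h2, bg1]; tauto
      symm
      refine Nat.card_eq_of_bijective (fun w : {w // S.cell w = S.cell u ∧ ¬ S.Bg w} =>
        (⟨β w.1, by rw [hβce, w.2.1, hu], key _ w.2.2⟩ : {b // ce b = some c ∧ ¬ bg b})) ⟨?_, ?_⟩
      · rintro ⟨w, hw1, hw2⟩ ⟨w', hw1', hw2'⟩ h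
        have h : β w = β w' := by simpa using h
        have hwx : w ≠ x := fun e => hw2 (e ▸ hx)
        have hwx' : w' ≠ x := fun e => hw2' (e ▸ hx)
        have : w = w' := by
          by_cases a1 : w = y
          · by_cases b1 : w' = y
            · rw [a1, b1]
            by_cases b2 : w' = z
            · rw [a1, b2, βy, βz] at h; exact absurd h Sum.inl_ne_inr
            · rw [a1, βy, βu w' b1 b2] at h; exact absurd (Sum.inl_injective h).symm hwx'
          by_cases a2 : w = z
          · by_cases b1 : w' = y
            · rw [a2, b1, βy, βz] at h; exact absurd h Sum.inr_ne_inl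
            by_cases b2 : w' = z
            · rw [a2, b2]
            · rw [a2, βz, βu w' b1 b2] at h; exact absurd h Sum.inr_ne_inl
          rw [βu w a1 a2] at h
          by_cases b1 : w' = y
          · rw [b1, βy] at h; exact absurd (Sum.inl_injective h) hwx
          by_cases b2 : w' = z
          · rw [b2, βz] at h; exact absurd h Sum.inl_ne_inr
          rw [βu w' b1 b2] at h
          exact Sum.inl_injective h
        simp [this]
      · rintro ⟨b, hb1, hb2⟩
        rcases cases' b with rfl | rfl | rfl | rfl | rfl | ⟨w, h1, h2, h3, rfl⟩
        · rw [ce1 x hxy hxz] at hb1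
          refine ⟨⟨y, ?_, hy'⟩, by simp [βy]⟩
          rw [hcy, hu]; simpa using hb1
        · simp [ce4] at hb1
        · simp [ce5] at hb1
        · simp [ce2] at hb1
        · rw [ce3] at hb1; rw [bg3] at hb2
          exact ⟨⟨z, by rw [hu]; simpa using hb1, hb2⟩, by simp [βz]⟩
        · rw [ce1 w h2 h3] at hb1
          refine ⟨⟨w, by rw [hu]; simpa using hb1, ?_⟩, by simp [βu w h2 h3]⟩
          intro h; exact hb2 ((bg1 w).2 ⟨h, h1, h3⟩)
  · intro P hP
    rw [← S.cnt P hP]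
    have c1 : Nat.card {a // E.angleFace (an a) = P} = Nat.card {a // E.angleFace (S.ang a) = P} +
        (if E.angleFace (S.ang x) = P then 2 else 0) := by
      simp only [Nat.card_eq_fintype_card, Fintype.card_subtype, Finset.card_filter]
      rw [Fintype.sum_sum_type]
      simp only [an1, Fintype.sum_bool, an2, an3, fcz]
      split_ifs <;> simp
    have c2 := c2 (fun F => F = P)
    rw [c1, ← c2]
    split_ifs <;> ring
  · have c2 := c2 (fun F => F ≠ E.outer)
    rw [if_pos hb'] at c2
    exact Nat.lt_of_succ_le c2.le
end step

end build

set_option linter.unusedSectionVars false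

/-- A triangulated map. -/
structure Tri {V : Type} {G : SimpleGraph V} (E : PlaneEmb G) (big : G.Dart → Prop) extends
    TMap E big where
  tri : ∀ x, E.angleFace (ang x) ≠ E.outer → α (σ (α (σ (α (σ x))))) = x
  cnt : ∀ P, P ≠ E.outer → Nat.card {x // E.angleFace (ang x) = P} =
      3 + 3 * Nat.card {d // E.angleFace d = P ∧ big d}

section build2
variable {V : Type} [Fintype V] [DecidableEq V] {G : SimpleGraph V} [DecidableRel G.Adj]
  {E : PlaneEmb G} {big : G.Dart → Prop}

lemma TSt.toTri (S : TSt E big) (h0 : ∀ x, S.fc x ≠ E.outer → ¬ S.Bg x) : Nonempty (Tri E big) := by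
  classical
  refine ⟨{ S.toTMap with tri := ?_, cnt := ?_ }⟩
  · intro x hx
    have hαinj : Function.Injective S.α := Function.LeftInverse.injective S.αα
    have hψinj : ∀ a b, S.α (S.σ a) = S.α (S.σ b) → a = b := fun a b h => S.σ.injective (hαinj h)
    have hclosed : ∀ (s : Finset S.D), x ∈ s → (∀ u ∈ s, S.α (S.σ u) ∈ s) → 3 ≤ s.card := by
      intro s hxs hs
      rw [← S.three x hx, Nat.card_eq_fintype_card, Fintype.card_subtype]
      apply Finset.card_le_card
      intro u hu
      simp only [Finset.mem_filter, Finset.mem_univ, true_and] at hu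
      have := S.cell_trans x u hu.1.symm
      clear hu
      induction this with
      | refl => exact hxs
      | tail _ hbc ih => rw [hbc]; exact hs _ ih
    have hfc : ∀ u, S.cell u = S.cell x → S.fc u ≠ E.outer := by
      intro u hu
      have := S.cell_trans x u hu.symm
      clear hu
      induction this with
      | refl => exact hx
      | tail _ hbc ih =>
        rw [hbc]; unfold TMap.fc; rw [S.fcψ]; exact ih
    have h3 : (Finset.univ.filter (fun u => S.cell u = S.cell x)).card = 3 := by
      rw [← S.three x hx, Nat.card_eq_fintype_card, Fintype.card_subtype]
      congr 1
      ext u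
      simp only [Finset.mem_filter, Finset.mem_univ, true_and]
      exact ⟨fun h => ⟨h, h0 u (hfc u h)⟩, fun h => h.1⟩
    set y := S.α (S.σ x) with hy
    set z := S.α (S.σ y) with hz
    have hxy : y ≠ x := by
      intro h
      have := hclosed {x} (by simp) (by intro u hu; simp at hu; subst hu; simp [← hy, h])
      simp at this
    have hyz : z ≠ y := fun h => hxy (hψinj _ _ h)
    have hzx : z ≠ x := by
      intro h
      have := hclosed {x, y} (by simp) (by
        intro u hu; simp at hu; rcases hu with rfl | rfl
        · simp [← hy]
        · rw [← hz, h]; simp)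
      have h2 := Finset.card_le_two (a := x) (b := y)
      omega
    have heq : ({x, y, z} : Finset S.D) = Finset.univ.filter (fun u => S.cell u = S.cell x) := by
      apply Finset.eq_of_subset_of_card_le
      · intro u hu
        simp only [Finset.mem_insert, Finset.mem_singleton] at hu
        simp only [Finset.mem_filter, Finset.mem_univ, true_and]
        rcases hu with rfl | rfl | rfl
        · rfl
        · exact S.cellψ _
        · rw [hz, S.cellψ, hy, S.cellψ]
      · rw [h3, Finset.card_eq_three.2 ⟨x, y, z, hxy.symm, hzx.symm, hyz.symm, rfl⟩]
    have : S.α (S.σ z) ∈ ({x, y, z} : Finset S.D) := by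
      rw [heq]
      simp only [Finset.mem_filter, Finset.mem_univ, true_and]
      rw [S.cellψ, hz, S.cellψ, hy, S.cellψ]
    simp only [Finset.mem_insert, Finset.mem_singleton] at this
    rcases this with h | h | h
    · exact h
    · exact absurd (hψinj _ _ h) hzx
    · exact absurd (hψinj _ _ h) hyz
  · intro P hP
    have := S.cnt P hP
    have h2 : Nat.card {x // E.angleFace (S.ang x) = P ∧ S.Bg x} = 0 := by
      rw [Nat.card_eq_zero]; left
      constructor
      rintro ⟨u, hu, hu'⟩
      exact h0 u (by rw [TMap.fc, hu]; exact hP) hu'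
    rw [h2] at this
    simpa using this

lemma exists_tri (h : IsCPTLabelling E big) : Nonempty (Tri E big) := by
  classical
  suffices H : ∀ n : ℕ, ∀ S : TSt E big, Nat.card {x // S.fc x ≠ E.outer ∧ S.Bg x} = n →
      Nonempty (Tri E big) from H _ (TSt.init h) rfl
  intro n
  induction n using Nat.strong_induction_on with
  | _ n ih =>
    intro S hS
    by_cases h0 : ∀ x, S.fc x ≠ E.outer → ¬ S.Bg x
    · exact S.toTri h0
    push Not at h0
    obtain ⟨x, hx, hbx⟩ := h0
    have : ∃ x, S.fc x ≠ E.outer ∧ S.Bg x ∧ ¬ S.Bg (S.ψ x) := by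
      by_contra hcon
      push Not at hcon
      have h3 := S.three x hx
      have : Nonempty {y // S.cell y = S.cell x ∧ ¬ S.Bg y} := by
        by_contra hne
        rw [not_nonempty_iff] at hne
        simp at h3
      obtain ⟨u, hu, hu'⟩ := this
      have := S.cell_trans x u hu.symm
      have key : S.fc u ≠ E.outer ∧ S.Bg u := by
        clear hu hu'
        induction this with
        | refl => exact ⟨hx, hbx⟩
        | tail _ hbc ih =>
          rw [hbc]; exact ⟨by unfold TMap.fc; rw [S.fcψ]; exact ih.1, hcon _ ih.1 ih.2⟩
      exact hu' key.2
    obtain ⟨x, hx, hbx, hn⟩ := this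
    obtain ⟨S', hS'⟩ := TSt.exists_step S x hbx hx hn
    exact ih _ (hS ▸ hS') S' rfl

end build2

set_option linter.unusedSectionVars false

namespace TMap
variable {V : Type} {G : SimpleGraph V} {E : PlaneEmb G} {big : G.Dart → Prop}
variable (T : TMap E big)

/-- outer corner -/
def isOut (x : T.D) : Prop := T.fc x = E.outer
/-- outer vertex -/
def OV (v : V) : Prop := ∃ x, T.isOut x ∧ T.src x = v
/-- corner inside a big angle -/
def Big (x : T.D) : Prop := big (T.ang x)
/-- active dart -/
def act (x : T.D) : Prop := ¬ PointedVx big (T.src x) ∨ T.Big x ∨ T.Big (T.σ.symm x)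

/-- the involution as a permutation -/
def αP : Equiv.Perm T.D := ⟨T.α, T.α, T.αα, T.αα⟩
/-- the face permutation -/
def ψP : Equiv.Perm T.D := T.σ.trans T.αP

@[simp] lemma αP_apply (x) : T.αP x = T.α x := rfl
@[simp] lemma ψP_apply (x) : T.ψP x = T.ψ x := rfl
lemma ψ_def (x) : T.ψ x = T.α (T.σ x) := rfl
@[simp] lemma ψP_symm_apply (x) : T.ψP.symm x = T.σ.symm (T.α x) := rfl
lemma ψ_inj {x y} (h : T.ψ x = T.ψ y) : x = y := T.ψP.injective h
lemma α_inj {x y} (h : T.α x = T.α y) : x = y := T.αP.injective h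
@[simp] lemma ψ_σsymm (x) : T.ψ (T.σ.symm x) = T.α x := by simp [ψ]
@[simp] lemma fc_ψ (x) : T.fc (T.ψ x) = T.fc x := T.fcψ x
lemma fc_α (x) : T.fc (T.α x) = T.fc (T.σ.symm x) := by rw [← ψ_σsymm, fc_ψ]
@[simp] lemma isOut_ψ (x) : T.isOut (T.ψ x) ↔ T.isOut x := by simp [isOut]

@[simp] lemma src_σ (x) : T.src (T.σ x) = T.src x := by
  unfold src
  rcases T.angσ x with h | ⟨-, h⟩
  · rw [h, T.ang_ι, E.rot_fst]
  · rw [h]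
@[simp] lemma src_σsymm (x) : T.src (T.σ.symm x) = T.src x := by
  rw [← src_σ]; simp
@[simp] lemma src_ι (d) : T.src (T.ι d) = d.fst := by simp [src, T.ang_ι]
@[simp] lemma tgt_ι (d) : T.tgt (T.ι d) = d.snd := by simp [tgt, T.α_ι]
@[simp] lemma src_α (x) : T.src (T.α x) = T.tgt x := rfl
@[simp] lemma tgt_α (x) : T.tgt (T.α x) = T.src x := by simp [tgt, T.αα]
lemma src_ψ (x) : T.src (T.ψ x) = T.tgt (T.σ x) := rfl
@[simp] lemma tgt_ψ (x) : T.tgt (T.ψ x) = T.src x := by simp [ψ]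
lemma ι_inj {d d'} (h : T.ι d = T.ι d') : d = d' := by rw [← T.ang_ι d, h, T.ang_ι]

lemma rtg_sameCycle {x y : T.D} (h : Relation.ReflTransGen (fun a b => b = T.σ a) x y) :
    T.σ.SameCycle x y := by
  induction h with
  | refl => exact Equiv.Perm.SameCycle.refl _ _
  | tail _ hbc ih => rw [hbc]; exact ih.apply_right

lemma sameCycle_ang (x : T.D) : T.σ.SameCycle (T.ι (T.ang x)) x := T.rtg_sameCycle (T.reach x)

lemma sameCycle_rot (d : G.Dart) : T.σ.SameCycle (T.ι d) (T.ι (E.rot d)) := by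
  set y := T.ι (E.rot d) with hy
  have h : T.ang (T.σ.symm y) = d := by
    rcases T.angσ (T.σ.symm y) with h | ⟨h, -⟩
    · rw [Equiv.apply_symm_apply] at h
      exact (E.rot.injective (T.ι_inj h)).symm
    · rw [Equiv.apply_symm_apply] at h; exact absurd ⟨_, hy.symm⟩ h
  have := T.sameCycle_ang (T.σ.symm y)
  rw [h] at this
  have := this.apply_right
  simpa using this

lemma sameCycle_iff {x y : T.D} : T.σ.SameCycle x y ↔ T.src x = T.src y := by
  constructor
  · rintro ⟨n, rfl⟩
    have : ∀ n : ℕ, ∀ x, T.src ((T.σ ^ n) x) = T.src x := by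
      intro n; induction n with
      | zero => simp
      | succ n ih => intro x; rw [pow_succ', Equiv.Perm.mul_apply, src_σ, ih]
    obtain ⟨m, rfl | rfl⟩ := n.eq_nat_or_neg
    · simp [this]
    · have h2 := this m ((T.σ ^ (-(m:ℤ))) x)
      rw [← h2]; simp
  · intro h
    obtain ⟨n, hn⟩ := E.rot_vertex (T.ang x) (T.ang y) h
    have key : ∀ n : ℕ, T.σ.SameCycle (T.ι (T.ang x)) (T.ι ((E.rot ^ n) (T.ang x))) := by
      intro n; induction n with
      | zero => exact Equiv.Perm.SameCycle.refl _ _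
      | succ n ih =>
        rw [pow_succ', Equiv.Perm.mul_apply]; exact ih.trans (T.sameCycle_rot _)
    have := key n
    rw [hn] at this
    exact ((T.sameCycle_ang x).symm.trans this).trans (T.sameCycle_ang y)

lemma rtg_of_src {x y : T.D} (h : T.src x = T.src y) :
    Relation.ReflTransGen (fun a b => b = T.σ a) x y := by
  obtain ⟨n, hn⟩ := (T.sameCycle_iff.2 h).exists_nat_pow_eq
  have key : ∀ n : ℕ, Relation.ReflTransGen (fun a b => b = T.σ a) x ((T.σ ^ n) x) := by
    intro n; induction n with
    | zero => exact Relation.ReflTransGen.refl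
    | succ n ih => rw [pow_succ', Equiv.Perm.mul_apply]; exact ih.tail rfl
  have := key n
  rwa [hn] at this

/-- induction around a vertex -/
lemma orbit_ind {p : T.D → Prop} {x y : T.D} (h : T.src x = T.src y) (hx : p x)
    (hs : ∀ z, T.src z = T.src x → p z → p (T.σ z)) : p y := by
  have := T.rtg_of_src h
  have : p y ∧ T.src y = T.src x := by
    clear h
    induction this with
    | refl => exact ⟨hx, rfl⟩
    | tail _ hbc ih =>
      rw [hbc]; exact ⟨hs _ ih.2 ih.1, by rw [src_σ, ih.2]⟩
  exact this.1

lemma out_range {x} (h : T.isOut x) : x = T.ι (T.ang x) := T.out x h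

lemma σ_out {x} (h : T.isOut x) : T.σ x = T.ι (E.rot (T.ang x)) := by
  rcases T.angσ x with h' | ⟨h1, h2⟩
  · exact h'
  · exact absurd ⟨_, (T.out (T.σ x) (by rw [h2]; exact h)).symm⟩ h1

lemma out_Big (hc : IsCPTLabelling E big) {x} (h : T.isOut x) : T.Big x := hc.outer_big _ h

lemma out_uniq (hc : IsCPTLabelling E big) {x y} (hx : T.isOut x) (hy : T.isOut y)
    (h : T.src x = T.src y) : x = y := by
  rw [T.out_range hx, T.out_range hy, hc.one_big _ _ (T.out_Big hc hx) (T.out_Big hc hy) h]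

lemma Big_ang_uniq (hc : IsCPTLabelling E big) {x y} (hx : T.Big x) (hy : T.Big y)
    (h : T.src x = T.src y) : T.ang x = T.ang y := hc.one_big _ _ hx hy h

lemma own_Big {x} (h : T.own x) : T.Big x := (T.own_prop x h).2.1

lemma own_not_OV (hc : IsCPTLabelling E big) {x} (h : T.own x) : ¬ T.OV (T.src x) := by
  rintro ⟨y, hy, hyx⟩
  have := T.Big_ang_uniq hc (T.out_Big hc hy) (T.own_Big h) hyx
  have h2 := (T.own_prop x h).2.2
  rw [← this] at h2
  exact h2 hy

lemma OV_pointed (hc : IsCPTLabelling E big) {v} (h : T.OV v) : PointedVx big v := by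
  obtain ⟨x, hx, rfl⟩ := h
  exact ⟨T.ang x, T.out_Big hc hx, rfl⟩

lemma Big_pointed {x} (h : T.Big x) : PointedVx big (T.src x) := ⟨T.ang x, h, rfl⟩

lemma pointed_iff {v} : PointedVx big v ↔ ∃ x, T.Big x ∧ T.src x = v := by
  constructor
  · rintro ⟨d, hd, rfl⟩; exact ⟨T.ι d, by simpa [Big, T.ang_ι] using hd, by simp⟩
  · rintro ⟨x, hx, rfl⟩; exact T.Big_pointed hx

lemma out_σsymm_range {x} (h : T.isOut x) : T.σ.symm (T.α x) = T.ι (T.ang (T.σ.symm (T.α x))) := by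
  apply T.out
  have : T.isOut (T.ψ (T.σ.symm (T.α x))) := by simpa [T.αα] using h
  exact (T.isOut_ψ _).1 this

lemma exists_out [Finite G.Dart] : ∃ x, T.isOut x := by
  obtain ⟨d, hd⟩ := Quotient.exists_rep E.outer
  refine ⟨T.ι d.symm, ?_⟩
  simp only [isOut, fc, T.ang_ι, PlaneEmb.angleFace, SimpleGraph.Dart.symm_symm]
  exact hd

/-- connectivity induction over vertices -/
lemma vert_ind {p : V → Prop} {v w : V} (hv : p v) (hs : ∀ x, p (T.src x) → p (T.tgt x)) : p w := by
  obtain ⟨W⟩ := E.connected.preconnected v w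
  induction W with
  | nil => exact hv
  | cons hadj _ ih =>
    apply ih
    have := hs (T.ι ⟨(_, _), hadj⟩) (by simpa using hv)
    simpa using this

lemma exists_dart [Finite G.Dart] (v : V) : ∃ x, T.src x = v := by
  obtain ⟨x, hx⟩ := T.exists_out
  exact T.vert_ind (p := fun v => ∃ x, T.src x = v) (v := T.src x) ⟨x, rfl⟩
    (fun y _ => ⟨T.α y, rfl⟩)

end TMap

set_option linter.unusedSectionVars false

namespace Tri
variable {V : Type} [Fintype V] [DecidableEq V] {G : SimpleGraph V} [DecidableRel G.Adj]
  {E : PlaneEmb G} {big : G.Dart → Prop}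
variable (T : Tri E big)

lemma ψ3 {x} (h : ¬ T.isOut x) : T.ψ (T.ψ (T.ψ x)) = x := T.tri x h

lemma ψ3_symm {x} (h : ¬ T.isOut x) : T.σ.symm (T.α x) = T.ψ (T.ψ x) := by
  have : T.ψP.symm x = T.ψ (T.ψ x) := by
    rw [Equiv.symm_apply_eq]; exact (T.ψ3 h).symm
  exact this

lemma src_ψψ {x} (h : ¬ T.isOut x) : T.src (T.ψ (T.ψ x)) = T.tgt x := by
  rw [← T.ψ3_symm h]; simp

lemma tgt_σψ {x} (h : ¬ T.isOut x) : T.tgt (T.σ (T.ψ x)) = T.tgt x := by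
  rw [← T.src_ψψ h]; rfl

/-- corners of bounded triangles touching `R` -/
def TC (R : V → Prop) (x : T.D) : Prop :=
  ¬ T.isOut x ∧ (R (T.src x) ∨ R (T.tgt x) ∨ R (T.tgt (T.σ x)))

lemma TC_ψ {R : V → Prop} {x} (h : T.TC R x) : T.TC R (T.ψ x) := by
  obtain ⟨h0, h⟩ := h
  refine ⟨by simpa using h0, ?_⟩
  rw [T.src_ψ, T.tgt_ψ, T.tgt_σψ h0]
  tauto

lemma TC_ψ_iff {R : V → Prop} {x} : T.TC R (T.ψ x) ↔ T.TC R x := by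
  refine ⟨fun h => ?_, T.TC_ψ⟩
  have := T.TC_ψ (T.TC_ψ h)
  rwa [T.ψ3 (by have := h.1; simpa using this)] at this

set_option maxHeartbeats 1000000 in
lemma euler_ineq (R : V → Prop) (hW : ∃ w, ¬ R w)
    (hR : ∀ v, R v → ∃ o, T.OV o ∧ R o ∧
      Relation.ReflTransGen (fun a b => R b ∧ ∃ x, T.src x = a ∧ T.tgt x = b) o v) :
    6 * Nat.card {v // R v} + 2 * Nat.card {x // T.TC R x} ≤
      3 * Nat.card {x // R (T.src x) ∨ R (T.tgt x)} := by
  classical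
  let Q := Quotient (Equiv.Perm.SameCycle.setoid T.ψP)
  have : Finite Q := Quotient.finite _
  let mk : T.D → Q := Quotient.mk _
  have mkψ : ∀ x, mk (T.ψ x) = mk x := fun x => Quotient.sound
    (s := Equiv.Perm.SameCycle.setoid T.ψP) ⟨-1, by simp [TMap.ψ, T.αα]⟩
  let TQ := {q : Q // ∃ x, T.TC R x ∧ mk x = q}
  have hmkeq : ∀ x y, T.TC R x → mk y = mk x → y = x ∨ y = T.ψ x ∨ y = T.ψ (T.ψ x) := by
    intro x y hx h
    have h1 : T.ψP.SameCycle x y := (Quotient.exact h).symm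
    obtain ⟨n, hn⟩ := h1.exists_nat_pow_eq
    have key : ∀ n : ℕ, (T.ψP ^ n) x = x ∨ (T.ψP ^ n) x = T.ψ x ∨ (T.ψP ^ n) x = T.ψ (T.ψ x) := by
      intro n; induction n with
      | zero => left; rfl
      | succ n ih =>
        rw [pow_succ', Equiv.Perm.mul_apply]
        rcases ih with h | h | h
        · rw [h]; right; left; rfl
        · rw [h]; right; right; rfl
        · rw [h]; left; exact T.ψ3 hx.1
    rw [← hn]; exact key n
  have hcount : Nat.card {x // T.TC R x} ≤ 3 * Nat.card TQ := by
    have : Fintype Q := Fintype.ofFinite _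
    rw [Nat.card_eq_fintype_card, Nat.card_eq_fintype_card, Fintype.card_subtype, Fintype.card_subtype]
    have h1 := Finset.card_le_mul_card_image (f := mk) (Finset.univ.filter (fun x => T.TC R x)) 3 (by
      intro q hq
      obtain ⟨x, hx, rfl⟩ := Finset.mem_image.1 hq
      have hx := (Finset.mem_filter.1 hx).2
      refine (Finset.card_le_card (t := {x, T.ψ x, T.ψ (T.ψ x)}) ?_).trans Finset.card_le_three
      intro y hy
      simp only [Finset.mem_insert, Finset.mem_singleton]
      exact hmkeq x y hx (Finset.mem_filter.1 hy).2)
    refine h1.trans (Nat.mul_le_mul_left _ (Finset.card_le_card ?_))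
    intro q hq
    obtain ⟨x, hx, rfl⟩ := Finset.mem_image.1 hq
    exact Finset.mem_filter.2 ⟨Finset.mem_univ _, x, (Finset.mem_filter.1 hx).2, rfl⟩
  let fe := Fintype.equivFin T.D
  let ER := {x : T.D // (R (T.src x) ∨ R (T.tgt x)) ∧ fe x < fe (T.α x)}
  have hRD : Nat.card {x // R (T.src x) ∨ R (T.tgt x)} = 2 * Nat.card ER := by
    have e1 : Nat.card {x // R (T.src x) ∨ R (T.tgt x)} = Nat.card (ER ⊕
        {x : T.D // (R (T.src x) ∨ R (T.tgt x)) ∧ ¬ fe x < fe (T.α x)}) := by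
      rw [Nat.card_sum]
      simp only [Nat.card_eq_fintype_card, Fintype.card_subtype, ER]
      rw [← Finset.card_filter_add_card_filter_not (s := Finset.univ.filter
        (fun x => R (T.src x) ∨ R (T.tgt x))) (p := fun x => fe x < fe (T.α x))]
      simp only [Finset.filter_filter]
    have e2 : Nat.card ER = Nat.card {x : T.D // (R (T.src x) ∨ R (T.tgt x)) ∧ ¬ fe x < fe (T.α x)} := by
      refine Nat.card_congr (T.αP.subtypeEquiv ?_)
      intro x
      simp only [TMap.αP_apply, TMap.src_α, TMap.tgt_α, T.αα, not_lt]
      have : fe x ≠ fe (T.α x) := fun h => T.α_ne x (fe.injective h).symm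
      constructor
      · rintro ⟨h1, h2⟩; exact ⟨h1.symm, h2.le⟩
      · rintro ⟨h1, h2⟩; exact ⟨h1.symm, lt_of_le_of_ne h2 this⟩
    rw [e1, Nat.card_sum, ← e2]; ring
  let gx : ({v // R v} → ℝ) → V → ℝ := fun g v => if h : R v then g ⟨v, h⟩ else 0
  let cx : (TQ → ℝ) → T.D → ℝ := fun c x => if h : T.TC R x then c ⟨mk x, x, h, rfl⟩ else 0
  have cxψ : ∀ c x, cx c (T.ψ x) = cx c x := by
    intro c x
    simp only [cx]
    by_cases h : T.TC R x
    · rw [dif_pos h, dif_pos (T.TC_ψ h)]; congr 2; exact mkψ x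
    · rw [dif_neg h, dif_neg (fun h' => h (T.TC_ψ_iff.1 h'))]
  let Φ : (({v // R v} → ℝ) × (TQ → ℝ)) →ₗ[ℝ] (ER → ℝ) :=
    { toFun := fun p y => gx p.1 (T.tgt y.1) - gx p.1 (T.src y.1) + cx p.2 y.1 - cx p.2 (T.α y.1)
      map_add' := by
        intro p q; funext y
        simp only [gx, cx, Prod.fst_add, Prod.snd_add, Pi.add_apply]
        split_ifs <;> ring
      map_smul' := by
        intro r p; funext y
        simp only [gx, cx, Prod.smul_fst, Prod.smul_snd, Pi.smul_apply, smul_eq_mul, RingHom.id_apply]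
        split_ifs <;> ring }
  have hinj : Function.Injective Φ := by
    rw [← LinearMap.ker_eq_bot, LinearMap.ker_eq_bot']
    rintro ⟨g, c⟩ hgc
    have k1 : ∀ y : T.D, R (T.src y) ∨ R (T.tgt y) →
        gx g (T.tgt y) - gx g (T.src y) + cx c y - cx c (T.α y) = 0 := by
      intro y hy
      rcases lt_or_ge (fe y) (fe (T.α y)) with h | h
      · exact congrFun hgc ⟨y, hy, h⟩
      · have h : fe (T.α y) < fe (T.α (T.α y)) := by
          rw [T.αα]
          exact lt_of_le_of_ne h (fun h => T.α_ne y (fe.injective h))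
        have := congrFun hgc ⟨T.α y, by simpa using hy.symm, h⟩
        have this : gx g (T.tgt (T.α y)) - gx g (T.src (T.α y)) + cx c (T.α y) - cx c (T.α (T.α y)) = 0 := this
        rw [T.αα, TMap.tgt_α, TMap.src_α] at this
        linarith
    let e : T.D → ℝ := fun y => gx g (T.tgt y) - gx g (T.src y)
    have k2 : ∀ y, e y * e y = e y * cx c (T.α y) - e y * cx c y := by
      intro y
      by_cases hy : R (T.src y) ∨ R (T.tgt y)
      · have := k1 y hy
        have : e y = cx c (T.α y) - cx c y := by simp only [e]; linarith
        rw [← mul_sub, ← this]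
      · push Not at hy
        have : e y = 0 := by simp [e, gx, hy.1, hy.2]
        rw [this]; ring
    have k3 : ∑ y, e y * cx c y = 0 := by
      have s1 : ∑ y, gx g (T.tgt y) * cx c y = ∑ y, gx g (T.src y) * cx c y := by
        rw [← Equiv.sum_comp T.ψP]
        refine Finset.sum_congr rfl (fun y _ => ?_)
        rw [TMap.ψP_apply, TMap.tgt_ψ, cxψ]
      simp only [e, sub_mul, Finset.sum_sub_distrib]
      rw [s1, sub_self]
    have k4 : ∑ y, e y * cx c (T.α y) = 0 := by
      rw [← Equiv.sum_comp T.αP]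
      have : ∀ y, e (T.αP y) * cx c (T.α (T.αP y)) = - (e y * cx c y) := by
        intro y; simp only [e, TMap.αP_apply, TMap.tgt_α, TMap.src_α, T.αα]; ring
      simp only [this, Finset.sum_neg_distrib, k3, neg_zero]
    have k5 : ∀ y, e y = 0 := by
      have : ∑ y, e y * e y = 0 := by
        simp only [k2, Finset.sum_sub_distrib, k3, k4, sub_zero]
      have := (Finset.sum_eq_zero_iff_of_nonneg (fun y _ => mul_self_nonneg (e y))).1 this
      intro y; exact mul_self_eq_zero.1 (this y (Finset.mem_univ y))
    have k6 : ∀ v, gx g v = 0 := by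
      obtain ⟨w, hw⟩ := hW
      intro v
      refine T.vert_ind (p := fun v => gx g v = 0) (v := w) (by simp [gx, hw]) ?_
      intro x hx
      have := k5 x
      simp only [e] at this
      linarith
    have k7 : ∀ y : T.D, R (T.src y) ∨ R (T.tgt y) → cx c y = cx c (T.α y) := by
      intro y hy; have := k1 y hy; rw [k6, k6] at this; linarith
    have k8 : ∀ x y : T.D, R (T.src x) → T.src x = T.src y → cx c x = 0 → cx c y = 0 := by
      intro x y hx hxy h0
      refine T.orbit_ind (p := fun y => cx c y = 0) hxy h0 ?_
      intro z hz h
      rw [k7 (T.σ z) (by rw [TMap.src_σ, hz]; exact Or.inl hx), ← TMap.ψ_def, cxψ]; exact h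
    have k9 : ∀ v, R v → ∀ x, T.src x = v → cx c x = 0 := by
      intro v hv
      obtain ⟨o, ho, hRo, hrt⟩ := hR v hv
      have : R v ∧ ∀ x, T.src x = v → cx c x = 0 := by
        clear hv
        induction hrt with
        | refl =>
          obtain ⟨x, hx, rfl⟩ := ho
          refine ⟨hRo, fun y hy => k8 x y hRo hy.symm ?_⟩
          simp only [cx]; rw [dif_neg]; intro h; exact h.1 hx
        | tail _ hbc ih =>
          obtain ⟨hc, x, rfl, rfl⟩ := hbc
          refine ⟨hc, fun y hy => k8 (T.α x) y hc hy.symm ?_⟩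
          rw [← k7 x (Or.inr hc)]; exact ih.2 x rfl
      exact this.2
    refine Prod.ext ?_ ?_
    · funext v
      have := k6 v.1
      simp only [gx] at this
      rw [dif_pos v.2] at this
      exact this
    · funext q
      obtain ⟨q, x, hx, rfl⟩ := q
      have hval : ∀ y (hy : T.TC R y) (h : mk y = mk x), R (T.src y) → c ⟨mk x, x, hx, rfl⟩ = 0 := by
        intro y hy h hRy
        have := k9 _ hRy y rfl
        simp only [cx] at this
        rw [dif_pos hy] at this
        rw [← this]; congr 2; exact h.symm
      rcases hx.2 with h | h | h
      · exact hval x hx rfl h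
      · exact hval (T.ψ (T.ψ x)) (T.TC_ψ (T.TC_ψ hx)) (by rw [mkψ, mkψ]) (by rw [T.src_ψψ hx.1]; exact h)
      · exact hval (T.ψ x) (T.TC_ψ hx) (mkψ x) h
  have hfin := LinearMap.finrank_le_finrank_of_injective hinj
  have : Fintype TQ := Fintype.ofFinite _
  rw [Module.finrank_prod, Module.finrank_fintype_fun_eq_card, Module.finrank_fintype_fun_eq_card,
    Module.finrank_fintype_fun_eq_card] at hfin
  simp only [← Nat.card_eq_fintype_card] at hfin
  rw [hRD]
  omega

end Tri

set_option linter.unusedSectionVars false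

section nc
variable {α β : Type} [Finite α] [Finite β]
/-- number of elements satisfying a predicate -/
noncomputable def nc {α : Type} (p : α → Prop) : ℕ := Nat.card {x // p x}

lemma nc_mono {p q : α → Prop} (h : ∀ x, p x → q x) : nc p ≤ nc q :=
  Nat.card_le_card_of_injective (fun x : {x // p x} => (⟨x.1, h _ x.2⟩ : {x // q x}))
    (fun a b hab => by simpa [Subtype.ext_iff] using hab)

lemma nc_inj {p : α → Prop} {q : β → Prop} (f : α → β) (h : ∀ x, p x → q (f x))
    (hf : ∀ x y, p x → p y → f x = f y → x = y) : nc p ≤ nc q :=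
  Nat.card_le_card_of_injective (fun x : {x // p x} => (⟨f x.1, h _ x.2⟩ : {x // q x}))
    (fun a b hab => Subtype.ext (hf _ _ a.2 b.2 (by simpa [Subtype.ext_iff] using hab)))

lemma nc_surj {p : β → Prop} {q : α → Prop} (g : α → β) (h : ∀ v, p v → ∃ x, q x ∧ g x = v) :
    nc p ≤ nc q := by
  choose f hf using h
  refine Nat.card_le_card_of_injective (fun v : {v // p v} => (⟨f v.1 v.2, (hf v.1 v.2).1⟩ : {x // q x}))
    (fun a b hab => Subtype.ext ?_)
  have hab : f a.1 a.2 = f b.1 b.2 := by simpa [Subtype.ext_iff] using hab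
  rw [← (hf a.1 a.2).2, hab, (hf b.1 b.2).2]

lemma nc_split (p q : α → Prop) : nc p = nc (fun x => p x ∧ q x) + nc (fun x => p x ∧ ¬ q x) := by
  classical
  have := Fintype.ofFinite α
  simp only [nc, Nat.card_eq_fintype_card, Fintype.card_subtype]
  rw [← Finset.card_filter_add_card_filter_not (s := Finset.univ.filter (fun x => p x)) (p := q)]
  simp only [Finset.filter_filter]

lemma nc_add_le {p q r : α → Prop} (h1 : ∀ x, p x → r x) (h2 : ∀ x, q x → r x)
    (h3 : ∀ x, p x → ¬ q x) : nc p + nc q ≤ nc r := by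
  rw [nc_split r p]
  exact Nat.add_le_add (nc_mono fun x hx => ⟨h1 x hx, hx⟩)
    (nc_mono fun x hx => ⟨h2 x hx, fun h => h3 x h hx⟩)

lemma nc_le_add {p q r : α → Prop} (h : ∀ x, r x → p x ∨ q x) : nc r ≤ nc p + nc q := by
  rw [nc_split r p]
  exact Nat.add_le_add (nc_mono fun x hx => hx.2)
    (nc_mono fun x hx => (h x hx.1).resolve_left hx.2)

lemma nc_three {p : α → Prop} {a b c : α} (ha : p a) (hb : p b) (hc : p c) (hab : a ≠ b)
    (hac : a ≠ c) (hbc : b ≠ c) : 3 ≤ nc p := by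
  classical
  have := Fintype.ofFinite α
  simp only [nc, Nat.card_eq_fintype_card, Fintype.card_subtype]
  rw [← Finset.card_eq_three.2 ⟨a, b, c, hab, hac, hbc, rfl⟩]
  apply Finset.card_le_card
  intro x hx
  simp only [Finset.mem_insert, Finset.mem_singleton] at hx
  rcases hx with rfl | rfl | rfl <;> simpa

lemma nc_pos {p : α → Prop} (h : ∃ x, p x) : 1 ≤ nc p := by
  obtain ⟨x, hx⟩ := h
  have : Nonempty {x // p x} := ⟨⟨x, hx⟩⟩
  exact Nat.card_pos
end nc

namespace Tri
variable {V : Type} [Fintype V] [DecidableEq V] {G : SimpleGraph V} [DecidableRel G.Adj]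
  {E : PlaneEmb G} {big : G.Dart → Prop}
variable (T : Tri E big)

/-- a separation violating three-connectivity -/
structure Sep (R A : V → Prop) : Prop where
  act_R : ∀ x, ¬ R (T.src x) → ¬ A (T.src x) → T.act x → ¬ R (T.tgt x)
  A_dart : ∀ a, A a → ∃ x, T.src x = a ∧ ¬ R (T.tgt x) ∧ ¬ A (T.tgt x)
  OV_or : ∀ v, T.OV v → R v ∨ A v
  disj : ∀ v, R v → ¬ A v
  A_card : nc A ≤ 2
  hW : ∃ w, ¬ R w
  hR : ∀ v, R v → ∃ o, T.OV o ∧ R o ∧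
      Relation.ReflTransGen (fun a b => R b ∧ ∃ x, T.src x = a ∧ T.tgt x = b) o v
  Rne : ∃ v, R v

section
variable {T} (hc : IsCPTLabelling E big) (h3 : ∀ x, T.isOut x → T.ψ (T.ψ x) ≠ x)
  {R A : V → Prop} (hs : T.Sep R A)

/-- 𝒦 -/
def KK (T : Tri E big) (R : V → Prop) (x : T.D) : Prop :=
  ¬ R (T.src x) ∧ ¬ R (T.tgt x) ∧ R (T.tgt (T.σ x))
/-- L -/
def LL (T : Tri E big) (R : V → Prop) (v : V) : Prop := ¬ R v ∧ ∃ x, T.src x = v ∧ R (T.tgt x)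

include hc h3 in
lemma out_prev3 {x : T.D} (hx : T.isOut x) : T.src x ≠ T.tgt x ∧
    T.tgt (T.σ.symm (T.α x)) ≠ T.src x ∧ T.tgt (T.σ.symm (T.α x)) ≠ T.tgt x ∧
    T.OV (T.tgt x) ∧ T.OV (T.tgt (T.σ.symm (T.α x))) := by
  have hne : ∀ y : T.D, T.isOut y → T.src y ≠ T.tgt y := by
    intro y hy
    rw [T.out_range hy]
    simp
  set w := T.σ.symm (T.α x) with hw
  have hwx : T.ψ w = x := by simp [hw, T.αα]
  have hwo : T.isOut w := by rw [← hwx] at hx; simpa using hx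
  set u := T.σ.symm (T.α w) with hu
  have huw : T.ψ u = w := by simp [hu, T.αα]
  have huo : T.isOut u := by rw [← huw] at hwo; simpa using hwo
  have e1 : T.src w = T.tgt x := by simp [hw]
  have e2 : T.src u = T.tgt w := by simp [hu]
  refine ⟨hne x hx, ?_, ?_, ⟨w, hwo, e1⟩, ⟨u, huo, e2⟩⟩
  · rw [← e2]; intro h
    have := T.out_uniq hc huo hx h
    apply h3 u huo
    rw [huw, hwx, this]
  · rw [← e1]; exact (hne w hwo).symm

include hc h3 hs in
lemma KK_prev {x : T.D} (hx : T.KK R x) : R (T.tgt (T.σ.symm (T.α x))) := by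
  by_cases ho : T.isOut x
  · obtain ⟨a1, a2, a3, a4, a5⟩ := out_prev3 hc h3 ho
    have b1 : A (T.src x) := (hs.OV_or _ ⟨x, ho, rfl⟩).resolve_left hx.1
    have b2 : A (T.tgt x) := (hs.OV_or _ a4).resolve_left hx.2.1
    refine (hs.OV_or _ a5).resolve_right (fun b3 => ?_)
    have := hs.A_card
    have h3 : 3 ≤ nc A := nc_three b1 b2 b3 a1 a2.symm a3.symm
    omega
  · rw [T.ψ3_symm ho]
    rw [TMap.tgt_ψ, TMap.src_ψ]; exact hx.2.2

include hc h3 hs in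
lemma KK_L {x : T.D} (hx : T.KK R x) : T.LL R (T.src x) ∧ T.LL R (T.tgt x) :=
  ⟨⟨hx.1, T.σ x, by simp, hx.2.2⟩, ⟨hx.2.1, T.σ.symm (T.α x), by simp, KK_prev hc h3 hs hx⟩⟩

include hc h3 hs in
lemma KK_own {x : T.D} (hx : T.KK R x) (hn : x ∉ Set.range T.ι) :
    (T.own x ∧ A (T.src x)) ∨ (T.own (T.α x) ∧ A (T.tgt x)) := by
  rcases T.own_or x hn with h | h
  · left; refine ⟨h, ?_⟩
    by_contra hA
    refine hs.act_R (T.σ x) (by simpa using hx.1) (by simpa using hA) ?_ hx.2.2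
    right; right; simpa using T.own_Big h
  · right; refine ⟨h, ?_⟩
    by_contra hA
    refine hs.act_R (T.σ.symm (T.α x)) (by simpa using hx.2.1) (by simpa using hA) ?_
      (KK_prev hc h3 hs hx)
    right; left
    have := T.own_Big h
    unfold TMap.Big at this ⊢
    rcases T.angσ (T.σ.symm (T.α x)) with h' | ⟨-, h'⟩
    · rw [Equiv.apply_symm_apply] at h'
      exact absurd ⟨_, h'.symm⟩ (T.own_prop _ h).1
    · rw [← h']; simpa using this

include hs in
lemma C_pointed {v : V} (hv : T.LL R v) (hA : ¬ A v) : PointedVx big v := by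
  by_contra hp
  obtain ⟨h1, x, rfl, hx⟩ := hv
  exact hs.act_R x h1 hA (Or.inl hp) hx

include hs in
lemma C_first {v : V} (hv : T.LL R v) (hA : ¬ A v) :
    ∃ x, T.KK R x ∧ T.src x = v ∧ ¬ R (T.tgt (T.σ.symm x)) := by
  obtain ⟨x0, hx0, rfl⟩ := T.pointed_iff.1 (C_pointed hs hv hA)
  by_contra hcon
  push Not at hcon
  obtain ⟨h1, y, hy, hRy⟩ := hv
  have : ¬ R (T.tgt y) ∧ ¬ R (T.tgt (T.σ y)) := by
    refine T.orbit_ind (x := x0) (p := fun y => ¬ R (T.tgt y) ∧ ¬ R (T.tgt (T.σ y))) hy.symm ⟨?_, ?_⟩ ?_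
    · exact hs.act_R _ h1 hA (Or.inr (Or.inl hx0))
    · exact hs.act_R _ (by simpa using h1) (by simpa using hA) (Or.inr (Or.inr (by simpa using hx0)))
    · rintro z hz ⟨ha, hb⟩
      refine ⟨hb, fun hR => ?_⟩
      have := hcon (T.σ z) ⟨by simpa [hz] using h1, hb, hR⟩ (by simpa using hz)
      simp at this; exact ha this
  exact this.1 hRy

include hs in
lemma A_first {v : V} (hv : T.LL R v) (hA : A v) :
    ∃ x, T.KK R x ∧ T.src x = v ∧ ¬ (R (T.tgt (T.σ.symm x)) ∧ A (T.tgt x)) := by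
  obtain ⟨x0, rfl, h01, h02⟩ := hs.A_dart v hA
  by_contra hcon
  push Not at hcon
  obtain ⟨h1, y, hy, hRy⟩ := hv
  have : ¬ R (T.tgt y) ∧ ¬ (R (T.tgt (T.σ.symm y)) ∧ A (T.tgt y)) := by
    refine T.orbit_ind (x := x0) (p := fun y => ¬ R (T.tgt y) ∧ ¬ (R (T.tgt (T.σ.symm y)) ∧ A (T.tgt y))) hy.symm ⟨h01, ?_⟩ ?_
    · tauto
    · rintro z hz ⟨ha, hb⟩
      have : ¬ R (T.tgt (T.σ z)) := fun hR => hb (hcon z ⟨by rw [hz]; exact h1, ha, hR⟩ hz)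
      refine ⟨this, ?_⟩
      simp [ha]
  exact this.1 hRy

end
end Tri

set_option linter.unusedSectionVars false

lemma dart_count {V : Type} [Finite V] (G : SimpleGraph V) (K : V → Prop) :
    nc (fun d : G.Dart => K d.fst ∧ K d.snd) ≤ 2 * Nat.card (G.induce {v | K v}).edgeSet := by
  classical
  have := Fintype.ofFinite V
  have h := (G.induce {v | K v}).dart_card_eq_twice_card_edges
  rw [← SimpleGraph.coe_edgeFinset, Nat.card_eq_fintype_card]
  simp only [Fintype.card_coe, SetLike.coe_sort_coe]
  rw [← h, ← Nat.card_eq_fintype_card]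
  refine Nat.card_le_card_of_injective (fun d : {d : G.Dart // K d.fst ∧ K d.snd} =>
    (⟨(⟨d.1.fst, d.2.1⟩, ⟨d.1.snd, d.2.2⟩), d.1.adj⟩ : (G.induce {v | K v}).Dart)) ?_
  intro a b hab
  have e1 := congrArg (fun d : (G.induce {v | K v}).Dart => (d.fst : V)) hab
  have e2 := congrArg (fun d : (G.induce {v | K v}).Dart => (d.snd : V)) hab
  exact Subtype.ext (SimpleGraph.Dart.ext _ _ (Prod.ext e1 e2))

namespace Tri
variable {V : Type} [Fintype V] [DecidableEq V] {G : SimpleGraph V} [DecidableRel G.Adj]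
  {E : PlaneEmb G} {big : G.Dart → Prop}
variable {T : Tri E big} (hc : IsCPTLabelling E big) (h3 : ∀ x, T.isOut x → T.ψ (T.ψ x) ≠ x)
  {R A : V → Prop} (hs : T.Sep R A)

include hc in
lemma cnt2 (R : V → Prop) : nc (fun x => R (T.src x) ∨ R (T.tgt x)) + nc (T.KK R) ≤
    nc (T.TC R) + nc (fun v => T.OV v ∧ R v) + nc (fun v => T.OV v ∧ T.LL R v) := by
  have a1 : nc (fun x => R (T.src x) ∨ R (T.tgt x)) + nc (T.KK R) ≤
      nc (fun x => R (T.src x) ∨ R (T.tgt x) ∨ R (T.tgt (T.σ x))) :=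
    nc_add_le (by tauto) (fun x hx => by have := hx.2.2; tauto) (fun x hx hk => by
      rcases hx with h | h
      · exact hk.1 h
      · exact hk.2.1 h)
  have a2 : nc (fun x => R (T.src x) ∨ R (T.tgt x) ∨ R (T.tgt (T.σ x))) ≤
      nc (T.TC R) + nc (fun x => T.isOut x ∧ (R (T.src x) ∨ T.LL R (T.src x))) := by
    refine nc_le_add (fun x hx => ?_)
    by_cases ho : T.isOut x
    · right; refine ⟨ho, ?_⟩
      by_cases hr : R (T.src x)
      · exact Or.inl hr
      right
      rcases hx with h | h | h
      · exact absurd h hr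
      · exact ⟨hr, x, rfl, h⟩
      · exact ⟨hr, T.σ x, by simp, h⟩
    · left; exact ⟨ho, hx⟩
  have a3 : nc (fun x => T.isOut x ∧ (R (T.src x) ∨ T.LL R (T.src x))) ≤
      nc (fun v => T.OV v ∧ (R v ∨ T.LL R v)) :=
    nc_inj T.src (fun x hx => ⟨⟨x, hx.1, rfl⟩, hx.2⟩) (fun x y hx hy h => T.out_uniq hc hx.1 hy.1 h)
  have a4 : nc (fun v => T.OV v ∧ (R v ∨ T.LL R v)) ≤
    nc (fun v => T.OV v ∧ R v) + nc (fun v => T.OV v ∧ T.LL R v) := nc_le_add (by tauto)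
  omega

include hc hs in
lemma cnt3a : nc (fun x => R (T.src x) ∨ R (T.tgt x)) + 2 * nc (fun v => T.OV v ∧ R v) +
    2 * nc (fun x => T.own x ∧ (A (T.src x) ∧ T.LL R (T.src x)) ∧ ¬ R (T.tgt x)) +
    2 * nc (fun v => T.OV v ∧ T.LL R v) ≤
    nc (fun x => x ∈ Set.range T.ι ∧ (R (T.src x) ∨ R (T.tgt x))) +
    2 * nc (fun v => R v ∧ PointedVx big v) +
    2 * nc (fun v => (A v ∧ T.LL R v) ∧ PointedVx big v) := by
  have a1 := nc_split (fun x => R (T.src x) ∨ R (T.tgt x)) (fun x => x ∈ Set.range T.ι)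
  have a2 : nc (fun x => (R (T.src x) ∨ R (T.tgt x)) ∧ x ∈ Set.range T.ι) ≤
    nc (fun x => x ∈ Set.range T.ι ∧ (R (T.src x) ∨ R (T.tgt x))) := nc_mono (by tauto)
  have a3 : nc (fun x => (R (T.src x) ∨ R (T.tgt x)) ∧ x ∉ Set.range T.ι) ≤
      nc (fun x => (R (T.src x) ∨ R (T.tgt x)) ∧ T.own x) +
      nc (fun x => (R (T.src x) ∨ R (T.tgt x)) ∧ T.own (T.α x)) := by
    refine nc_le_add (fun x hx => ?_)
    rcases T.own_or x hx.2 with h | h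
    · exact Or.inl ⟨hx.1, h⟩
    · exact Or.inr ⟨hx.1, h⟩
  have a4 : nc (fun x => (R (T.src x) ∨ R (T.tgt x)) ∧ T.own (T.α x)) ≤
      nc (fun x => (R (T.src x) ∨ R (T.tgt x)) ∧ T.own x) := by
    refine nc_inj T.α (fun x hx => ?_) (fun x y _ _ h => T.α_inj h)
    simpa [or_comm] using hx
  have a5 : nc (fun x => (R (T.src x) ∨ R (T.tgt x)) ∧ T.own x) ≤
      nc (fun x => T.own x ∧ R (T.src x)) +
      nc (fun x => T.own x ∧ (A (T.src x) ∧ T.LL R (T.src x)) ∧ R (T.tgt x)) := by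
    refine nc_le_add (fun x hx => ?_)
    by_cases hr : R (T.src x)
    · exact Or.inl ⟨hx.2, hr⟩
    right
    have hr2 := hx.1.resolve_left hr
    refine ⟨hx.2, ⟨?_, hr, x, rfl, hr2⟩, hr2⟩
    by_contra hA
    exact hs.act_R x hr hA (Or.inr (Or.inl (T.own_Big hx.2))) hr2
  have b1 : nc (fun x => T.own x ∧ R (T.src x)) ≤ nc (fun v => R v ∧ PointedVx big v ∧ ¬ T.OV v) :=
    nc_inj T.src (fun x hx => ⟨hx.2, T.Big_pointed (T.own_Big hx.1), T.own_not_OV hc hx.1⟩)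
      (fun x y hx hy h => T.own_uniq _ _ hx.1 hy.1 h)
  have b2 : nc (fun v => R v ∧ PointedVx big v ∧ ¬ T.OV v) + nc (fun v => T.OV v ∧ R v) ≤
      nc (fun v => R v ∧ PointedVx big v) :=
    nc_add_le (by tauto) (fun v hv => ⟨hv.2, T.OV_pointed hc hv.1⟩) (by tauto)
  have c0 := nc_split (fun x => T.own x ∧ (A (T.src x) ∧ T.LL R (T.src x))) (fun x => R (T.tgt x))
  have c1 : nc (fun x => T.own x ∧ (A (T.src x) ∧ T.LL R (T.src x))) ≤
      nc (fun v => (A v ∧ T.LL R v) ∧ PointedVx big v ∧ ¬ T.OV v) :=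
    nc_inj T.src (fun x hx => ⟨hx.2, T.Big_pointed (T.own_Big hx.1), T.own_not_OV hc hx.1⟩)
      (fun x y hx hy h => T.own_uniq _ _ hx.1 hy.1 h)
  have c2 : nc (fun v => (A v ∧ T.LL R v) ∧ PointedVx big v ∧ ¬ T.OV v) + nc (fun v => T.OV v ∧ T.LL R v) ≤
      nc (fun v => (A v ∧ T.LL R v) ∧ PointedVx big v) :=
    nc_add_le (by tauto) (fun v hv => ⟨⟨(hs.OV_or v hv.1).resolve_left hv.2.1, hv.2⟩,
      T.OV_pointed hc hv.1⟩) (by tauto)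
  simp only [and_assoc] at *
  omega

include hs in
lemma cnt3b (hgl : GenLaman G big) :
    nc (fun x => x ∈ Set.range T.ι ∧ (R (T.src x) ∨ R (T.tgt x))) +
    nc (fun x => x ∈ Set.range T.ι ∧ (T.LL R (T.src x) ∧ T.LL R (T.tgt x))) +
    2 * (nc (fun v => R v ∧ PointedVx big v) + nc (fun v => T.LL R v ∧ ¬ A v) +
      nc (fun v => (A v ∧ T.LL R v) ∧ PointedVx big v)) + 6 ≤
    6 * (nc R + nc (fun v => T.LL R v ∧ ¬ A v) + nc (fun v => A v ∧ T.LL R v)) := by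
  have a1 : nc (fun x => x ∈ Set.range T.ι ∧ (R (T.src x) ∨ R (T.tgt x))) +
    nc (fun x => x ∈ Set.range T.ι ∧ (T.LL R (T.src x) ∧ T.LL R (T.tgt x))) ≤
    nc (fun x => x ∈ Set.range T.ι ∧ ((R (T.src x) ∨ T.LL R (T.src x)) ∧
      (R (T.tgt x) ∨ T.LL R (T.tgt x)))) := by
    refine nc_add_le ?_ (by tauto) ?_
    · rintro x ⟨h1, h2⟩
      refine ⟨h1, ?_⟩
      by_cases hr : R (T.src x)
      · by_cases ht : R (T.tgt x)
        · tauto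
        · exact ⟨Or.inl hr, Or.inr ⟨ht, T.α x, rfl, by simpa using hr⟩⟩
      · have ht := h2.resolve_left hr
        exact ⟨Or.inr ⟨hr, x, rfl, ht⟩, Or.inl ht⟩
    · rintro x ⟨h1, h2⟩ ⟨h3, h4, h5⟩
      rcases h2 with h | h
      · exact h4.1 h
      · exact h5.1 h
  have a2 : nc (fun x => x ∈ Set.range T.ι ∧ ((R (T.src x) ∨ T.LL R (T.src x)) ∧
      (R (T.tgt x) ∨ T.LL R (T.tgt x)))) ≤
      nc (fun d : G.Dart => (R d.fst ∨ T.LL R d.fst) ∧ (R d.snd ∨ T.LL R d.snd)) := by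
    refine nc_inj T.ang ?_ ?_
    · rintro x ⟨⟨d, rfl⟩, h⟩
      simpa [T.ang_ι] using h
    · rintro x y ⟨⟨d, rfl⟩, h⟩ ⟨⟨d', rfl⟩, h'⟩ heq
      simp only [T.ang_ι] at heq; rw [heq]
  have a3 := dart_count G (fun v => R v ∨ T.LL R v)
  have d1 : nc R + nc (T.LL R) ≤ nc (fun v => R v ∨ T.LL R v) :=
    nc_add_le (by tauto) (by tauto) (fun v h1 h2 => h2.1 h1)
  have d2 : nc (fun v => R v ∨ T.LL R v) ≤ nc R + nc (T.LL R) := nc_le_add (by tauto)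
  have d3 := nc_split (T.LL R) A
  have d4 : nc (fun v => T.LL R v ∧ A v) = nc (fun v => A v ∧ T.LL R v) := by
    congr 1; funext v; rw [and_comm]
  have hL : ∃ v, T.LL R v := by
    by_contra hcon
    push Not at hcon
    obtain ⟨w, hw⟩ := hs.hW
    obtain ⟨v, hv⟩ := hs.Rne
    refine hw (T.vert_ind (p := R) hv ?_)
    intro x hx
    by_contra hr
    exact hcon (T.tgt x) ⟨hr, T.α x, rfl, by simpa using hx⟩
  have d5 := nc_pos hs.Rne
  have d6 := nc_pos hL
  have a4 := hgl {v | R v ∨ T.LL R v} (by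
    have : Nat.card ({v | R v ∨ T.LL R v} : Set V) = nc (fun v => R v ∨ T.LL R v) := rfl
    rw [this]; omega)
  have e1 : Nat.card ({v ∈ {v | R v ∨ T.LL R v} | ¬ PointedVx big v} : Set V) =
    nc (fun v => (R v ∨ T.LL R v) ∧ ¬ PointedVx big v) := rfl
  have e2 : Nat.card ({v ∈ {v | R v ∨ T.LL R v} | PointedVx big v} : Set V) =
    nc (fun v => (R v ∨ T.LL R v) ∧ PointedVx big v) := rfl
  rw [e1, e2] at a4
  have e3 := nc_split (fun v => R v ∨ T.LL R v) (PointedVx big)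
  have e4 : nc (fun v => R v ∧ PointedVx big v) + nc (fun v => T.LL R v ∧ PointedVx big v) ≤
      nc (fun v => (R v ∨ T.LL R v) ∧ PointedVx big v) :=
    nc_add_le (by tauto) (by tauto) (fun v h1 h2 => h2.1.1 h1.1)
  have e5 : nc (fun v => T.LL R v ∧ ¬ A v) + nc (fun v => (A v ∧ T.LL R v) ∧ PointedVx big v) ≤
      nc (fun v => T.LL R v ∧ PointedVx big v) :=
    nc_add_le (fun v hv => ⟨hv.1, C_pointed hs hv.1 hv.2⟩) (by tauto) (by tauto)
  have a4' : (Nat.card (G.induce {v | R v ∨ T.LL R v}).edgeSet : ℤ) = ((Nat.card (G.induce {v | R v ∨ T.LL R v}).edgeSet : ℕ) : ℤ) := rfl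
  omega

include hc h3 hs in
lemma cnt4 : 2 * nc (T.KK R) ≤ nc (fun x => T.KK R x ∧ T.KK R (T.α x)) +
    nc (fun x => x ∈ Set.range T.ι ∧ (T.LL R (T.src x) ∧ T.LL R (T.tgt x))) +
    2 * nc (fun x => T.own x ∧ (A (T.src x) ∧ T.LL R (T.src x)) ∧ ¬ R (T.tgt x)) := by
  have a1 : nc (T.KK R) ≤ nc (fun x => T.KK R (T.α x)) :=
    nc_inj T.α (fun x hx => by rw [T.αα]; exact hx) (fun x y _ _ h => T.α_inj h)
  have a2 := nc_split (fun x => T.KK R (T.α x)) (T.KK R)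
  have a3 : nc (T.KK R) + nc (fun x => T.KK R (T.α x) ∧ ¬ T.KK R x) ≤
      nc (fun x => T.KK R x ∨ T.KK R (T.α x)) := nc_add_le (by tauto) (by tauto) (by tauto)
  have a4 : nc (fun x => T.KK R (T.α x) ∧ T.KK R x) ≤ nc (fun x => T.KK R x ∧ T.KK R (T.α x)) :=
    nc_mono (by tauto)
  have key : ∀ x, T.KK R x → (x ∈ Set.range T.ι ∧ (T.LL R (T.src x) ∧ T.LL R (T.tgt x))) ∨
      ((T.own x ∧ (A (T.src x) ∧ T.LL R (T.src x)) ∧ ¬ R (T.tgt x)) ∨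
       (T.own (T.α x) ∧ (A (T.tgt x) ∧ T.LL R (T.tgt x)) ∧ ¬ R (T.src x))) := by
    intro x hx
    have hl := KK_L hc h3 hs hx
    by_cases hn : x ∈ Set.range T.ι
    · exact Or.inl ⟨hn, hl⟩
    right
    rcases KK_own hc h3 hs hx hn with h | h
    · exact Or.inl ⟨h.1, ⟨h.2, hl.1⟩, hx.2.1⟩
    · exact Or.inr ⟨h.1, ⟨h.2, hl.2⟩, hx.1⟩
  have a5 : nc (fun x => T.KK R x ∨ T.KK R (T.α x)) ≤
      nc (fun x => x ∈ Set.range T.ι ∧ (T.LL R (T.src x) ∧ T.LL R (T.tgt x))) +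
      nc (fun x => (T.own x ∧ (A (T.src x) ∧ T.LL R (T.src x)) ∧ ¬ R (T.tgt x)) ∨
       (T.own (T.α x) ∧ (A (T.tgt x) ∧ T.LL R (T.tgt x)) ∧ ¬ R (T.src x))) := by
    refine nc_le_add (fun x hx => ?_)
    rcases hx with hx | hx
    · exact key x hx
    · rcases key _ hx with ⟨⟨d, hd⟩, h1, h2⟩ | h | h
      · left
        refine ⟨⟨d.symm, ?_⟩, by simpa using h2, by simpa using h1⟩
        rw [← T.α_ι, hd, T.αα]
      · right; right; simpa using h
      · right; left; simpa [T.αα] using h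
  have a6 : nc (fun x => (T.own x ∧ (A (T.src x) ∧ T.LL R (T.src x)) ∧ ¬ R (T.tgt x)) ∨
       (T.own (T.α x) ∧ (A (T.tgt x) ∧ T.LL R (T.tgt x)) ∧ ¬ R (T.src x))) ≤
      nc (fun x => T.own x ∧ (A (T.src x) ∧ T.LL R (T.src x)) ∧ ¬ R (T.tgt x)) +
      nc (fun x => T.own (T.α x) ∧ (A (T.tgt x) ∧ T.LL R (T.tgt x)) ∧ ¬ R (T.src x)) :=
    nc_le_add (fun x hx => hx)
  have a7 : nc (fun x => T.own (T.α x) ∧ (A (T.tgt x) ∧ T.LL R (T.tgt x)) ∧ ¬ R (T.src x)) ≤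
      nc (fun x => T.own x ∧ (A (T.src x) ∧ T.LL R (T.src x)) ∧ ¬ R (T.tgt x)) :=
    nc_inj T.α (fun x hx => by simpa using hx) (fun x y _ _ h => T.α_inj h)
  omega

include hc h3 hs in
lemma cnt5 : ∃ kC kA, nc (T.KK R) = kC + kA ∧ nc (fun v => T.LL R v ∧ ¬ A v) ≤ kC ∧
    nc (fun v => A v ∧ T.LL R v) ≤ kA ∧
    nc (fun x => T.KK R x ∧ T.KK R (T.α x)) + 2 * nc (fun v => T.LL R v ∧ ¬ A v) +
      nc (fun v => A v ∧ T.LL R v) ≤ 2 * kC + kA := by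
  refine ⟨nc (fun x => T.KK R x ∧ ¬ A (T.src x)), nc (fun x => T.KK R x ∧ A (T.src x)), ?_, ?_, ?_, ?_⟩
  · rw [nc_split (T.KK R) (fun x => A (T.src x))]; ring
  · refine nc_surj T.src ?_
    rintro v ⟨h1, h2⟩
    obtain ⟨x, hx, rfl, -⟩ := C_first hs h1 h2
    exact ⟨x, ⟨hx, h2⟩, rfl⟩
  · refine nc_surj T.src ?_
    rintro v ⟨h1, h2⟩
    obtain ⟨x, hx, rfl, -⟩ := A_first hs h2 h1
    exact ⟨x, ⟨hx, h1⟩, rfl⟩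
  · have hα : ∀ x, T.KK R (T.α x) → R (T.tgt (T.σ.symm x)) := by
      intro x hx
      have := KK_prev hc h3 hs hx
      rwa [T.αα] at this
    have a1 := nc_split (fun x => T.KK R x ∧ T.KK R (T.α x)) (fun x => A (T.src x))
    have a2 := nc_split (fun x => (T.KK R x ∧ T.KK R (T.α x)) ∧ A (T.src x)) (fun x => A (T.tgt x))
    have b1 : nc (fun v => T.LL R v ∧ ¬ A v) ≤ nc (fun x => T.KK R x ∧ ¬ A (T.src x) ∧ ¬ T.KK R (T.α x)) := by
      refine nc_surj T.src ?_
      rintro v ⟨h1, h2⟩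
      obtain ⟨x, hx, rfl, hx2⟩ := C_first hs h1 h2
      exact ⟨x, ⟨hx, h2, fun h => hx2 (hα x h)⟩, rfl⟩
    have b2 : nc (fun v => A v ∧ T.LL R v) ≤ nc (fun x => T.KK R x ∧ A (T.src x) ∧ ¬ (T.KK R (T.α x) ∧ A (T.tgt x))) := by
      refine nc_surj T.src ?_
      rintro v ⟨h1, h2⟩
      obtain ⟨x, hx, rfl, hx2⟩ := A_first hs h2 h1
      exact ⟨x, ⟨hx, h1, fun h => hx2 ⟨hα x h.1, h.2⟩⟩, rfl⟩
    have c1 : nc (fun x => T.KK R x ∧ ¬ A (T.src x) ∧ ¬ T.KK R (T.α x)) +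
        nc (fun x => (T.KK R x ∧ T.KK R (T.α x)) ∧ ¬ A (T.src x)) ≤
        nc (fun x => T.KK R x ∧ ¬ A (T.src x)) := nc_add_le (by tauto) (by tauto) (by tauto)
    have c2 : nc (fun x => T.KK R x ∧ A (T.src x) ∧ ¬ (T.KK R (T.α x) ∧ A (T.tgt x))) +
        nc (fun x => ((T.KK R x ∧ T.KK R (T.α x)) ∧ A (T.src x)) ∧ A (T.tgt x)) ≤
        nc (fun x => T.KK R x ∧ A (T.src x)) := nc_add_le (by tauto) (by tauto) (by tauto)
    have c3 : nc (fun x => ((T.KK R x ∧ T.KK R (T.α x)) ∧ A (T.src x)) ∧ ¬ A (T.tgt x)) ≤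
        nc (fun x => (T.KK R x ∧ T.KK R (T.α x)) ∧ ¬ A (T.src x)) := by
      refine nc_inj T.α (fun x hx => ?_) (fun x y _ _ h => T.α_inj h)
      simp only [T.αα, TMap.src_α]; tauto
    omega

include hc h3 hs in
lemma Sep.false (hgl : GenLaman G big) : False := by
  have h1 : 6 * nc R + 2 * nc (T.TC R) ≤ 3 * nc (fun x => R (T.src x) ∨ R (T.tgt x)) :=
    T.euler_ineq R hs.hW hs.hR
  have h2 := cnt2 (T := T) hc R
  have h3a := cnt3a hc hs
  have h3b := cnt3b hs hgl
  have h4 := cnt4 hc h3 hs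
  obtain ⟨kC, kA, k1, k2, k3, k4⟩ := cnt5 hc h3 hs
  have h6 : nc (fun v => A v ∧ T.LL R v) ≤ nc A := nc_mono (fun v hv => hv.1)
  have h7 := hs.A_card
  omega

/-- **Three-connectivity.** -/
theorem three_conn (hc : IsCPTLabelling E big) (h3 : ∀ x, T.isOut x → T.ψ (T.ψ x) ≠ x)
    (hgl : GenLaman G big) (S : V → Prop) (hS : ∃ v, S v) (hO : ∀ v, S v → ¬ T.OV v) :
    3 ≤ nc (fun w => ¬ S w ∧ ∃ x, T.act x ∧ S (T.src x) ∧ T.tgt x = w) := by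
  by_contra hcon
  push Not at hcon
  set A : V → Prop := fun w => ¬ S w ∧ ∃ x, T.act x ∧ S (T.src x) ∧ T.tgt x = w with hA
  set R : V → Prop := fun v => ∃ o, T.OV o ∧ ¬ A o ∧
    Relation.ReflTransGen (fun a b => (¬ S b ∧ ¬ A b) ∧ ∃ x, T.src x = a ∧ T.tgt x = b) o v with hR
  have R_not : ∀ v, R v → ¬ S v ∧ ¬ A v := by
    rintro v ⟨o, ho, hoA, h⟩
    rcases Relation.ReflTransGen.cases_tail h with h | ⟨c, -, h, -⟩
    · rw [h]; exact ⟨fun h => hO _ h ho, hoA⟩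
    · exact h
  have R_step : ∀ x, R (T.src x) → ¬ S (T.tgt x) → ¬ A (T.tgt x) → R (T.tgt x) := by
    rintro x ⟨o, ho, hoA, h⟩ h1 h2
    exact ⟨o, ho, hoA, h.tail ⟨⟨h1, h2⟩, x, rfl, rfl⟩⟩
  have OVR : ∀ v, T.OV v → ¬ A v → R v := fun v hv hA => ⟨v, hv, hA, Relation.ReflTransGen.refl⟩
  have hsep : T.Sep R A := by
    refine ⟨?_, ?_, ?_, fun v hv => (R_not v hv).2, by omega, ?_, ?_, ?_⟩
    · intro x h1 h2 hact hR
      by_cases hs : S (T.src x)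
      · by_cases hs' : S (T.tgt x)
        · exact (R_not _ hR).1 hs'
        · exact (R_not _ hR).2 ⟨hs', x, hact, hs, rfl⟩
      · have := R_step (T.α x) hR (by simpa using hs) (by simpa using h2)
        exact h1 (by simpa using this)
    · rintro a ⟨h1, x, hact, hsx, rfl⟩
      refine ⟨T.α x, rfl, ?_, ?_⟩
      · intro h; exact (R_not _ h).1 (by simpa using hsx)
      · intro h; exact h.1 (by simpa using hsx)
    · intro v hv
      by_cases hA : A v
      · exact Or.inr hA
      · exact Or.inl (OVR v hv hA)
    · obtain ⟨v, hv⟩ := hS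
      exact ⟨v, fun h => (R_not v h).1 hv⟩
    · rintro v ⟨o, ho, hoA, h⟩
      refine ⟨o, ho, OVR o ho hoA, ?_⟩
      induction h with
      | refl => exact Relation.ReflTransGen.refl
      | tail hab hbc ih =>
        exact ih.tail ⟨⟨o, ho, hoA, hab.tail hbc⟩, hbc.2⟩
    · by_contra hne
      push Not at hne
      have hOA : ∀ v, T.OV v → A v := fun v hv => by
        by_contra h; exact hne v (OVR v hv h)
      obtain ⟨x, hx⟩ := T.exists_out
      obtain ⟨a1, a2, a3, a4, a5⟩ := out_prev3 hc h3 hx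
      have := nc_three (hOA _ ⟨x, hx, rfl⟩) (hOA _ a4) (hOA _ a5) a1 a2.symm a3.symm
      omega
  exact hsep.false hc h3 hgl

end Tri

set_option linter.unusedSectionVars false

/-- orientation determinant -/
def det3 (a b c : ℝ × ℝ) : ℝ := (b.1 - a.1) * (c.2 - a.2) - (b.2 - a.2) * (c.1 - a.1)

section tutte
open Matrix
variable {V : Type} [Fintype V] [DecidableEq V] (O : V → Prop) (N : V → V → Prop)
open scoped Classical in
/-- the system matrix -/
noncomputable def TM {R : Type} [CommRing R] (m : V → V → R) : Matrix V V R := fun v w =>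
  if O v then (if v = w then 1 else 0)
  else (if N v w then m v w else 0) - if v = w then ∑ u, (if N v u then m v u else 0) else 0

open scoped Classical in
/-- right hand side -/
noncomputable def TB {R : Type} [CommRing R] (q : V → R) (v : V) : R := if O v then q v else 0

lemma TM_out {R : Type} [CommRing R] (m : V → V → R) (h : V → R) {v : V} (hv : O v) :
    (TM O N m *ᵥ h) v = h v := by
  simp [Matrix.mulVec, dotProduct, TM, hv]

open scoped Classical in
lemma TM_in {R : Type} [CommRing R] (m : V → V → R) (h : V → R) {v : V} (hv : ¬ O v) :
    (TM O N m *ᵥ h) v = ∑ w, (if N v w then m v w else 0) * (h w - h v) := by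
  simp only [Matrix.mulVec, dotProduct, TM, hv, if_false, sub_mul, Finset.sum_sub_distrib, mul_sub]
  congr 1
  simp [Finset.sum_mul]

lemma TM_map {R S : Type} [CommRing R] [CommRing S] (f : R →+* S) (m : V → V → R) :
    (TM O N m).map f = TM O N (fun v w => f (m v w)) := by
  classical
  ext v w
  simp only [Matrix.map_apply, TM]
  split_ifs <;> simp [apply_ite f]

variable {O N}

open scoped Classical in
lemma max_step {f h : V → ℝ} (v : V) (hf : ∀ w, 0 ≤ f w) (hs : ∑ w, f w * (h w - h v) = 0)
    (hm : ∀ w, h w ≤ h v) {w : V} (hw : 0 < f w) : h w = h v := by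
  have := (Finset.sum_eq_zero_iff_of_nonpos (fun w _ =>
    mul_nonpos_of_nonneg_of_nonpos (hf w) (sub_nonpos.2 (hm w)))).1 hs w (Finset.mem_univ _)
  rcases mul_eq_zero.1 this with h | h
  · exact absurd h hw.ne'
  · linarith

lemma TM_le_zero [Nonempty V] {m : V → V → ℝ} (hm : ∀ v w, 0 ≤ m v w)
    (hr : ∀ v, ∃ o, O o ∧ Relation.ReflTransGen (fun a b => N a b ∧ 0 < m a b) v o)
    (h : V → ℝ) (hh : TM O N m *ᵥ h = 0) (v : V) : h v ≤ 0 := by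
  classical
  obtain ⟨v0, -, h0⟩ := Finset.exists_max_image (Finset.univ : Finset V) h Finset.univ_nonempty
  obtain ⟨o, ho, hp⟩ := hr v0
  have key : ∀ w, Relation.ReflTransGen (fun a b => N a b ∧ 0 < m a b) v0 w → h w = h v0 ∨ h v0 ≤ 0 := by
    intro w hw
    induction hw with
    | refl => exact Or.inl rfl
    | @tail b c _ hbc ih =>
      rcases ih with ih | ih
      · by_cases hb : O b
        · right
          have := congrFun hh b
          rw [TM_out O N m h hb] at this
          simp only [Pi.zero_apply] at this
          linarith
        · left
          have := congrFun hh b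
          rw [TM_in O N m h hb] at this
          rw [← ih]
          refine max_step b (f := fun w => if N b w then m b w else 0) ?_ this ?_ ?_
          · intro w; split_ifs; exacts [hm _ _, le_rfl]
          · intro w; rw [ih]; exact h0 w (Finset.mem_univ _)
          · simpa [hbc.1] using hbc.2
      · exact Or.inr ih
  have h1 := h0 v (Finset.mem_univ _)
  rcases key o hp with h2 | h2
  · have := congrFun hh o
    rw [TM_out O N m h ho] at this
    simp only [Pi.zero_apply] at this
    linarith
  · linarith

lemma TM_det [Nonempty V] {m : V → V → ℝ} (hm : ∀ v w, 0 ≤ m v w)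
    (hr : ∀ v, ∃ o, O o ∧ Relation.ReflTransGen (fun a b => N a b ∧ 0 < m a b) v o) :
    (TM O N m).det ≠ 0 := by
  intro h
  obtain ⟨g, hg, hg0⟩ := Matrix.exists_mulVec_eq_zero_iff.2 h
  apply hg
  funext v
  refine le_antisymm (TM_le_zero hm hr g hg0 v) ?_
  have := TM_le_zero hm hr (-g) (by rw [Matrix.mulVec_neg, hg0, neg_zero]) v
  simpa using this

section matching
variable (h3 : ∀ S : V → Prop, (∃ v, S v) → (∀ v, S v → ¬ O v) →
  3 ≤ nc (fun w => ¬ S w ∧ ∃ v, S v ∧ N v w))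
include h3

lemma exists_match (a b c : V) : ∃ m : V → V, (∀ v, O v → m v = v) ∧
    (∀ v, ¬ O v → m v = v ∨ N v (m v)) ∧ (∀ v w, ¬ O v → ¬ O w → m v = m w → v = w) ∧
    ∀ v, ¬ O v → m v ≠ a ∧ m v ≠ b ∧ m v ≠ c := by
  classical
  let t : {v // ¬ O v} → Finset V := fun v =>
    Finset.univ.filter (fun w => (w = v ∨ N v w) ∧ w ≠ a ∧ w ≠ b ∧ w ≠ c)
  obtain ⟨f, hf, hft⟩ := (Finset.all_card_le_biUnion_card_iff_exists_injective t).1 (by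
    intro s
    rcases s.eq_empty_or_nonempty with rfl | ⟨v0, hv0⟩
    · simp
    let S : V → Prop := fun v => ∃ h : ¬ O v, (⟨v, h⟩ : {v // ¬ O v}) ∈ s
    have h := h3 S ⟨v0.1, v0.2, hv0⟩ (fun v hv => hv.1)
    have h1 : nc (fun w => S w ∨ ∃ v, S v ∧ N v w) ≤
        nc (fun w => (S w ∨ ∃ v, S v ∧ N v w) ∧ w ≠ a ∧ w ≠ b ∧ w ≠ c) + 3 := by
      have e : nc (fun w => w = a ∨ w = b ∨ w = c) ≤ 3 := by
        rw [nc, Nat.card_eq_fintype_card, Fintype.card_subtype]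
        refine le_trans (Finset.card_le_card (t := {a, b, c}) ?_) Finset.card_le_three
        intro x; simp
      refine (nc_le_add (p := fun w => (S w ∨ ∃ v, S v ∧ N v w) ∧ w ≠ a ∧ w ≠ b ∧ w ≠ c)
        (q := fun w => w = a ∨ w = b ∨ w = c) ?_).trans (by omega)
      intro w hw
      by_cases e1 : w = a ∨ w = b ∨ w = c
      · exact Or.inr e1
      · exact Or.inl ⟨hw, by push Not at e1; exact e1⟩
    have h2 : nc S + nc (fun w => ¬ S w ∧ ∃ v, S v ∧ N v w) ≤ nc (fun w => S w ∨ ∃ v, S v ∧ N v w) :=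
      nc_add_le (fun x hx => Or.inl hx) (fun x hx => Or.inr hx.2) (fun x hx h => h.1 hx)
    have h4 : nc S = s.card := by
      rw [← Finset.card_map (Function.Embedding.subtype _), nc, Nat.card_eq_fintype_card,
        Fintype.card_subtype]
      congr 1; ext v; simp [S]
    have h5 : nc (fun w => (S w ∨ ∃ v, S v ∧ N v w) ∧ w ≠ a ∧ w ≠ b ∧ w ≠ c) ≤ (s.biUnion t).card := by
      rw [nc, Nat.card_eq_fintype_card, Fintype.card_subtype]
      apply Finset.card_le_card
      intro w hw
      simp only [Finset.mem_filter, Finset.mem_univ, true_and] at hw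
      simp only [Finset.mem_biUnion, t, Finset.mem_filter, Finset.mem_univ, true_and]
      obtain ⟨⟨h, hw1⟩ | ⟨v, ⟨h, hv⟩, hn⟩, hw2⟩ := hw
      · exact ⟨⟨w, h⟩, hw1, Or.inl rfl, hw2⟩
      · exact ⟨⟨v, h⟩, hv, Or.inr hn, hw2⟩
    omega)
  simp only [t, Finset.mem_filter, Finset.mem_univ, true_and] at hft
  refine ⟨fun v => if h : O v then v else f ⟨v, h⟩, ?_, ?_, ?_, ?_⟩
  · intro v hv; simp [hv]
  · intro v hv; simpa [hv] using (hft ⟨v, hv⟩).1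
  · intro v w hv hw h
    simp only [hv, hw, dif_neg, not_false_eq_true] at h
    simpa using hf h
  · intro v hv; simpa [hv] using (hft ⟨v, hv⟩).2

lemma reach_all {m : V → V → ℝ} {P : V → Prop}
    (hP : ∀ v, P v → ∃ o, O o ∧ Relation.ReflTransGen (fun a b => N a b ∧ 0 < m a b) v o)
    (hm : ∀ v w, ¬ P v → 0 < m v w) (v : V) :
    ∃ o, O o ∧ Relation.ReflTransGen (fun a b => N a b ∧ 0 < m a b) v o := by
  by_contra hcon
  have h := h3 (fun v => ¬ ∃ o, O o ∧ Relation.ReflTransGen (fun a b => N a b ∧ 0 < m a b) v o)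
    ⟨v, hcon⟩ (fun v hv ho => hv ⟨v, ho, .refl⟩)
  have : ∃ w, (fun w => ¬¬(∃ o, O o ∧ Relation.ReflTransGen (fun a b => N a b ∧ 0 < m a b) w o) ∧
      ∃ v, (¬ ∃ o, O o ∧ Relation.ReflTransGen (fun a b => N a b ∧ 0 < m a b) v o) ∧ N v w) w := by
    by_contra hne
    push Not at hne
    rw [nc] at h
    have hz : IsEmpty {w // ¬¬(∃ o, O o ∧ Relation.ReflTransGen (fun a b => N a b ∧ 0 < m a b) w o) ∧
      ∃ v, (¬ ∃ o, O o ∧ Relation.ReflTransGen (fun a b => N a b ∧ 0 < m a b) v o) ∧ N v w} :=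
      ⟨fun w => by
        obtain ⟨h1, u, h2, h3⟩ := w.2
        push Not at h1 h2
        exact hne w.1 h1 u h2 h3⟩
    rw [Nat.card_of_isEmpty] at h
    omega
  obtain ⟨w, hw, u, hu, huw⟩ := this
  rw [not_not] at hw
  obtain ⟨o, ho, hwo⟩ := hw
  have hPu : ¬ P u := fun h => hu (hP u h)
  exact hu ⟨o, ho, .head ⟨huw, hm _ _ hPu⟩ hwo⟩

lemma exists_special [Nonempty V] (a b c : V) (hab : a ≠ b) (hac : a ≠ c) (hbc : b ≠ c) :
    ∃ μ : V → V → ℝ, (TM O N μ).det ≠ 0 ∧ ∃ ea eb ec, O ea ∧ O eb ∧ O ec ∧ ea ≠ eb ∧ ea ≠ ec ∧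
      eb ≠ ec ∧ ∀ q h : V → ℝ, TM O N μ *ᵥ h = TB O q → h a = q ea ∧ h b = q eb ∧ h c = q ec := by
  classical
  obtain ⟨m, mO, mN, minj, mX⟩ := exists_match h3 a b c
  let X : V → Prop := fun v => v = a ∨ v = b ∨ v = c
  have mX' : ∀ v, ¬ O v → ¬ X (m v) := by
    intro v hv; have := mX v hv; simp only [X]; tauto
  have cancel : ∀ k l x y, X x → X y → (∀ i < k, ¬ O (m^[i] x)) → (∀ i < l, ¬ O (m^[i] y)) →
      m^[k] x = m^[l] y → x = y ∧ k = l := by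
    intro k
    induction k with
    | zero =>
      intro l x y hx hy _ hl h
      cases l with
      | zero => exact ⟨h, rfl⟩
      | succ l =>
        rw [Function.iterate_succ_apply'] at h
        exact absurd hx (by rw [show x = _ from h]; exact mX' _ (hl l (by omega)))
    | succ k ih =>
      intro l x y hx hy hk hl h
      rw [Function.iterate_succ_apply'] at h
      cases l with
      | zero =>
        exact absurd hy (by rw [show y = _ from h.symm]; exact mX' _ (hk k (by omega)))
      | succ l =>
        rw [Function.iterate_succ_apply'] at h
        have := ih l x y hx hy (fun i hi => hk i (by omega)) (fun i hi => hl i (by omega))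
          (minj _ _ (hk k (by omega)) (hl l (by omega)) h)
        exact ⟨this.1, by omega⟩
  have hit : ∀ x, X x → ∃ k, O (m^[k] x) := by
    intro x hx
    by_contra hne
    push Not at hne
    obtain ⟨i, j, hij, h⟩ := Finite.exists_ne_map_eq_of_infinite (fun k => m^[k] x)
    exact hij (cancel i j x x hx hx (fun _ _ => hne _) (fun _ _ => hne _) h).2
  have hOm : ∀ v, O v → ∀ k, m^[k] v = v := fun v hv k => Function.iterate_fixed (mO v hv) k
  let P : V → Prop := fun v => ∃ x, X x ∧ ∃ i, v = m^[i] x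
  have Pm : ∀ v, P v → P (m v) := by
    rintro v ⟨x, hx, i, rfl⟩
    exact ⟨x, hx, i+1, by rw [Function.iterate_succ_apply']⟩
  have PO : ∀ v, P v → ∃ k, O (m^[k] v) := by
    rintro v ⟨x, hx, i, rfl⟩
    obtain ⟨k, hk⟩ := hit x hx
    refine ⟨k, ?_⟩
    rw [← Function.iterate_add_apply, add_comm, Function.iterate_add_apply, hOm _ hk]
    exact hk
  have PN : ∀ v, P v → ¬ O v → N v (m v) := by
    intro v hv ho
    refine (mN v ho).resolve_left (fun h => ?_)
    obtain ⟨k, hk⟩ := PO v hv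
    rw [Function.iterate_fixed h] at hk
    exact ho hk
  let μ : V → V → ℝ := fun v w => if P v then (if w = m v then 1 else 0) else 1
  have hμ : ∀ v w, 0 ≤ μ v w := by
    intro v w; simp only [μ]; split_ifs <;> norm_num
  have hPr : ∀ k v, P v → O (m^[k] v) →
      ∃ o, O o ∧ Relation.ReflTransGen (fun a b => N a b ∧ 0 < μ a b) v o := by
    intro k
    induction k with
    | zero => intro v _ ho; exact ⟨v, ho, .refl⟩
    | succ k ih =>
      intro v hv ho
      by_cases hvo : O v
      · exact ⟨v, hvo, .refl⟩
      obtain ⟨o, h1, h2⟩ := ih (m v) (Pm v hv) ho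
      exact ⟨o, h1, .head ⟨PN v hv hvo, by simp [μ, hv]⟩ h2⟩
  refine ⟨μ, TM_det hμ (reach_all h3 (P := P) (fun v hv => ?_) (fun v w hv => by simp [μ, hv])), ?_⟩
  · obtain ⟨k, hk⟩ := PO v hv
    exact hPr k v hv hk
  have hval : ∀ q h : V → ℝ, TM O N μ *ᵥ h = TB O q → ∀ k v, P v → h (m^[k] v) = h v := by
    intro q h hh k
    induction k with
    | zero => intro v _; rfl
    | succ k ih =>
      intro v hv
      rw [Function.iterate_succ_apply, ih (m v) (Pm v hv)]
      by_cases hvo : O v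
      · rw [mO v hvo]
      · have := congrFun hh v
        rw [TM_in O N μ h hvo, Finset.sum_eq_single (m v)] at this
        · simp [PN v hv hvo, μ, hv, TB, hvo] at this
          linarith
        · intro w _ hw; simp [μ, hv, hw]
        · simp
  have hend : ∀ x (hx : X x), ∀ q h : V → ℝ, TM O N μ *ᵥ h = TB O q →
      h x = q (m^[Nat.find (hit x hx)] x) := by
    intro x hx q h hh
    have ho := Nat.find_spec (hit x hx)
    rw [← hval q h hh (Nat.find (hit x hx)) x ⟨x, hx, 0, rfl⟩]
    have := congrFun hh (m^[Nat.find (hit x hx)] x)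
    rw [TM_out O N μ h ho] at this
    rw [this]; simp [TB, ho]
  have hne : ∀ x (hx : X x) y (hy : X y), x ≠ y →
      m^[Nat.find (hit x hx)] x ≠ m^[Nat.find (hit y hy)] y := by
    intro x hx y hy hxy h
    exact hxy (cancel _ _ x y hx hy (fun i hi => Nat.find_min _ hi) (fun i hi => Nat.find_min _ hi) h).1
  have Xa : X a := Or.inl rfl
  have Xb : X b := Or.inr (Or.inl rfl)
  have Xc : X c := Or.inr (Or.inr rfl)
  exact ⟨_, _, _, Nat.find_spec (hit a Xa), Nat.find_spec (hit b Xb), Nat.find_spec (hit c Xc),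
    hne a Xa b Xb hab, hne a Xa c Xc hac, hne b Xb c Xc hbc,
    fun q h hh => ⟨hend a Xa q h hh, hend b Xb q h hh, hend c Xc q h hh⟩⟩

open scoped Classical in
lemma exists_tutte [Nonempty V] (q : V → ℝ × ℝ)
    (hq : ∀ a b c, O a → O b → O c → a ≠ b → a ≠ c → b ≠ c → det3 (q a) (q b) (q c) ≠ 0) :
    ∃ (lam : V → V → ℝ) (p : V → ℝ × ℝ), (∀ v w, 0 < lam v w) ∧ (∀ v, O v → p v = q v) ∧
      (∀ v, ¬ O v → ∑ w, (if N v w then lam v w else 0) * ((p w).1 - (p v).1) = 0 ∧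
        ∑ w, (if N v w then lam v w else 0) * ((p w).2 - (p v).2) = 0) ∧
      ∀ a b c, a ≠ b → a ≠ c → b ≠ c → det3 (p a) (p b) (p c) ≠ 0 := by
  let Rg := MvPolynomial (V × V) ℝ
  let Mt : Matrix V V Rg := TM O N (fun v w => MvPolynomial.X (v, w))
  let Px : V → Rg := Mt.adjugate *ᵥ (TB O (fun v => MvPolynomial.C (q v).1))
  let Py : V → Rg := Mt.adjugate *ᵥ (TB O (fun v => MvPolynomial.C (q v).2))
  let D : V × V × V → Rg := fun t =>
    Mt.det * ((Px t.2.1 - Px t.1) * (Py t.2.2 - Py t.1) - (Py t.2.1 - Py t.1) * (Px t.2.2 - Px t.1))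
  have ev : ∀ μ : V × V → ℝ, (MvPolynomial.eval μ) Mt.det = (TM O N (fun v w => μ (v, w))).det := by
    intro μ
    rw [RingHom.map_det, RingHom.mapMatrix_apply]
    simp only [Mt, TM_map, MvPolynomial.eval_X]
  have ev1 : ∀ (μ : V × V → ℝ) (g : V → ℝ) v,
      (MvPolynomial.eval μ) ((Mt.adjugate *ᵥ (TB O (fun v => MvPolynomial.C (g v)))) v) =
      ((TM O N (fun v w => μ (v, w))).adjugate *ᵥ (TB O g)) v := by
    intro μ g v
    rw [RingHom.map_mulVec, ← RingHom.mapMatrix_apply, RingHom.map_adjugate, RingHom.mapMatrix_apply]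
    simp only [Mt, TM_map, MvPolynomial.eval_X]
    congr 2
    funext v; simp only [Function.comp, TB]; split_ifs <;> simp
  have sol : ∀ (μ : V → V → ℝ) (g : V → ℝ), (TM O N μ).det ≠ 0 →
      TM O N μ *ᵥ ((TM O N μ).det⁻¹ • ((TM O N μ).adjugate *ᵥ (TB O g))) = TB O g := by
    intro μ g hd
    rw [Matrix.mulVec_smul, Matrix.mulVec_mulVec, Matrix.mul_adjugate, Matrix.smul_mulVec,
      Matrix.one_mulVec, smul_smul, inv_mul_cancel₀ hd, one_smul]
  -- values
  have evD : ∀ (μ : V → V → ℝ) t, (TM O N μ).det ≠ 0 →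
      (MvPolynomial.eval (fun e => μ e.1 e.2)) (D t) = (TM O N μ).det ^ 3 *
      (let h1 := (TM O N μ).det⁻¹ • ((TM O N μ).adjugate *ᵥ (TB O fun v => (q v).1));
       let h2 := (TM O N μ).det⁻¹ • ((TM O N μ).adjugate *ᵥ (TB O fun v => (q v).2));
       det3 (h1 t.1, h2 t.1) (h1 t.2.1, h2 t.2.1) (h1 t.2.2, h2 t.2.2)) := by
    intro μ t hd
    simp only [D, Px, Py, map_mul, map_sub, ev, ev1, det3, Pi.smul_apply, smul_eq_mul]
    field_simp
  let Tr : Finset (V × V × V) :=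
    Finset.univ.filter (fun t => t.1 ≠ t.2.1 ∧ t.1 ≠ t.2.2 ∧ t.2.1 ≠ t.2.2)
  have hD0 : ∀ t ∈ Tr, D t ≠ 0 := by
    intro t ht h0
    simp only [Tr, Finset.mem_filter, Finset.mem_univ, true_and] at ht
    obtain ⟨μ, hd, ea, eb, ec, oa, ob, oc, hab, hac, hbc, hv⟩ :=
      exists_special h3 t.1 t.2.1 t.2.2 ht.1 ht.2.1 ht.2.2
    have h := evD μ t hd
    rw [h0, map_zero] at h
    obtain ⟨x1, x2, x3⟩ := hv _ _ (sol μ (fun v => (q v).1) hd)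
    obtain ⟨y1, y2, y3⟩ := hv _ _ (sol μ (fun v => (q v).2) hd)
    simp only [x1, x2, x3, y1, y2, y3] at h
    rcases mul_eq_zero.1 h.symm with h | h
    · exact hd (pow_eq_zero_iff (by norm_num) |>.1 h)
    · exact hq ea eb ec oa ob oc hab hac hbc h
  have hQ : (∏ t ∈ Tr, D t) ≠ 0 := Finset.prod_ne_zero_iff.2 hD0
  have hpos : ∃ μ : V × V → ℝ, (∀ e, 0 < μ e) ∧ (MvPolynomial.eval μ) (∏ t ∈ Tr, D t) ≠ 0 := by
    by_contra hne
    push Not at hne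
    apply hQ
    refine MvPolynomial.funext_set (fun _ => Set.Ioi (0:ℝ)) (fun _ => Set.Ioi_infinite 0) ?_
    intro x hx
    rw [map_zero]
    exact hne x (fun e => hx e (Set.mem_univ _))
  obtain ⟨μ, hμ, hev⟩ := hpos
  have hdet : (TM O N (fun v w => μ (v, w))).det ≠ 0 := by
    refine TM_det (fun v w => (hμ _).le) (reach_all h3 (P := fun _ => False) (fun v h => h.elim)
      (fun v w _ => hμ _))
  set m : V → V → ℝ := fun v w => μ (v, w) with hm
  refine ⟨m, fun v => (((TM O N m).det⁻¹ • ((TM O N m).adjugate *ᵥ (TB O fun v => (q v).1))) v,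
    ((TM O N m).det⁻¹ • ((TM O N m).adjugate *ᵥ (TB O fun v => (q v).2))) v),
    fun v w => hμ _, ?_, ?_, ?_⟩
  · intro v hv
    have e1 := congrFun (sol m (fun v => (q v).1) hdet) v
    have e2 := congrFun (sol m (fun v => (q v).2) hdet) v
    rw [TM_out O N m _ hv] at e1 e2
    ext
    · simp only [e1, TB, hv, if_true]
    · simp only [e2, TB, hv, if_true]
  · intro v hv
    have e1 := congrFun (sol m (fun v => (q v).1) hdet) v
    have e2 := congrFun (sol m (fun v => (q v).2) hdet) v
    rw [TM_in O N m _ hv] at e1 e2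
    simp only [TB, hv, if_false] at e1 e2
    exact ⟨e1, e2⟩
  · intro a b c hab hac hbc h0
    rw [map_prod] at hev
    have := Finset.prod_ne_zero_iff.1 hev (a, b, c) (by simp [Tr, hab, hac, hbc])
    have h2 := evD m (a, b, c) hdet
    simp only [hm, Prod.mk.eta] at h2
    apply this
    refine h2.trans ?_
    rw [mul_eq_zero]; right
    exact h0

end matching
end tutte

set_option linter.unusedSectionVars false

variable {V : Type} [Fintype V] [DecidableEq V] {G : SimpleGraph V} [DecidableRel G.Adj]
  {E : PlaneEmb G} {big : G.Dart → Prop}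

/-- active neighbours -/
def Tri.Nb (T : Tri E big) (v w : V) : Prop := ∃ x, T.act x ∧ T.src x = v ∧ T.tgt x = w

open scoped Classical in
/-- a Tutte drawing -/
structure Dr (T : Tri E big) where
  hc : IsCPTLabelling E big
  h3 : ∀ x, T.isOut x → T.ψ (T.ψ x) ≠ x
  tc : ∀ S : V → Prop, (∃ v, S v) → (∀ v, S v → ¬ T.OV v) →
    3 ≤ nc (fun w => ¬ S w ∧ ∃ v, S v ∧ T.Nb v w)
  p : V → ℝ × ℝ
  B : ℕ
  hB : 3 ≤ B
  j : T.D → ℕ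
  j_lt : ∀ x, T.isOut x → j x < B
  j_ψ : ∀ x, T.isOut x → j (T.ψ x) = if j x + 1 = B then 0 else j x + 1
  j_inj : ∀ x y, T.isOut x → T.isOut y → j x = j y → x = y
  j_surj : ∀ k < B, ∃ x, T.isOut x ∧ j x = k
  p_out : ∀ x, T.isOut x → p (T.src x) = ((j x : ℝ), (j x : ℝ) ^ 2)
  lam : V → V → ℝ
  lam_pos : ∀ v w, 0 < lam v w
  equ : ∀ v, ¬ T.OV v →
    ∑ w, (if T.Nb v w then lam v w else 0) * ((p w).1 - (p v).1) = 0 ∧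
    ∑ w, (if T.Nb v w then lam v w else 0) * ((p w).2 - (p v).2) = 0
  gp : ∀ a b c, a ≠ b → a ≠ c → b ≠ c → det3 (p a) (p b) (p c) ≠ 0

namespace Tri
variable (T : Tri E big)

lemma out_orbit {x y : T.D} (hx : T.isOut x) (hy : T.isOut y) : ∃ k, T.ψ^[k] x = y := by
  have key : ∀ d, Relation.ReflTransGen (fun a b => b = (E.rot a).symm) (T.ang x) d →
      ∃ k, T.ψ^[k] x = T.ι d := by
    intro d hd
    induction hd with
    | refl => exact ⟨0, T.out_range hx⟩
    | @tail b c _ hbc ih =>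
      obtain ⟨k, hk⟩ := ih
      refine ⟨k + 1, ?_⟩
      have ho : T.isOut (T.ι b) := by
        rw [← hk]
        clear hk
        induction k with
        | zero => exact hx
        | succ k ih => rw [Function.iterate_succ_apply']; simpa using ih
      rw [Function.iterate_succ_apply', hk, hbc, T.ψ_def, T.σ_out ho, T.ang_ι, T.α_ι]
  obtain ⟨k, hk⟩ := key _ (angleFace_trans (T.ang x) (T.ang y) (Eq.trans hx (Eq.symm hy)))
  exact ⟨k, hk.trans (T.out_range hy).symm⟩

lemma exists_idx (h3 : ∀ x, T.isOut x → T.ψ (T.ψ x) ≠ x) :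
    ∃ (B : ℕ) (j : T.D → ℕ), 3 ≤ B ∧ (∀ x, T.isOut x → j x < B) ∧
    (∀ x, T.isOut x → j (T.ψ x) = if j x + 1 = B then 0 else j x + 1) ∧
    (∀ x y, T.isOut x → T.isOut y → j x = j y → x = y) ∧
    (∀ k < B, ∃ x, T.isOut x ∧ j x = k) := by
  classical
  have := T.fin
  obtain ⟨x0, hx0⟩ := T.exists_out
  set B := Function.minimalPeriod T.ψ x0 with hBdef
  have hper : x0 ∈ Function.periodicPts T.ψ :=
    Function.Injective.mem_periodicPts (fun a b h => T.ψ_inj h) x0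
  have hB0 : 0 < B := Function.minimalPeriod_pos_of_mem_periodicPts hper
  have hBx : T.ψ^[B] x0 = x0 := Function.iterate_minimalPeriod
  have hB : 3 ≤ B := by
    have h2 := h3 x0 hx0
    by_contra hlt
    have : B = 1 ∨ B = 2 := by omega
    rcases this with h | h <;> rw [h] at hBx
    · have e : T.ψ x0 = x0 := hBx
      exact h2 (by rw [e, e])
    · exact h2 hBx
  have uniq : ∀ k l, k < B → l < B → T.ψ^[k] x0 = T.ψ^[l] x0 → k = l := fun k l hk hl h =>
    (Function.iterate_eq_iterate_iff_of_lt_minimalPeriod hk hl).1 h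
  have ho : ∀ k, T.isOut (T.ψ^[k] x0) := by
    intro k
    induction k with
    | zero => exact hx0
    | succ k ih => rw [Function.iterate_succ_apply']; simpa using ih
  have ex : ∀ x, ∃ k, T.isOut x → k < B ∧ T.ψ^[k] x0 = x := by
    intro x
    by_cases hx : T.isOut x
    · obtain ⟨k, hk⟩ := T.out_orbit hx0 hx
      exact ⟨k % B, fun _ => ⟨Nat.mod_lt _ hB0, by rw [Function.iterate_mod_minimalPeriod_eq, hk]⟩⟩
    · exact ⟨0, fun h => absurd h hx⟩
  choose j hj using ex
  refine ⟨B, j, hB, fun x hx => (hj x hx).1, ?_, ?_, ?_⟩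
  · intro x hx
    have h1 := hj x hx
    have h2 := hj (T.ψ x) (by simpa using hx)
    have e : T.ψ^[j x + 1] x0 = T.ψ x := by rw [Function.iterate_succ_apply', h1.2]
    split_ifs with h
    · refine uniq _ _ h2.1 hB0 ?_
      rw [h2.2, ← e, h, hBx]; rfl
    · exact uniq _ _ h2.1 (by omega) (by rw [h2.2, e])
  · intro x y hx hy h
    rw [← (hj x hx).2, ← (hj y hy).2, h]
  · intro k hk
    exact ⟨_, ho k, uniq _ _ (hj _ (ho k)).1 hk (hj _ (ho k)).2⟩

lemma det3_parab (a b c : ℝ) : det3 (a, a^2) (b, b^2) (c, c^2) = (b - a) * (c - a) * (c - b) := by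
  simp only [det3]; ring

lemma exists_dr (hc : IsCPTLabelling E big) (h3 : ∀ x, T.isOut x → T.ψ (T.ψ x) ≠ x)
    (hgl : GenLaman G big) : Nonempty (Dr T) := by
  classical
  obtain ⟨B, j, hB, j1, j2, j3, j4⟩ := T.exists_idx h3
  have hne : Nonempty V := by
    obtain ⟨x, -⟩ := T.exists_out
    exact ⟨T.src x⟩
  have tc : ∀ S : V → Prop, (∃ v, S v) → (∀ v, S v → ¬ T.OV v) →
      3 ≤ nc (fun w => ¬ S w ∧ ∃ v, S v ∧ T.Nb v w) := by
    intro S hS hO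
    refine (three_conn hc h3 hgl S hS hO).trans (nc_mono ?_)
    rintro w ⟨h1, x, h2, h3, h4⟩
    exact ⟨h1, _, h3, x, h2, rfl, h4⟩
  have ex : ∀ v, ∃ q : ℝ × ℝ, ∀ x, T.isOut x → T.src x = v → q = ((j x : ℝ), (j x : ℝ) ^ 2) := by
    intro v
    by_cases h : T.OV v
    · obtain ⟨x, hx, hxv⟩ := h
      exact ⟨((j x : ℝ), (j x : ℝ) ^ 2), fun y hy hyv => by rw [T.out_uniq hc hx hy (hxv.trans hyv.symm)]⟩
    · exact ⟨0, fun x hx hxv => absurd ⟨x, hx, hxv⟩ h⟩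
  choose q hq using ex
  obtain ⟨lam, p, h1, h2, h3', h4⟩ := exists_tutte (O := T.OV)
    (N := T.Nb) tc q (by
    rintro a b c ⟨x, hx, rfl⟩ ⟨y, hy, rfl⟩ ⟨z, hz, rfl⟩ hab hac hbc
    rw [hq _ x hx rfl, hq _ y hy rfl, hq _ z hz rfl, det3_parab]
    have e : ∀ x y, T.isOut x → T.isOut y → T.src x ≠ T.src y → (j y : ℝ) - j x ≠ 0 := by
      intro x y hx hy h h0
      have : (j y : ℝ) = j x := by linarith
      exact h (by rw [j3 x y hx hy (by exact_mod_cast this.symm)])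
    exact mul_ne_zero (mul_ne_zero (e x y hx hy hab) (e x z hx hz hac)) (e y z hy hz hbc))
  exact ⟨⟨hc, h3, tc, p, B, hB, j, j1, j2, j3, j4,
    fun x hx => by rw [h2 _ ⟨x, hx, rfl⟩, hq _ x hx rfl], lam, h1, h3', h4⟩⟩

end Tri

set_option linter.unusedSectionVars false
open Filter Topology

lemma dot2_add_left (a b z : ℝ × ℝ) : dot2 (a + b) z = dot2 a z + dot2 b z := by
  simp only [dot2, Prod.fst_add, Prod.snd_add]; ring
lemma dot2_smul_left (t : ℝ) (b z : ℝ × ℝ) : dot2 (t • b) z = t * dot2 b z := by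
  simp only [dot2, Prod.smul_fst, Prod.smul_snd, smul_eq_mul]; ring
lemma dot2_neg_left (b z : ℝ × ℝ) : dot2 (-b) z = - dot2 b z := by
  simp only [dot2, Prod.fst_neg, Prod.snd_neg]; ring
lemma dot2_neg_right (b z : ℝ × ℝ) : dot2 b (-z) = - dot2 b z := by
  simp only [dot2, Prod.fst_neg, Prod.snd_neg]; ring
lemma dot2_sub_right (c a b : ℝ × ℝ) : dot2 c (a - b) = dot2 c a - dot2 c b := by
  simp only [dot2, Prod.fst_sub, Prod.snd_sub]; ring
lemma dot2_self_pos {w : ℝ × ℝ} (h : w ≠ 0) : 0 < dot2 w w := by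
  simp only [dot2]
  by_contra hh
  apply h
  have h1 : w.1 = 0 := by nlinarith [sq_nonneg w.1, sq_nonneg w.2]
  have h2 : w.2 = 0 := by nlinarith [sq_nonneg w.1, sq_nonneg w.2]
  exact Prod.ext h1 h2

lemma ev_lex (c g z : ℝ × ℝ) (h : 0 < dot2 c z ∨ (dot2 c z = 0 ∧ 0 < dot2 g z)) :
    ∀ᶠ e in 𝓝[>] (0:ℝ), 0 < dot2 (c + e • g) z := by
  rcases h with h | ⟨h1, h2⟩
  · have ht : Tendsto (fun e : ℝ => dot2 (c + e • g) z) (𝓝[>] 0) (𝓝 (dot2 c z)) := by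
      simp only [dot2_add_left, dot2_smul_left]
      have : Tendsto (fun e : ℝ => dot2 c z + e * dot2 g z) (𝓝 0) (𝓝 (dot2 c z + 0 * dot2 g z)) :=
        (continuous_const.add (continuous_id.mul continuous_const)).tendsto 0
      rw [zero_mul, add_zero] at this
      exact this.mono_left nhdsWithin_le_nhds
    exact ht.eventually (lt_mem_nhds h)
  · filter_upwards [self_mem_nhdsWithin] with e he
    rw [dot2_add_left, dot2_smul_left, h1, zero_add]
    exact mul_pos he h2

lemma ev_ne {c g z : ℝ × ℝ} (h : dot2 c z ≠ 0 ∨ dot2 g z ≠ 0) :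
    ∀ᶠ e in 𝓝[>] (0:ℝ), dot2 (c + e • g) z ≠ 0 := by
  rcases lt_trichotomy (dot2 c z) 0 with h0 | h0 | h0
  · filter_upwards [ev_lex c g (-z) (Or.inl (by rw [dot2_neg_right]; linarith))] with e he
    rw [dot2_neg_right] at he; linarith
  · have h := h.resolve_left (not_not.2 h0)
    rcases lt_or_gt_of_ne h with h1 | h1
    · filter_upwards [ev_lex c g (-z) (Or.inr (by simp only [dot2_neg_right]; constructor <;> linarith))] with e he
      rw [dot2_neg_right] at he; linarith
    · filter_upwards [ev_lex c g z (Or.inr ⟨h0, h1⟩)] with e he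
      exact he.ne'
  · filter_upwards [ev_lex c g z (Or.inl h0)] with e he
    exact he.ne'

lemma gen_lex {ι κ : Type} [Finite ι] [Finite κ] (c g : ℝ × ℝ) (z : ι → ℝ × ℝ)
    (hz : ∀ i, 0 < dot2 c (z i) ∨ (dot2 c (z i) = 0 ∧ 0 < dot2 g (z i)))
    (w : κ → ℝ × ℝ) (hw : ∀ j, w j ≠ 0) :
    ∃ c', (∀ i, 0 < dot2 c' (z i)) ∧ ∀ j, dot2 c' (w j) ≠ 0 := by
  obtain ⟨e, he⟩ := (eventually_all.2 fun i => ev_lex c g (z i) (hz i)).exists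
  -- perturb in both directions
  obtain ⟨e1, h1, h1'⟩ := ((eventually_all.2 fun i => ev_lex (c + e • g) (1, 0) (z i) (Or.inl (he i))).and
    (eventually_all.2 fun j : {j // (w j).1 ≠ 0} => ev_ne (c := c + e • g) (g := (1, 0)) (z := w j)
      (Or.inr (by simpa [dot2] using j.2)))).exists
  obtain ⟨e2, h2, h2', h2''⟩ := ((eventually_all.2 fun i => ev_lex (c + e • g + e1 • (1, 0)) (0, 1) (z i)
    (Or.inl (h1 i))).and ((eventually_all.2 fun j : {j // (w j).1 ≠ 0} =>
      ev_ne (c := c + e • g + e1 • (1, 0)) (g := (0, 1)) (z := w j) (Or.inl (h1' j))).and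
    (eventually_all.2 fun j : {j // (w j).2 ≠ 0} =>
      ev_ne (c := c + e • g + e1 • (1, 0)) (g := (0, 1)) (z := w j)
        (Or.inr (by simpa [dot2] using j.2))))).exists
  refine ⟨_, h2, fun j => ?_⟩
  by_cases hj : (w j).1 = 0
  · refine h2'' ⟨j, fun h => hw j (Prod.ext hj h)⟩
  · exact h2' ⟨j, hj⟩

lemma nc_three_exists {α : Type} [Finite α] {p : α → Prop} (h : 3 ≤ nc p) :
    ∃ a b c, p a ∧ p b ∧ p c ∧ a ≠ b ∧ a ≠ c ∧ b ≠ c := by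
  classical
  have := Fintype.ofFinite α
  rw [nc, Nat.card_eq_fintype_card, Fintype.card_subtype] at h
  obtain ⟨a, b, c, ha, hb, hc, h1, h2, h3⟩ := Finset.two_lt_card_iff.1 (show 2 < _ from h)
  simp only [Finset.mem_filter, Finset.mem_univ, true_and] at ha hb hc
  exact ⟨a, b, c, ha, hb, hc, h1, h2, h3⟩

namespace Dr
variable {V : Type} [Fintype V] [DecidableEq V] {G : SimpleGraph V} [DecidableRel G.Adj]
  {E : PlaneEmb G} {big : G.Dart → Prop} {T : Tri E big} (d : Dr T)

/-- height function -/
def f (c : ℝ × ℝ) (v : V) : ℝ := dot2 c (d.p v)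

open scoped Classical in
lemma equil (c : ℝ × ℝ) {v : V} (hv : ¬ T.OV v) :
    ∑ w, (if T.Nb v w then d.lam v w else 0) * (d.f c w - d.f c v) = 0 := by
  obtain ⟨h1, h2⟩ := d.equ v hv
  have : ∀ w, (if T.Nb v w then d.lam v w else 0) * (d.f c w - d.f c v) =
      c.1 * ((if T.Nb v w then d.lam v w else 0) * ((d.p w).1 - (d.p v).1)) +
      c.2 * ((if T.Nb v w then d.lam v w else 0) * ((d.p w).2 - (d.p v).2)) := by
    intro w; simp only [f, dot2]; ring
  simp only [this, Finset.sum_add_distrib, ← Finset.mul_sum, h1, h2, mul_zero, add_zero]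

lemma f_neg (c v) : d.f (-c) v = - d.f c v := dot2_neg_left _ _

lemma nb_const (c : ℝ × ℝ) {v : V} (hv : ¬ T.OV v) (h : ∀ w, T.Nb v w → d.f c w ≤ d.f c v)
    {w : V} (hw : T.Nb v w) : d.f c w = d.f c v := by
  classical
  have h0 := d.equil c hv
  have := (Finset.sum_eq_zero_iff_of_nonpos (fun w _ => by
    split_ifs with h1
    · exact mul_nonpos_of_nonneg_of_nonpos (d.lam_pos _ _).le (sub_nonpos.2 (h w h1))
    · simp)).1 h0 w (Finset.mem_univ _)
  simp only [hw, if_true] at this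
  rcases mul_eq_zero.1 this with h | h
  · exact absurd h (d.lam_pos _ _).ne'
  · linarith

lemma det3_zero {c a b e : ℝ × ℝ} (hc : c ≠ 0) (h1 : dot2 c b = dot2 c a) (h2 : dot2 c e = dot2 c a) :
    det3 a b e = 0 := by
  have e1 : c.1 * det3 a b e = 0 := by
    simp only [dot2, det3] at *
    linear_combination (e.2 - a.2) * h1 - (b.2 - a.2) * h2
  have e2 : c.2 * det3 a b e = 0 := by
    simp only [dot2, det3] at *
    linear_combination (b.1 - a.1) * h2 - (e.1 - a.1) * h1
  by_contra hne
  exact hc (Prod.ext ((mul_eq_zero.1 e1).resolve_right hne) ((mul_eq_zero.1 e2).resolve_right hne))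

lemma exists_nb_ne {c : ℝ × ℝ} (hc : c ≠ 0) {v : V} (hv : ¬ T.OV v) :
    ∃ w, T.Nb v w ∧ d.f c w ≠ d.f c v := by
  obtain ⟨a, b, e, ⟨a1, v1, rfl, a2⟩, ⟨b1, v2, h2, b2⟩, -, hab, -, -⟩ :=
    nc_three_exists (d.tc (fun w => w = v) ⟨v, rfl⟩ (by rintro _ rfl; exact hv))
  subst h2
  by_contra hne
  push Not at hne
  exact d.gp _ a b (Ne.symm a1) (Ne.symm b1) hab (det3_zero hc (hne a a2) (hne b b2))

lemma exists_up {c : ℝ × ℝ} (hc : c ≠ 0) {v : V} (hv : ¬ T.OV v) :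
    ∃ x, T.act x ∧ T.src x = v ∧ d.f c v < d.f c (T.tgt x) := by
  by_contra hne
  push Not at hne
  have h : ∀ w, T.Nb v w → d.f c w ≤ d.f c v := by
    rintro w ⟨x, h1, h2, rfl⟩; exact hne x h1 h2
  obtain ⟨w, hw, hw'⟩ := d.exists_nb_ne hc hv
  exact hw' (d.nb_const c hv h hw)

lemma exists_down {c : ℝ × ℝ} (hc : c ≠ 0) {v : V} (hv : ¬ T.OV v) :
    ∃ x, T.act x ∧ T.src x = v ∧ d.f c (T.tgt x) < d.f c v := by
  obtain ⟨x, h1, h2, h3⟩ := d.exists_up (c := -c) (by simpa using hc) hv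
  exact ⟨x, h1, h2, by simp only [f_neg] at h3; linarith⟩

lemma min_principle (c : ℝ × ℝ) (t : ℝ) (h : ∀ x, T.isOut x → t ≤ d.f c (T.src x)) (v : V) :
    t ≤ d.f c v := by
  classical
  have : Nonempty V := ⟨v⟩
  obtain ⟨v0, -, h0⟩ := Finset.exists_min_image (Finset.univ : Finset V) (d.f c) Finset.univ_nonempty
  by_contra hlt
  push Not at hlt
  have h1 := h0 v (Finset.mem_univ _)
  obtain ⟨a, _, _, ⟨ha, u, hu, hn⟩, -⟩ := nc_three_exists (d.tc (fun w => d.f c w = d.f c v0) ⟨v0, rfl⟩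
    (by rintro w hw ⟨x, hx, rfl⟩; have := h x hx; linarith))
  have hu' : ¬ T.OV u := by rintro ⟨x, hx, rfl⟩; have := h x hx; linarith
  have := d.nb_const (-c) hu' (fun w _ => by
    simp only [f_neg]; have := h0 w (Finset.mem_univ _); linarith) hn
  simp only [f_neg] at this
  exact ha (by linarith)

lemma p_inj : Function.Injective d.p := by
  intro u v h
  by_contra hne
  obtain ⟨x, hx⟩ := T.exists_out
  obtain ⟨a1, a2, a3, a4, a5⟩ := Tri.out_prev3 d.hc d.h3 hx
  have : ∃ w, u ≠ w ∧ v ≠ w := by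
    by_contra hn
    push Not at hn
    by_cases h1 : u = T.src x
    · have := hn (T.tgt x) (by rw [h1]; exact a1)
      have := hn (T.tgt (T.σ.symm (T.α x))) (by rw [h1]; exact a2.symm)
      exact a3 (by rw [← this]; assumption)
    · have h2 := hn _ h1
      by_cases h3 : u = T.tgt x
      · have := hn (T.tgt (T.σ.symm (T.α x))) (by rw [h3]; exact a3.symm)
        exact a2 (by rw [← this, h2])
      · exact a1 (by rw [← h2, hn _ h3])
  obtain ⟨w, h1, h2⟩ := this
  refine d.gp u v w hne h1 h2 ?_
  simp [det3, h]

/-- generic covectors -/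
def gn (c : ℝ × ℝ) : Prop := c ≠ 0 ∧ Function.Injective (d.f c)

lemma gn_neg {c} (h : d.gn c) : d.gn (-c) :=
  ⟨by simpa using h.1, fun a b hab => h.2 (by simp only [f_neg] at hab; linarith)⟩

lemma gen {ι κ : Type} [Finite ι] [Finite κ] (c g : ℝ × ℝ) (z : ι → ℝ × ℝ)
    (hz : ∀ i, 0 < dot2 c (z i) ∨ (dot2 c (z i) = 0 ∧ 0 < dot2 g (z i)))
    (w : κ → ℝ × ℝ) (hw : ∀ j, w j ≠ 0) :
    ∃ c', d.gn c' ∧ (∀ i, 0 < dot2 c' (z i)) ∧ ∀ j, dot2 c' (w j) ≠ 0 := by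
  obtain ⟨c', h1, h2⟩ := gen_lex c g z hz
    (fun j : Option (κ ⊕ {e : V × V // e.1 ≠ e.2}) => match j with
      | none => ((1 : ℝ), (0 : ℝ))
      | some (.inl k) => w k
      | some (.inr e) => d.p e.1.1 - d.p e.1.2) (by
    rintro (_ | k | e)
    · simp
    · exact hw k
    · exact sub_ne_zero.2 (fun h => e.2 (d.p_inj h)))
  refine ⟨c', ⟨?_, ?_⟩, h1, fun j => h2 (some (.inl j))⟩
  · rintro rfl
    exact h2 none (by simp [dot2])
  · intro a b hab
    by_contra hne
    refine h2 (some (.inr ⟨(a, b), hne⟩)) ?_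
    simp only [dot2_sub_right]
    simp only [f] at hab; linarith

end Dr

set_option linter.unusedSectionVars false

lemma nc_fiber {α β : Type} [Fintype α] [Fintype β] (p : α → Prop) (g : α → β) :
    nc p = ∑ b, nc (fun x => p x ∧ g x = b) := by
  classical
  simp only [nc, Nat.card_eq_fintype_card, Fintype.card_subtype]
  rw [Finset.card_eq_sum_card_fiberwise (f := g) (t := Finset.univ) (by simp)]
  simp only [Finset.filter_filter]

lemma nc_congr {α : Type} {p q : α → Prop} (h : ∀ x, p x ↔ q x) : nc p = nc q := by
  rw [show p = q from funext fun x => propext (h x)]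

namespace Tri
variable {V : Type} [Fintype V] [DecidableEq V] {G : SimpleGraph V} [DecidableRel G.Adj]
  {E : PlaneEmb G} {big : G.Dart → Prop} (T : Tri E big)

lemma total (hc : IsCPTLabelling E big) :
    nc (fun _ : T.D => True) + 2 * nc T.isOut + 6 = 6 * Fintype.card V := by
  classical
  have := T.fin
  have : Finite E.Face := Quotient.finite _
  have := Fintype.ofFinite E.Face
  have hD := nc_fiber (fun _ : T.D => True) T.fc
  have hG := nc_fiber (fun _ : G.Dart => True) E.angleFace
  rw [← Finset.add_sum_erase _ _ (Finset.mem_univ E.outer)] at hD hG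
  have e1 : ∑ P ∈ Finset.univ.erase E.outer, nc (fun x => True ∧ T.fc x = P) =
      ∑ P ∈ Finset.univ.erase E.outer, (3 + 3 * nc (fun d => E.angleFace d = P ∧ big d)) := by
    refine Finset.sum_congr rfl fun P hP => ?_
    rw [nc_congr (fun x => by rw [true_and])]
    exact T.cnt P (Finset.ne_of_mem_erase hP)
  have e2 : ∑ P ∈ Finset.univ.erase E.outer, nc (fun d => True ∧ E.angleFace d = P) =
      ∑ P ∈ Finset.univ.erase E.outer, (3 + nc (fun d => E.angleFace d = P ∧ big d)) := by
    refine Finset.sum_congr rfl fun P hP => ?_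
    rw [nc_congr (fun x => by rw [true_and]), nc_split _ big, add_comm]
    congr 1
    exact hc.bounded_small P (Finset.ne_of_mem_erase hP)
  rw [e1, Finset.sum_add_distrib, ← Finset.mul_sum] at hD
  rw [e2, Finset.sum_add_distrib] at hG
  have e3 : nc (fun x => True ∧ T.fc x = E.outer) = nc T.isOut := nc_congr (fun x => by simp [TMap.isOut])
  have e4 : nc (fun d => True ∧ E.angleFace d = E.outer) = nc T.isOut := by
    apply le_antisymm
    · refine nc_inj T.ι (fun x hx => ?_) (fun x y _ _ h => T.ι_inj h)
      simpa [TMap.isOut, TMap.fc, T.ang_ι] using hx.2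
    · refine nc_inj T.ang (fun x hx => ⟨trivial, hx⟩) (fun x y hx hy h => ?_)
      rw [T.out_range hx, T.out_range hy, h]
  rw [e3] at hD
  rw [e4] at hG
  simp only [Finset.sum_const, Finset.card_erase_of_mem (Finset.mem_univ _), Finset.card_univ,
    smul_eq_mul] at hD hG
  have hF : 0 < Fintype.card E.Face := Fintype.card_pos_iff.2 ⟨E.outer⟩
  have hE := E.euler
  have e5 : nc (fun _ : G.Dart => True) = 2 * Nat.card G.edgeSet := by
    have h := G.dart_card_eq_twice_card_edges
    rw [nc, Nat.card_eq_fintype_card, Fintype.card_subtype, Nat.card_eq_fintype_card,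
      ← SimpleGraph.edgeFinset_card, ← h]
    simp
  rw [e5] at hG
  rw [Nat.card_eq_fintype_card, Nat.card_eq_fintype_card (α := Quotient _)] at hE
  have : Fintype.card E.Face = Fintype.card (Quotient (faceSetoid (E.rot * dartSymmPerm G))) := rfl
  omega
end Tri

set_option linter.unusedSectionVars false

lemma nc_le_one {α : Type} [Finite α] {p : α → Prop} (h : ∀ x y, p x → p y → x = y) : nc p ≤ 1 :=
  Finite.card_le_one_iff_subsingleton.2 ⟨fun a b => Subtype.ext (h _ _ a.2 b.2)⟩

open scoped Classical in
lemma nc_sum {α : Type} [Fintype α] (p : α → Prop) : nc p = ∑ x, if p x then 1 else 0 := by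
  rw [nc, Nat.card_eq_fintype_card, Fintype.card_subtype, Finset.card_filter]

namespace Dr
variable {V : Type} [Fintype V] [DecidableEq V] {G : SimpleGraph V} [DecidableRel G.Adj]
  {E : PlaneEmb G} {big : G.Dart → Prop} {T : Tri E big} (d : Dr T)

/-- upward dart -/
def up (c : ℝ × ℝ) (x : T.D) : Prop := d.f c (T.src x) < d.f c (T.tgt x)
/-- descent corner -/
def ud (c : ℝ × ℝ) (x : T.D) : Prop := d.up c x ∧ ¬ d.up c (T.σ x)
/-- extremal outer corner -/
def Ext (c : ℝ × ℝ) (x : T.D) : Prop := T.isOut x ∧ (d.up c x ↔ d.up c (T.σ x))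
/-- mixed bounded corner -/
def mx (c : ℝ × ℝ) (x : T.D) : Prop := ¬ T.isOut x ∧ ¬ (d.up c x ↔ d.up c (T.σ x))

/-- previous outer corner -/
def prev (T : Tri E big) (x : T.D) : T.D := T.σ.symm (T.α x)

lemma ψ_prev (x : T.D) : T.ψ (prev T x) = x := by simp [prev, T.αα]
lemma prev_ψ (x : T.D) : prev T (T.ψ x) = x := T.ψ_inj (by rw [ψ_prev])
lemma src_prev (x : T.D) : T.src (prev T x) = T.tgt x := by simp [prev]
lemma isOut_prev {x : T.D} (h : T.isOut x) : T.isOut (prev T x) := by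
  rw [← T.isOut_ψ, ψ_prev]; exact h

include d in
lemma out_ne {x : T.D} (hx : T.isOut x) : T.src x ≠ T.tgt x := (Tri.out_prev3 d.hc d.h3 hx).1
include d in
lemma out_ne_σ {x : T.D} (hx : T.isOut x) : T.src x ≠ T.tgt (T.σ x) := by
  have := d.out_ne (x := T.ψ x) (by simpa using hx)
  rw [T.src_ψ, T.tgt_ψ] at this; exact this.symm
include d in
lemma out_tgt_ne {x : T.D} (hx : T.isOut x) : T.tgt x ≠ T.tgt (T.σ x) := by
  have := (Tri.out_prev3 d.hc d.h3 (x := T.ψ x) (by simpa using hx)).2.2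
  intro h
  have := (Tri.out_prev3 d.hc d.h3 (x := T.ψ x) (by simpa using hx)).2.1
  have e : T.σ.symm (T.α (T.ψ x)) = x := prev_ψ x
  rw [e, T.src_ψ] at this
  exact this h

lemma f_out {c : ℝ × ℝ} {x : T.D} (hx : T.isOut x) :
    d.f c (T.src x) = c.1 * (d.j x : ℝ) + c.2 * (d.j x : ℝ) ^ 2 := by
  simp only [f, dot2, d.p_out x hx]

lemma local_min {c : ℝ × ℝ} {x : T.D} (hx : T.isOut x) (h1 : d.up c x) (h2 : d.up c (T.σ x))
    {z : T.D} (hz : T.isOut z) (hne : z ≠ x) : d.f c (T.src x) < d.f c (T.src z) := by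
  have hp := isOut_prev hx
  have hn : T.isOut (T.ψ x) := by simpa using hx
  simp only [up, T.src_σ] at h1 h2
  rw [← src_prev, d.f_out hx, d.f_out hp] at h1
  rw [← T.src_ψ, d.f_out hx, d.f_out hn] at h2
  rw [d.f_out hx, d.f_out hz]
  have hk : d.j z ≠ d.j x := fun h => hne (d.j_inj _ _ hz hx h)
  have l1 := d.j_lt x hx
  have l2 := d.j_lt z hz
  have jn := d.j_ψ x hx
  have jp := d.j_ψ _ hp
  rw [ψ_prev] at jp
  have lp := d.j_lt _ hp
  have hB := d.hB
  generalize d.j x = a at *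
  generalize d.j z = k at *
  generalize d.j (T.ψ x) = n at *
  generalize d.j (prev T x) = m at *
  generalize d.B = B at *
  have key : ∀ {u v : ℝ}, 0 < u → 0 < v → 0 < u * v := fun h h' => mul_pos h h'
  obtain ⟨c1, c2⟩ := c
  simp only at *
  rcases lt_or_gt_of_ne hk with hlt | hgt
  · -- k < a
    have hm : m + 1 = a := by split_ifs at jp <;> omega
    subst hm
    have e1 : c1 + c2 * (2 * m + 1) < 0 := by push_cast at h1; nlinarith
    have hka : (k : ℝ) ≤ m := by exact_mod_cast (by omega : k ≤ m)
    have e2 : c1 + c2 * (k + m + 1) < 0 := by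
      split_ifs at jn with hb
      · subst jn
        have e3 : c1 + c2 * (m + 1) < 0 := by
          push_cast at h2
          have : (c1 + c2 * (m + 1)) * ((m:ℝ) + 1) < 0 := by nlinarith
          by_contra h
          push Not at h
          have : 0 ≤ (c1 + c2 * (m + 1)) * ((m:ℝ) + 1) := mul_nonneg h (by positivity)
          linarith
        have hk0 : (0:ℝ) ≤ k := by positivity
        by_cases hc2 : 0 ≤ c2
        · nlinarith
        · push Not at hc2; nlinarith
      · subst jn
        push_cast at h2
        have : 0 < c2 := by nlinarith
        nlinarith
    push_cast
    have : 0 < (m + 1 - k) * (-(c1 + c2 * (k + m + 1))) := key (by linarith) (by linarith)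
    nlinarith
  · have hn' : n = a + 1 := by split_ifs at jn <;> omega
    subst hn'
    have e1 : 0 < c1 + c2 * (2 * a + 1) := by push_cast at h2; nlinarith
    have hka : (a : ℝ) + 1 ≤ k := by exact_mod_cast (by omega : a + 1 ≤ k)
    have e2 : 0 < c1 + c2 * (k + a) := by
      split_ifs at jp with hb
      · subst jp
        have hm0 : (0:ℝ) < m := by exact_mod_cast (by omega : 0 < m)
        have e3 : 0 < c1 + c2 * m := by
          push_cast at h1
          have : 0 < (c1 + c2 * m) * m := by nlinarith
          exact pos_of_mul_pos_left this hm0.le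
        have hk0 : (k:ℝ) ≤ m := by exact_mod_cast (by omega : k ≤ m)
        push_cast at *
        by_cases hc2 : 0 ≤ c2
        · nlinarith
        · push Not at hc2; nlinarith
      · subst jp
        push_cast at *
        have : 0 < c2 := by nlinarith
        nlinarith
    have : 0 < (k - a) * (c1 + c2 * (k + a)) := key (by linarith) e2
    nlinarith

lemma up_neg {c} (hg : d.gn c) {x : T.D} (h : T.src x ≠ T.tgt x) : d.up (-c) x ↔ ¬ d.up c x := by
  have : d.f c (T.src x) ≠ d.f c (T.tgt x) := fun h' => h (hg.2 h')
  simp only [up, f_neg, neg_lt_neg_iff, not_lt]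
  exact ⟨le_of_lt, fun h => lt_of_le_of_ne h this.symm⟩

lemma ext_card {c} (hg : d.gn c) : nc (d.Ext c) ≤ 2 := by
  have := T.fin
  have h1 : ∀ c, nc (fun x => T.isOut x ∧ d.up c x ∧ d.up c (T.σ x)) ≤ 1 := by
    intro c
    refine nc_le_one ?_
    rintro x y ⟨x1, x2, x3⟩ ⟨y1, y2, y3⟩
    by_contra hne
    exact lt_asymm (d.local_min x1 x2 x3 y1 (Ne.symm hne)) (d.local_min y1 y2 y3 x1 hne)
  refine (nc_le_add (p := fun x => T.isOut x ∧ d.up c x ∧ d.up c (T.σ x))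
    (q := fun x => T.isOut x ∧ d.up (-c) x ∧ d.up (-c) (T.σ x)) ?_).trans
    (Nat.add_le_add (h1 c) (h1 (-c)))
  rintro x ⟨ho, hx⟩
  rw [d.up_neg hg (d.out_ne ho), d.up_neg hg (by rw [T.src_σ]; exact d.out_ne_σ ho)]
  tauto

lemma exists_ud {c} {x y : T.D} (h : T.src x = T.src y) (hx : d.up c x) (hy : ¬ d.up c y) :
    ∃ z, d.ud c z ∧ T.src z = T.src x := by
  by_contra hne
  push Not at hne
  refine hy (T.orbit_ind h hx fun z hz hu => ?_)
  by_contra hn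
  exact hne z ⟨hu, hn⟩ hz

lemma ud_or_ext {c} (hg : d.gn c) (v : V) :
    (∃ x, d.Ext c x ∧ T.src x = v) ∨ ∃ z, d.ud c z ∧ T.src z = v := by
  by_cases hv : T.OV v
  · obtain ⟨x, hx, rfl⟩ := hv
    by_cases he : d.Ext c x
    · exact Or.inl ⟨x, he, rfl⟩
    · right
      by_cases hu : d.up c x
      · exact d.exists_ud (y := T.σ x) (by simp) hu (fun h => he ⟨hx, by tauto⟩)
      · have := d.exists_ud (x := T.σ x) (y := x) (c := c) (by simp)
          (by by_contra h; exact he ⟨hx, by tauto⟩) hu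
        simpa using this
  · right
    obtain ⟨x, -, rfl, hx⟩ := d.exists_up hg.1 hv
    obtain ⟨y, -, hyx, hy⟩ := d.exists_down hg.1 hv
    exact d.exists_ud hyx.symm hx (by simp only [up, hyx]; exact not_lt.2 hy.le)

lemma ud_count {c} (hg : d.gn c) : Fintype.card V ≤ nc (d.ud c) + nc (d.Ext c) := by
  have := T.fin
  have e : Fintype.card V = nc (fun _ : V => True) := by
    rw [nc, Nat.card_eq_fintype_card, Fintype.card_subtype]; simp
  rw [e]
  refine (nc_le_add (p := fun v => ∃ z, d.ud c z ∧ T.src z = v)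
    (q := fun v => ∃ x, d.Ext c x ∧ T.src x = v) (fun v _ => (d.ud_or_ext hg v).symm)).trans ?_
  exact Nat.add_le_add (nc_surj T.src fun v h => h) (nc_surj T.src fun v h => h)

lemma mx_count (c) : nc (d.mx c) + nc T.isOut = 2 * nc (d.ud c) + nc (d.Ext c) := by
  have := T.fin
  have h0 := nc_split (fun x => ¬ (d.up c x ↔ d.up c (T.σ x))) T.isOut
  have h1 := nc_split T.isOut (fun x => d.up c x ↔ d.up c (T.σ x))
  have h2 := nc_split (fun x => ¬ (d.up c x ↔ d.up c (T.σ x))) (d.up c)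
  have h3 := nc_split (d.up c) (fun x => d.up c (T.σ x))
  have h4 := nc_split (fun x => d.up c (T.σ x)) (d.up c)
  have h5 : nc (fun x => d.up c (T.σ x)) = nc (d.up c) := by
    apply le_antisymm
    · exact nc_inj T.σ (fun x hx => hx) (fun x y _ _ h => T.σ.injective h)
    · exact nc_inj T.σ.symm (fun x hx => by simpa using hx) (fun x y _ _ h => T.σ.symm.injective h)
  have a1 : nc (fun x => ¬ (d.up c x ↔ d.up c (T.σ x)) ∧ ¬ T.isOut x) = nc (d.mx c) :=
    nc_congr fun x => and_comm
  have a2 : nc (fun x => ¬ (d.up c x ↔ d.up c (T.σ x)) ∧ T.isOut x) =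
    nc (fun x => T.isOut x ∧ ¬ (d.up c x ↔ d.up c (T.σ x))) := nc_congr fun x => and_comm
  have a3 : nc (fun x => ¬ (d.up c x ↔ d.up c (T.σ x)) ∧ d.up c x) = nc (d.ud c) :=
    nc_congr fun x => by simp only [ud]; tauto
  have a4 : nc (fun x => ¬ (d.up c x ↔ d.up c (T.σ x)) ∧ ¬ d.up c x) =
    nc (fun x => d.up c (T.σ x) ∧ ¬ d.up c x) := nc_congr fun x => by tauto
  have a5 : nc (fun x => d.up c x ∧ ¬ d.up c (T.σ x)) = nc (d.ud c) := rfl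
  have a6 : nc (fun x => d.up c (T.σ x) ∧ d.up c x) = nc (fun x => d.up c x ∧ d.up c (T.σ x)) :=
    nc_congr fun x => and_comm
  have a7 : nc (fun x => T.isOut x ∧ (d.up c x ↔ d.up c (T.σ x))) = nc (d.Ext c) := rfl
  omega

open scoped Classical in
/-- number of mixed labels at a corner -/
noncomputable def g (c : ℝ × ℝ) (x : T.D) : ℕ := (if d.mx c x then 1 else 0) + if d.mx (-c) x then 1 else 0

lemma g_tri {c} (hg : d.gn c) {x : T.D} (hx : ¬ T.isOut x) :
    d.g c x + d.g c (T.ψ x) + d.g c (T.ψ (T.ψ x)) ≤ 2 := by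
  classical
  have t1 : T.tgt (T.σ x) = T.src (T.ψ x) := rfl
  have t2 : T.tgt x = T.src (T.ψ (T.ψ x)) := (T.src_ψψ hx).symm
  have t3 : T.tgt (T.ψ x) = T.src x := T.tgt_ψ x
  have t4 : T.tgt (T.σ (T.ψ x)) = T.src (T.ψ (T.ψ x)) := rfl
  have t5 : T.tgt (T.ψ (T.ψ x)) = T.src (T.ψ x) := T.tgt_ψ _
  have t6 : T.tgt (T.σ (T.ψ (T.ψ x))) = T.src x := by
    rw [← T.src_ψ, T.ψ3 hx]
  have h1 : ¬ T.isOut (T.ψ x) := by simpa using hx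
  have h2 : ¬ T.isOut (T.ψ (T.ψ x)) := by simpa using hx
  simp only [g, mx, up, hx, h1, h2, T.src_σ, t1, t2, t3, t4, t5, t6, f_neg, not_false_eq_true,
    true_and, neg_lt_neg_iff]
  generalize d.f c (T.src x) = a
  generalize d.f c (T.src (T.ψ x)) = b
  generalize d.f c (T.src (T.ψ (T.ψ x))) = e
  rcases lt_trichotomy a b with h | h | h <;> rcases lt_trichotomy a e with h' | h' | h' <;>
    rcases lt_trichotomy b e with h'' | h'' | h'' <;>
    first
    | (exfalso; linarith)
    | (simp [h, h', h'', not_lt_of_gt])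

lemma g_sum {c} : ∑ x, d.g c x = nc (d.mx c) + nc (d.mx (-c)) := by
  classical
  simp only [g, Finset.sum_add_distrib, nc_sum]

lemma g_out {c} {x : T.D} (hx : T.isOut x) : d.g c x = 0 := by
  simp [g, mx, hx]

open scoped Classical in
lemma index {c} (hg : d.gn c) : nc (d.ud c) + nc (d.Ext c) = Fintype.card V ∧
    ∀ x, ¬ T.isOut x → d.g c x + d.g c (T.ψ x) + d.g c (T.ψ (T.ψ x)) = 2 := by
  have a1 := d.ud_count hg
  have a2 := d.ud_count (d.gn_neg hg)
  have b1 := d.mx_count c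
  have b2 := d.mx_count (-c)
  have e1 := d.ext_card hg
  have e2 := d.ext_card (d.gn_neg hg)
  have tot := T.total d.hc
  have s0 := d.g_sum (c := c)
  have s1 : ∑ x, d.g c (T.ψ x) = ∑ x, d.g c x := Equiv.sum_comp T.ψP (d.g c)
  have s2 : ∑ x, d.g c (T.ψ (T.ψ x)) = ∑ x, d.g c x :=
    (Equiv.sum_comp T.ψP (fun x => d.g c (T.ψ x))).trans s1
  have hle : ∀ x ∈ (Finset.univ : Finset T.D), d.g c x + d.g c (T.ψ x) + d.g c (T.ψ (T.ψ x)) ≤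
      if T.isOut x then 0 else 2 := by
    intro x _
    split_ifs with h
    · rw [d.g_out h, d.g_out (by simpa using h), d.g_out (by simpa using h)]
    · exact d.g_tri hg h
  have hs := Finset.sum_le_sum hle
  have hr : ∑ x : T.D, (if T.isOut x then 0 else 2) + 2 * nc T.isOut = 2 * nc (fun _ : T.D => True) := by
    rw [nc_sum, nc_sum, Finset.mul_sum, Finset.mul_sum, ← Finset.sum_add_distrib]
    refine Finset.sum_congr rfl fun x _ => ?_
    split_ifs <;> simp_all
  rw [Finset.sum_add_distrib, Finset.sum_add_distrib, s1, s2, s0] at hs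
  refine ⟨by omega, fun x hx => ?_⟩
  have heq : ∑ x, (d.g c x + d.g c (T.ψ x) + d.g c (T.ψ (T.ψ x))) =
      ∑ x : T.D, (if T.isOut x then 0 else 2) := by
    rw [Finset.sum_add_distrib, Finset.sum_add_distrib, s1, s2, s0]
    omega
  have := (Finset.sum_eq_sum_iff_of_le hle).1 heq x (Finset.mem_univ _)
  simpa [hx] using this

lemma ud_aux {c} (hg : d.gn c) {y : T.D} (hy : d.ud c y)
    (h : ∀ v, (∃ x, d.Ext c x ∧ T.src x = v) ∨ ∃ z, (d.ud c z ∧ z ≠ y) ∧ T.src z = v) : False := by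
  have := T.fin
  have e : Fintype.card V = nc (fun _ : V => True) := by
    rw [nc, Nat.card_eq_fintype_card, Fintype.card_subtype]; simp
  have h1 := (d.index hg).1
  have h2 : nc (fun _ : V => True) ≤ nc (fun z => d.ud c z ∧ z ≠ y) + nc (d.Ext c) := by
    refine (nc_le_add (p := fun v => ∃ z, (d.ud c z ∧ z ≠ y) ∧ T.src z = v)
      (q := fun v => ∃ x, d.Ext c x ∧ T.src x = v) (fun v _ => (h v).symm)).trans ?_
    exact Nat.add_le_add (nc_surj T.src fun v h => h) (nc_surj T.src fun v h => h)
  have h3 := nc_split (d.ud c) (fun z => z = y)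
  have h4 : 1 ≤ nc (fun z => d.ud c z ∧ z = y) := nc_pos ⟨y, hy, rfl⟩
  have h5 : nc (fun z => d.ud c z ∧ ¬ z = y) = nc (fun z => d.ud c z ∧ z ≠ y) := rfl
  omega

lemma ud_uniq {c} (hg : d.gn c) {x y : T.D} (hx : d.ud c x) (hy : d.ud c y)
    (h : T.src x = T.src y) : x = y := by
  by_contra hne
  refine d.ud_aux hg hy fun v => ?_
  rcases d.ud_or_ext hg v with h1 | ⟨z, h1, rfl⟩
  · exact Or.inl h1
  · right
    by_cases hz : z = y
    · exact ⟨x, ⟨hx, hne⟩, by rw [h, hz]⟩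
    · exact ⟨z, ⟨h1, hz⟩, rfl⟩

lemma ud_not_ext {c} (hg : d.gn c) {x y : T.D} (hx : d.ud c x) (hy : d.Ext c y)
    (h : T.src x = T.src y) : False := by
  refine d.ud_aux hg hx fun v => ?_
  by_cases hv : v = T.src x
  · exact Or.inl ⟨y, hy, by rw [hv, h]⟩
  rcases d.ud_or_ext hg v with h1 | ⟨z, h1, rfl⟩
  · exact Or.inl h1
  · exact Or.inr ⟨z, ⟨h1, fun hz => hv (by rw [hz])⟩, rfl⟩

/-- at an extremal vertex, everything has the same status -/
lemma ext_all {c} (hg : d.gn c) {x y : T.D} (hx : d.Ext c x) (h : T.src x = T.src y) :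
    d.up c y ↔ d.up c x := by
  constructor
  · intro hy
    by_contra hn
    obtain ⟨z, hz, hzs⟩ := d.exists_ud h.symm hy hn
    exact d.ud_not_ext hg hz hx (by rw [hzs, h])
  · intro hu
    by_contra hn
    obtain ⟨z, hz, hzs⟩ := d.exists_ud h hu hn
    exact d.ud_not_ext hg hz hx hzs
end Dr

set_option linter.unusedSectionVars false

namespace Dr
variable {V : Type} [Fintype V] [DecidableEq V] {G : SimpleGraph V} [DecidableRel G.Adj]
  {E : PlaneEmb G} {big : G.Dart → Prop} {T : Tri E big} (d : Dr T)

/-- the vector of a dart -/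
def vec (x : T.D) : ℝ × ℝ := d.p (T.tgt x) - d.p (T.src x)

lemma up_iff {c} {x : T.D} : d.up c x ↔ 0 < dot2 c (d.vec x) := by
  simp [up, f, vec, dot2_sub_right]

lemma vec_α (x : T.D) : d.vec (T.α x) = - d.vec x := by simp [vec]

lemma genL (c g : ℝ × ℝ) (L : List (ℝ × ℝ))
    (hz : ∀ z ∈ L, 0 < dot2 c z ∨ (dot2 c z = 0 ∧ 0 < dot2 g z)) :
    ∃ c', d.gn c' ∧ ∀ z ∈ L, 0 < dot2 c' z := by
  obtain ⟨c', h1, h2, -⟩ := d.gen c g (ι := {z // z ∈ L.toFinset}) (κ := Empty) (fun z => z.1)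
    (fun z => hz _ (List.mem_toFinset.1 z.2)) (fun e => e.elim) (fun e => e.elim)
  exact ⟨c', h1, fun z hz => h2 ⟨z, by simpa using hz⟩⟩

include d in
lemma c3 {x : T.D} (hx : ¬ T.isOut x) (h1 : T.tgt x = T.src x) (h2 : T.tgt (T.σ x) = T.src x) :
    False := by
  obtain ⟨c, hc, -⟩ := d.genL 0 0 [] (by simp)
  have := (d.index hc).2 x hx
  have e1 : T.src (T.ψ x) = T.src x := by rw [T.src_ψ, h2]
  have e2 : T.src (T.ψ (T.ψ x)) = T.src x := by rw [T.src_ψψ hx, h1]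
  have key : ∀ y : T.D, T.tgt y = T.src y → T.tgt (T.σ y) = T.src y → d.g c y = 0 := by
    intro y ha hb
    simp [g, mx, up, ha, hb]
  rw [key x h1 h2, key _ (by rw [T.tgt_ψ, e1]) (by rw [T.tgt_σψ hx, e1, h1]),
    key _ (by rw [T.tgt_ψ, e1, e2]) (by rw [T.tgt_σψ (by simpa using hx), e2, T.tgt_ψ])] at this
  omega

lemma lemL {c} (hg : d.gn c) {y : T.D} (h1 : d.up c (T.σ.symm y)) (h2 : ¬ d.up c y)
    (h3 : d.up c (T.σ y)) {z : T.D} (hz : T.src z = T.src y) : z = y ∨ d.up c z := by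
  refine T.orbit_ind (p := fun z => z = y ∨ d.up c z) (x := T.σ y) (by simp [hz]) (Or.inr h3) ?_
  rintro z hz (rfl | h)
  · exact Or.inr h3
  · by_cases hu : d.up c (T.σ z)
    · exact Or.inr hu
    · left
      have : z = T.σ.symm y := d.ud_uniq hg ⟨h, hu⟩ ⟨h1, by simpa using h2⟩ (by simpa using hz)
      rw [this]; simp

lemma exists_both {v u u' : V} (h : u ≠ v) (h' : u' ≠ v) :
    ∃ c, 0 < dot2 c (d.p u - d.p v) ∧ 0 < dot2 c (d.p u' - d.p v) := by
  have ne : ∀ u, u ≠ v → d.p u - d.p v ≠ 0 := fun u h => sub_ne_zero.2 fun e => h (d.p_inj e)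
  by_cases e : u = u'
  · subst e
    exact ⟨_, dot2_self_pos (ne u h), dot2_self_pos (ne u h)⟩
  · have hd := d.gp v u u' (Ne.symm h) (Ne.symm h') e
    set D := det3 (d.p v) (d.p u) (d.p u') with hD
    have : 0 < D * D := mul_self_pos.2 hd
    refine ⟨(D * ((d.p u').2 - (d.p u).2), D * ((d.p u).1 - (d.p u').1)), ?_, ?_⟩
    · refine this.trans_eq ?_
      nth_rw 2 [hD]
      simp only [det3, dot2, Prod.fst_sub, Prod.snd_sub]; ring
    · refine this.trans_eq ?_
      nth_rw 2 [hD]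
      simp only [det3, dot2, Prod.fst_sub, Prod.snd_sub]; ring

/-- functional with outer vertex at the bottom -/
lemma bottom {x : T.D} (hx : T.isOut x) : ∃ c, d.gn c ∧ d.Ext c x ∧ d.up c x := by
  have key : ∀ z, T.isOut z → z ≠ x →
      0 < dot2 (-2 * (d.j x : ℝ), (1:ℝ)) (d.p (T.src z) - d.p (T.src x)) := by
    intro z hz hne
    have hj : (d.j z : ℝ) - d.j x ≠ 0 := by
      rw [sub_ne_zero]; exact_mod_cast fun h => hne (d.j_inj _ _ hz hx h)
    rw [d.p_out z hz, d.p_out x hx]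
    have : 0 < ((d.j z : ℝ) - d.j x) ^ 2 := by positivity
    refine this.trans_eq ?_
    simp only [dot2, Prod.fst_sub, Prod.snd_sub]; ring
  obtain ⟨c, hg, h⟩ := d.genL (-2 * (d.j x : ℝ), (1:ℝ)) 0 [d.vec x, d.vec (T.σ x)] (by
    have h1 := key (prev T x) (isOut_prev hx) (by
      intro e; have := d.out_ne hx; rw [← src_prev, e] at this; exact this rfl)
    have h2 := key (T.ψ x) (by simpa using hx) (by
      intro e; have := d.out_ne_σ hx; rw [← T.src_ψ, e] at this; exact this rfl)
    rw [src_prev] at h1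
    rw [T.src_ψ] at h2
    intro z hz
    left
    simp only [List.mem_cons, List.not_mem_nil, or_false] at hz
    rcases hz with rfl | rfl
    · exact h1
    · simp only [vec, T.src_σ]; exact h2)
  have u1 : d.up c x := d.up_iff.2 (h _ (by simp))
  have u2 : d.up c (T.σ x) := d.up_iff.2 (h _ (by simp))
  exact ⟨c, hg, ⟨hx, by simp [u1, u2]⟩, u1⟩

include d in
lemma no_loop (x : T.D) : T.tgt x ≠ T.src x := by
  intro hl
  by_cases ho : T.OV (T.src x)
  · obtain ⟨y, hy, hyx⟩ := ho
    obtain ⟨c, hg, he, hu⟩ := d.bottom hy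
    have := (d.ext_all hg he hyx).2 hu
    simp [up, hl] at this
  · have o1 : ¬ T.isOut x := fun h => ho ⟨x, h, rfl⟩
    have o2 : ¬ T.isOut (T.σ.symm x) := fun h => ho ⟨_, h, by simp⟩
    have n1 : T.tgt (T.σ x) ≠ T.src x := fun h => d.c3 o1 hl h
    have n2 : T.tgt (T.σ.symm x) ≠ T.src x := fun h => d.c3 o2 (by simpa using h) (by simpa using hl)
    obtain ⟨c, h1, h2⟩ := d.exists_both n1 n2
    obtain ⟨c', hg, h⟩ := d.genL c 0 [d.vec (T.σ x), d.vec (T.σ.symm x)] (by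
      intro z hz
      left
      simp only [List.mem_cons, List.not_mem_nil, or_false] at hz
      rcases hz with rfl | rfl
      · simpa [vec] using h1
      · simpa [vec] using h2)
    have nx : ¬ d.up c' x := by simp [up, hl]
    rcases d.lemL hg (d.up_iff.2 (h _ (by simp))) nx (d.up_iff.2 (h _ (by simp))) (z := T.α x)
      (by simpa using hl) with e | e
    · exact T.α_ne x e
    · simp [up, hl] at e

/-- orientation of a corner -/
def det (x : T.D) : ℝ := det3 (d.p (T.src x)) (d.p (T.tgt x)) (d.p (T.tgt (T.σ x)))

lemma det_ψ {x : T.D} (hx : ¬ T.isOut x) : d.det (T.ψ x) = d.det x := by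
  simp only [det, T.src_ψ, T.tgt_ψ, T.tgt_σψ hx, det3]; ring

lemma det_ne {x : T.D} (hx : ¬ T.isOut x) : d.det x ≠ 0 := by
  refine d.gp _ _ _ (d.no_loop x).symm (by simpa using (d.no_loop (T.σ x)).symm) ?_
  have := d.no_loop (T.σ (T.ψ x))
  rw [T.tgt_σψ hx, T.src_σ, T.src_ψ] at this
  exact this

lemma det_eq (x : T.D) : d.det x = dot2 (rot90 (d.vec x)) (d.vec (T.σ x)) := by
  simp only [det, det3, dot2, rot90, vec, T.src_σ, Prod.fst_sub, Prod.snd_sub]; ring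

lemma det_same_aux {y : T.D} (h1 : ¬ T.isOut y) (h2 : ¬ T.isOut (T.σ.symm y)) (s : ℝ)
    (hs : s ≠ 0) (hd1 : 0 < s * d.det y) (hd2 : s * d.det (T.σ.symm y) < 0) : False := by
  set w := d.vec y with hw
  have hw0 : w ≠ 0 := sub_ne_zero.2 fun e => d.no_loop y (d.p_inj e)
  set c0 := s • rot90 w with hc0
  have hc00 : c0 ≠ 0 := by
    intro h
    rw [hc0, smul_eq_zero] at h
    rcases h with h | h
    · exact hs h
    · simp only [rot90, Prod.mk_eq_zero, neg_eq_zero] at h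
      exact hw0 (Prod.ext h.2 h.1)
  have e1 : 0 < dot2 c0 (d.vec (T.σ y)) := by
    rw [hc0, dot2_smul_left, hw, ← d.det_eq]; exact hd1
  have e2 : 0 < dot2 c0 (d.vec (T.σ.symm y)) := by
    rw [d.det_eq, Equiv.apply_symm_apply, ← hw] at hd2
    have : dot2 (rot90 w) (d.vec (T.σ.symm y)) = - dot2 (rot90 (d.vec (T.σ.symm y))) w := by
      simp only [dot2, rot90]; ring
    rw [hc0, dot2_smul_left, this]; linarith
  have e3 : dot2 c0 w = 0 := by rw [hc0, dot2_smul_left]; simp only [dot2, rot90]; ring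
  have e4 : dot2 c0 (-w) = 0 ∧ 0 < dot2 (-w) (-w) :=
    ⟨by rw [dot2_neg_right, e3]; simp, dot2_self_pos (by simpa using hw0)⟩
  have base : ∀ L : List (ℝ × ℝ), (∀ z ∈ L, 0 < dot2 c0 z) → ∃ c, d.gn c ∧
      d.up c (T.σ.symm y) ∧ ¬ d.up c y ∧ d.up c (T.σ y) ∧ ∀ z ∈ L, 0 < dot2 c z := by
    intro L hL
    obtain ⟨c, hg, h⟩ := d.genL c0 (-w) (d.vec (T.σ y) :: d.vec (T.σ.symm y) :: -w :: L) (by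
      intro z hz
      simp only [List.mem_cons] at hz
      rcases hz with rfl | rfl | rfl | hz
      · exact Or.inl e1
      · exact Or.inl e2
      · exact Or.inr e4
      · exact Or.inl (hL z hz))
    refine ⟨c, hg, d.up_iff.2 (h _ (by simp)), ?_, d.up_iff.2 (h _ (by simp)),
      fun z hz => h z (by simp [hz])⟩
    rw [d.up_iff]
    have := h (-w) (by simp)
    rw [dot2_neg_right] at this
    linarith
  by_cases ho : T.OV (T.src y)
  · obtain ⟨x, hx, hxy⟩ := ho
    obtain ⟨c, hg, u1, u2, u3, -⟩ := base [] (by simp)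
    have hud : d.ud c (T.σ.symm y) := ⟨u1, by simpa using u2⟩
    by_cases he : d.Ext c x
    · exact d.ud_not_ext hg hud he (by simp [hxy])
    · have he' : ¬ (d.up c x ↔ d.up c (T.σ x)) := fun h => he ⟨hx, h⟩
      by_cases hux : d.up c x
      · have : ¬ d.up c (T.σ x) := fun h => he' (by simp [h, hux])
        have := d.ud_uniq hg (x := x) ⟨hux, this⟩ hud (by simp [hxy])
        exact h2 (this ▸ hx)
      · have hus : d.up c (T.σ x) := by by_contra h; exact he' (by simp [h, hux])
        have un : ∀ z, d.up (-c) z ↔ ¬ d.up c z := fun z => d.up_neg hg (d.no_loop z).symm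
        have := d.ud_uniq (d.gn_neg hg) (x := x) (y := y) ⟨(un _).2 hux, by rw [un]; simpa using hus⟩
          ⟨(un _).2 u2, by rw [un]; simpa using u3⟩ hxy
        exact h1 (this ▸ hx)
  · have hz : ∀ z, T.src z = T.src y → 0 ≤ dot2 c0 (d.vec z) := by
      intro z hz
      by_contra hneg
      obtain ⟨c, hg, u1, u2, u3, u4⟩ := base [-d.vec z] (by
        intro q hq
        simp only [List.mem_cons, List.not_mem_nil, or_false] at hq
        rw [hq, dot2_neg_right]; linarith)
      have := u4 (-d.vec z) (by simp)
      rw [dot2_neg_right] at this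
      rcases d.lemL hg u1 u2 u3 hz with rfl | h
      · rw [← hw, e3] at hneg; simp at hneg
      · rw [d.up_iff] at h; linarith
    obtain ⟨q, hq, hqn⟩ := d.exists_nb_ne hc00 ho
    refine hqn ?_
    have := d.nb_const (-c0) ho (fun q hq => by
      obtain ⟨z, -, hzs, rfl⟩ := hq
      have := hz z hzs
      rw [vec, dot2_sub_right, hzs] at this
      rw [f_neg, f_neg]; simp only [f]; linarith) hq
    simp only [f_neg] at this; linarith

lemma det_same {y : T.D} (h1 : ¬ T.isOut y) (h2 : ¬ T.isOut (T.σ.symm y)) :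
    0 < d.det (T.σ.symm y) ↔ 0 < d.det y := by
  have n1 := d.det_ne h1
  have n2 := d.det_ne h2
  constructor
  · intro h
    by_contra hn
    have : d.det y < 0 := lt_of_le_of_ne (not_lt.1 hn) n1
    exact d.det_same_aux h1 h2 (-1) (by norm_num) (by linarith) (by linarith)
  · intro h
    by_contra hn
    have : d.det (T.σ.symm y) < 0 := lt_of_le_of_ne (not_lt.1 hn) n2
    exact d.det_same_aux h1 h2 1 (by norm_num) (by linarith) (by linarith)

include d in
lemma σ_out_not {x : T.D} (hx : T.isOut x) : ¬ T.isOut (T.σ x) := by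
  intro h
  have := T.out_uniq d.hc h hx (by simp)
  exact d.out_tgt_ne hx (by rw [this])

include d in
lemma σsymm_out_not {x : T.D} (hx : T.isOut x) : ¬ T.isOut (T.σ.symm x) := fun h => by
  have := d.σ_out_not h
  simp at this; exact this hx

lemma det_vertex (v : V) : ∃ x0, ∀ z, T.src z = v → ¬ T.isOut z →
    (0 < d.det z ↔ 0 < d.det x0) := by
  have key : ∀ x0, ¬ T.isOut x0 → (∀ z, T.isOut z → T.src z = T.src x0 → T.σ z = x0) →
      ∀ z, T.src z = T.src x0 → ¬ T.isOut z → (0 < d.det z ↔ 0 < d.det x0) := by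
    intro x0 h0 hs z hz hzo
    have := T.orbit_ind (p := fun z => T.isOut z ∨ (0 < d.det z ↔ 0 < d.det x0)) hz.symm
      (Or.inr Iff.rfl) (by
      rintro z hz h
      by_cases hzo : T.isOut z
      · right; rw [hs z hzo hz]
      · by_cases hso : T.isOut (T.σ z)
        · exact Or.inl hso
        · right
          rw [← d.det_same hso (by simpa using hzo)]
          simpa [hzo] using h)
    tauto
  by_cases ho : T.OV v
  · obtain ⟨x, hx, rfl⟩ := ho
    refine ⟨T.σ x, fun z hz => key (T.σ x) (d.σ_out_not hx) ?_ z (by simpa using hz)⟩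
    intro z hz hzs
    rw [T.out_uniq d.hc hz hx (by simpa using hzs)]
  · obtain ⟨x, rfl⟩ := T.exists_dart v
    exact ⟨x, fun z hz => key x (fun h => ho ⟨x, h, rfl⟩) (fun z h e => absurd ⟨z, h, e⟩ ho) z hz⟩

lemma det_pos {x : T.D} (hx : ¬ T.isOut x) : 0 < d.det x := by
  suffices H : ∀ v, ∀ x, T.src x = v → ¬ T.isOut x → 0 < d.det x from H _ x rfl hx
  intro v
  have ext : ∀ x, ¬ T.isOut x → 0 < d.det x → ∀ z, T.src z = T.src x → ¬ T.isOut z → 0 < d.det z := by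
    intro x hx hp z hz hzo
    obtain ⟨x0, h⟩ := d.det_vertex (T.src x)
    exact (h z hz hzo).2 ((h x rfl hx).1 hp)
  obtain ⟨b, hb, hb0⟩ := d.j_surj 0 (by have := d.hB; omega)
  refine T.vert_ind (p := fun v => ∀ x, T.src x = v → ¬ T.isOut x → 0 < d.det x) (v := T.src b) ?_ ?_
  · have hs := d.σ_out_not hb
    have : 0 < d.det (T.σ b) := by
      refine lt_of_le_of_ne ?_ (d.det_ne hs).symm
      have hn : T.isOut (T.ψ b) := by simpa using hb
      have j1 : d.j (T.ψ b) = 1 := by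
        rw [d.j_ψ b hb, hb0, if_neg]
        have := d.hB; omega
      have m := d.min_principle (-1, 1) 0 (by
        intro x hx
        rw [d.f_out hx]
        have : (0:ℝ) ≤ (d.j x : ℝ) * ((d.j x : ℝ) - 1) := by
          rcases Nat.eq_zero_or_pos (d.j x) with h | h
          · simp [h]
          · have : (1:ℝ) ≤ d.j x := by exact_mod_cast h
            have : (0:ℝ) ≤ (d.j x : ℝ) - 1 := by linarith
            positivity
        simp only; linarith) (T.tgt (T.σ (T.σ b)))
      rw [det, T.src_σ, ← T.src_ψ, d.p_out _ hb, d.p_out _ hn, j1, hb0]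
      simp only [f, dot2] at m
      simp only [det3]; push_cast; linarith
    intro x hx hxo
    exact ext _ hs this x (by simpa using hx) hxo
  · intro x h
    by_cases hx : T.isOut x
    · have hy := d.σsymm_out_not hx
      have h1 := h (T.σ.symm x) (by simp) hy
      rw [← d.det_ψ hy, T.ψ_σsymm] at h1
      intro z hz hzo
      refine ext (T.α x) ?_ h1 z hz hzo
      rw [← T.ψ_σsymm, T.isOut_ψ]; exact hy
    · have h1 := h x rfl hx
      rw [← d.det_ψ hx, ← d.det_ψ (by simpa using hx)] at h1
      intro z hz hzo
      exact ext _ (by simpa using hx) h1 z (by rw [hz, T.src_ψψ hx]) hzo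

lemma det_out {x : T.D} (hx : T.isOut x) : d.det x < 0 := by
  have hp := isOut_prev hx
  have hn : T.isOut (T.ψ x) := by simpa using hx
  have j1 := d.j_ψ _ hp
  have j2 := d.j_ψ _ hx
  have l1 := d.j_lt _ hp
  rw [ψ_prev] at j1
  have hB := d.hB
  rw [det, ← src_prev, ← T.src_ψ, d.p_out _ hx, d.p_out _ hn, d.p_out _ hp, Tri.det3_parab]
  set a := d.j x
  set b := d.j (prev T x)
  set e := d.j (T.ψ x)
  have hB' : (3:ℝ) ≤ d.B := by exact_mod_cast hB
  split_ifs at j1 with h1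
  · have hb : (b:ℝ) = d.B - 1 := by rw [← h1]; push_cast; ring
    have ha : (a:ℝ) = 0 := by exact_mod_cast j1
    have he : (e:ℝ) = 1 := by
      rw [j1, if_neg (by omega)] at j2
      exact_mod_cast j2
    rw [hb, ha, he]
    have : 0 < ((d.B:ℝ) - 1) * (d.B - 2) := by
      apply mul_pos <;> linarith
    nlinarith
  · have ha : (a:ℝ) = b + 1 := by exact_mod_cast j1
    split_ifs at j2 with h2
    · have hb : (b:ℝ) = d.B - 2 := by
        have : (a:ℝ) + 1 = d.B := by exact_mod_cast h2
        linarith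
      have he : (e:ℝ) = 0 := by exact_mod_cast j2
      rw [ha, hb, he]
      have : 0 < ((d.B:ℝ) - 1) * (d.B - 2) := by
        apply mul_pos <;> linarith
      nlinarith
    · have he : (e:ℝ) = a + 1 := by exact_mod_cast j2
      rw [he, ha]
      norm_num
      linarith

end Dr

set_option linter.unusedSectionVars false

/-- complex number of a vector -/
def cx (u : ℝ × ℝ) : ℂ := ⟨u.1, u.2⟩
/-- polar angle relative to a functional -/
noncomputable def pa (c u : ℝ × ℝ) : ℝ := Complex.arg ((⟨c.2, c.1⟩ : ℂ) * cx u)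

lemma cx_ne {u : ℝ × ℝ} (h : u ≠ 0) : cx u ≠ 0 := fun e => h
  (Prod.ext (congrArg Complex.re e) (congrArg Complex.im e))

lemma ccwAngle_def (u w : ℝ × ℝ) : ccwAngle u w =
    if 0 < Complex.arg (cx w / cx u) then Complex.arg (cx w / cx u)
    else Complex.arg (cx w / cx u) + 2 * Real.pi := rfl

lemma ccw_mem (u w : ℝ × ℝ) : 0 < ccwAngle u w ∧ ccwAngle u w ≤ 2 * Real.pi := by
  have h1 := Complex.neg_pi_lt_arg (cx w / cx u)
  have h2 := Complex.arg_le_pi (cx w / cx u)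
  have := Real.pi_pos
  rw [ccwAngle_def]
  split_ifs with h <;> constructor <;> linarith

lemma ccw_coe (u w : ℝ × ℝ) : (ccwAngle u w : Real.Angle) = Complex.arg (cx w / cx u) := by
  rw [ccwAngle_def]
  split_ifs <;> simp

lemma angle_eq {a b : ℝ} (h : (a : Real.Angle) = b) (ha : 0 < a) (ha' : a ≤ 2 * Real.pi)
    (hb : 0 < b) (hb' : b ≤ 2 * Real.pi) : a = b := by
  rw [Real.Angle.angle_eq_iff_two_pi_dvd_sub] at h
  obtain ⟨k, hk⟩ := h
  have hp := Real.pi_pos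
  have h1 : (-1:ℝ) < k := by
    by_contra hh; push Not at hh; nlinarith
  have h2 : (k:ℝ) < 1 := by
    by_contra hh; push Not at hh; nlinarith
  have : k = 0 := by
    have h1 : (-1:ℤ) < k := by exact_mod_cast h1
    have h2 : k < 1 := by exact_mod_cast h2
    omega
  rw [this] at hk; simp at hk; linarith

lemma cx_im (u w : ℝ × ℝ) : (cx w / cx u).im = dot2 (rot90 u) w / Complex.normSq (cx u) := by
  rw [Complex.div_im]
  simp only [cx, dot2, rot90]; ring

lemma ccw_lt {u w : ℝ × ℝ} (hu : u ≠ 0) (h : 0 < dot2 (rot90 u) w) : ccwAngle u w < Real.pi := by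
  have hn : 0 < Complex.normSq (cx u) := Complex.normSq_pos.2 (cx_ne hu)
  have him : 0 < (cx w / cx u).im := by rw [cx_im]; positivity
  have h1 : 0 ≤ Complex.arg (cx w / cx u) := Complex.arg_nonneg_iff.2 him.le
  have h2 : Complex.arg (cx w / cx u) ≠ 0 := fun e => by
    rw [Complex.arg_eq_zero_iff] at e; linarith [e.2]
  rw [ccwAngle_def, if_pos (lt_of_le_of_ne h1 h2.symm)]
  refine lt_of_le_of_ne (Complex.arg_le_pi _) fun e => ?_
  rw [Complex.arg_eq_pi_iff] at e; linarith [e.2]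

lemma ccw_gt {u w : ℝ × ℝ} (hu : u ≠ 0) (h : dot2 (rot90 u) w < 0) : Real.pi < ccwAngle u w := by
  have hn : 0 < Complex.normSq (cx u) := Complex.normSq_pos.2 (cx_ne hu)
  have him : (cx w / cx u).im < 0 := by rw [cx_im]; exact div_neg_of_neg_of_pos h hn
  have h1 : Complex.arg (cx w / cx u) < 0 := Complex.arg_neg_iff.2 him
  rw [ccwAngle_def, if_neg (by linarith)]
  linarith [Complex.neg_pi_lt_arg (cx w / cx u)]

lemma pa_im (c u : ℝ × ℝ) : ((⟨c.2, c.1⟩ : ℂ) * cx u).im = dot2 c u := by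
  simp [cx, dot2]; ring

lemma pa_up {c u : ℝ × ℝ} (h : 0 < dot2 c u) : 0 < pa c u ∧ pa c u < Real.pi := by
  rw [← pa_im] at h
  refine ⟨lt_of_le_of_ne (Complex.arg_nonneg_iff.2 h.le) fun e => ?_,
    lt_of_le_of_ne (Complex.arg_le_pi _) fun e => ?_⟩
  · have e := Complex.arg_eq_zero_iff.1 e.symm; linarith [e.2]
  · have e := Complex.arg_eq_pi_iff.1 e; linarith [e.2]

lemma pa_down {c u : ℝ × ℝ} (h : dot2 c u < 0) : -Real.pi < pa c u ∧ pa c u < 0 := by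
  rw [← pa_im] at h
  exact ⟨Complex.neg_pi_lt_arg _, Complex.arg_neg_iff.2 h⟩

lemma ccw_coe_pa {c u w : ℝ × ℝ} (hc : c ≠ 0) (hu : u ≠ 0) (hw : w ≠ 0) :
    (ccwAngle u w : Real.Angle) = (pa c w - pa c u : ℝ) := by
  have hk : (⟨c.2, c.1⟩ : ℂ) ≠ 0 := fun e => hc
    (Prod.ext (congrArg Complex.im e) (congrArg Complex.re e))
  rw [ccw_coe, Complex.arg_div_coe_angle (cx_ne hw) (cx_ne hu), Real.Angle.coe_sub, pa, pa,
    Complex.arg_mul_coe_angle hk (cx_ne hw), Complex.arg_mul_coe_angle hk (cx_ne hu)]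
  abel

lemma ccw_pa {c u w : ℝ × ℝ} (hc : c ≠ 0) (hu : u ≠ 0) (hw : w ≠ 0) :
    ccwAngle u w = pa c w - pa c u + 2 * Real.pi * (if pa c w ≤ pa c u then 1 else 0) := by
  have h1 := ccw_mem u w
  have a1 := Complex.neg_pi_lt_arg ((⟨c.2, c.1⟩ : ℂ) * cx u)
  have a2 := Complex.arg_le_pi ((⟨c.2, c.1⟩ : ℂ) * cx u)
  have a3 := Complex.neg_pi_lt_arg ((⟨c.2, c.1⟩ : ℂ) * cx w)
  have a4 := Complex.arg_le_pi ((⟨c.2, c.1⟩ : ℂ) * cx w)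
  change -Real.pi < pa c u at a1
  change -Real.pi < pa c w at a3
  change pa c u ≤ _ at a2
  change pa c w ≤ _ at a4
  refine angle_eq ?_ h1.1 h1.2 ?_ ?_
  · rw [ccw_coe_pa hc hu hw]
    split_ifs <;> simp
  · split_ifs with h
    · linarith
    · push Not at h; simpa using h
  · split_ifs with h
    · linarith
    · push Not at h; linarith

namespace Dr
variable {V : Type} [Fintype V] [DecidableEq V] {G : SimpleGraph V} [DecidableRel G.Adj]
  {E : PlaneEmb G} {big : G.Dart → Prop} {T : Tri E big} (d : Dr T)

/-- corner angle -/
noncomputable def ca (x : T.D) : ℝ := ccwAngle (d.vec x) (d.vec (T.σ x))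
/-- jump indicator -/
noncomputable def J (c : ℝ × ℝ) (x : T.D) : ℝ :=
  if pa c (d.vec (T.σ x)) ≤ pa c (d.vec x) then 1 else 0

lemma vec_ne (x : T.D) : d.vec x ≠ 0 := sub_ne_zero.2 fun e => d.no_loop x (d.p_inj e)

lemma ca_pos (x : T.D) : 0 < d.ca x := (ccw_mem _ _).1

lemma ca_pa {c} (hg : d.gn c) (x : T.D) :
    d.ca x = pa c (d.vec (T.σ x)) - pa c (d.vec x) + 2 * Real.pi * d.J c x :=
  ccw_pa hg.1 (d.vec_ne _) (d.vec_ne _)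

lemma ca_lt {x : T.D} (hx : ¬ T.isOut x) : d.ca x < Real.pi :=
  ccw_lt (d.vec_ne _) (by rw [← det_eq]; exact d.det_pos hx)

lemma ca_gt {x : T.D} (hx : T.isOut x) : Real.pi < d.ca x :=
  ccw_gt (d.vec_ne _) (by rw [← det_eq]; exact d.det_out hx)

lemma pa_of_up {c} {x : T.D} (h : d.up c x) : 0 < pa c (d.vec x) ∧ pa c (d.vec x) < Real.pi :=
  pa_up (d.up_iff.1 h)

lemma pa_of_not_up {c} (hg : d.gn c) {x : T.D} (h : ¬ d.up c x) :
    -Real.pi < pa c (d.vec x) ∧ pa c (d.vec x) < 0 := by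
  refine pa_down ?_
  rw [d.up_iff, not_lt] at h
  refine lt_of_le_of_ne h fun e => d.no_loop x (hg.2 ?_)
  simp only [vec, dot2_sub_right] at e
  simp only [f]; linarith

open scoped Classical in
lemma J_eq {c} (hg : d.gn c) {x : T.D} (hx : ¬ T.isOut x) :
    d.J c x = if d.ud c x then 1 else 0 := by
  have h := d.ca_pa hg x
  have hlt := d.ca_lt hx
  have hp := Real.pi_pos
  by_cases h1 : d.up c x <;> by_cases h2 : d.up c (T.σ x)
  · have a := d.pa_of_up h1
    have b := d.pa_of_up h2
    simp only [ud, h1, h2, not_true, and_false, if_false]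
    by_contra hn
    have : d.J c x = 1 := by
      simp only [J] at hn ⊢; split_ifs at hn ⊢ <;> simp_all
    rw [this] at h; linarith
  · have a := d.pa_of_up h1
    have b := d.pa_of_not_up hg h2
    simp only [ud, h1, h2, not_false_eq_true, and_true, if_true]
    rw [J, if_pos (by linarith)]
  · have a := d.pa_of_not_up hg h1
    have b := d.pa_of_up h2
    simp only [ud, h1, false_and, if_false]
    rw [J, if_neg (by linarith)]
  · have a := d.pa_of_not_up hg h1
    have b := d.pa_of_not_up hg h2
    simp only [ud, h1, false_and, if_false]
    by_contra hn
    have : d.J c x = 1 := by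
      simp only [J] at hn ⊢; split_ifs at hn ⊢ <;> simp_all
    rw [this] at h; linarith

lemma J_out {c} {x : T.D} (hg : d.gn c) (hx : T.isOut x) (h1 : d.up c x) (h2 : d.up c (T.σ x)) :
    d.J c x = 1 := by
  have h := d.ca_pa hg x
  have hlt := d.ca_gt hx
  have a := d.pa_of_up h1
  have b := d.pa_of_up h2
  by_contra hn
  have : d.J c x = 0 := by
    simp only [J] at hn ⊢; split_ifs at hn ⊢ <;> simp_all
  rw [this] at h; linarith

open scoped Classical in
lemma sum_vertex_pa {c} (hg : d.gn c) (v : V) :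
    ∑ x with T.src x = v, d.ca x = 2 * Real.pi * ∑ x with T.src x = v, d.J c x := by
  have h1 : ∑ x with T.src x = v, pa c (d.vec (T.σ x)) = ∑ x with T.src x = v, pa c (d.vec x) := by
    rw [Finset.sum_filter, Finset.sum_filter,
      ← Equiv.sum_comp T.σ (fun x => if T.src x = v then pa c (d.vec x) else 0)]
    simp
  rw [Finset.sum_congr rfl (fun x _ => d.ca_pa hg x), Finset.sum_add_distrib,
    Finset.sum_sub_distrib, h1, Finset.mul_sum]
  ring

open scoped Classical in
lemma sum_vertex (v : V) : ∑ x with T.src x = v, d.ca x = 2 * Real.pi := by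
  have fin : ∀ c (y : T.D), d.gn c → T.src y = v → d.J c y = 1 →
      (∀ z, T.src z = v → z ≠ y → d.J c z = 0) → ∑ x with T.src x = v, d.ca x = 2 * Real.pi := by
    intro c y hg hy h1 h0
    rw [d.sum_vertex_pa hg, Finset.sum_eq_single y (fun z hz hn => h0 z (by simpa using hz) hn)
      (fun h => absurd (by simpa using hy) h), h1, mul_one]
  by_cases ho : T.OV v
  · obtain ⟨y, hy, rfl⟩ := ho
    obtain ⟨c, hg, he, hu⟩ := d.bottom hy
    have all : ∀ z, T.src z = T.src y → d.up c z := fun z hz => (d.ext_all hg he hz.symm).2 hu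
    refine fin c y hg rfl (d.J_out hg hy hu (all _ (by simp))) fun z hz hn => ?_
    rw [d.J_eq hg (fun h => hn (T.out_uniq d.hc h hy hz)), if_neg]
    exact fun h => h.2 (all _ (by simpa using hz))
  · obtain ⟨c, hg, -⟩ := d.genL 0 0 [] (by simp)
    have no : ∀ z, T.src z = v → ¬ T.isOut z := fun z h h' => ho ⟨z, h', h⟩
    rcases d.ud_or_ext hg v with ⟨x, hx, hxv⟩ | ⟨y, hy, hyv⟩
    · exact absurd ⟨x, hx.1, hxv⟩ ho
    · refine fin c y hg hyv (by rw [d.J_eq hg (no y hyv), if_pos hy]) fun z hz hn => ?_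
      rw [d.J_eq hg (no z hz), if_neg]
      exact fun h => hn (d.ud_uniq hg h hy (by rw [hz, hyv]))

lemma ca_arg {x : T.D} (hx : ¬ T.isOut x) : d.ca x = Complex.arg (cx (d.vec (T.σ x)) / cx (d.vec x)) := by
  have := d.ca_lt hx
  rw [ca, ccwAngle_def] at this ⊢
  split_ifs at this ⊢ with h
  · rfl
  · linarith [Complex.neg_pi_lt_arg (cx (d.vec (T.σ x)) / cx (d.vec x))]

lemma tri_sum {x : T.D} (hx : ¬ T.isOut x) :
    d.ca x + d.ca (T.ψ x) + d.ca (T.ψ (T.ψ x)) = Real.pi := by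
  have h1 : ¬ T.isOut (T.ψ x) := by simpa using hx
  have h2 : ¬ T.isOut (T.ψ (T.ψ x)) := by simpa using hx
  have hp := Real.pi_pos
  have a0 := d.ca_pos x
  have a1 := d.ca_pos (T.ψ x)
  have a2 := d.ca_pos (T.ψ (T.ψ x))
  have b0 := d.ca_lt hx
  have b1 := d.ca_lt h1
  have b2 := d.ca_lt h2
  have e1 : cx (d.vec (T.ψ x)) = - cx (d.vec (T.σ x)) := by
    rw [TMap.ψ_def, d.vec_α]; simp [cx, Complex.ext_iff]
  have e2 : cx (d.vec (T.σ (T.ψ x))) = cx (d.vec x) - cx (d.vec (T.σ x)) := by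
    simp only [vec, T.tgt_σψ hx, T.src_σ, T.src_ψ, cx, Complex.ext_iff, Complex.sub_re, Complex.sub_im]
    simp
  have e3 : cx (d.vec (T.ψ (T.ψ x))) = - (cx (d.vec x) - cx (d.vec (T.σ x))) := by
    rw [← e2, T.ψ_def (T.ψ x), d.vec_α]; simp [cx, Complex.ext_iff]
  have e4 : cx (d.vec (T.σ (T.ψ (T.ψ x)))) = - cx (d.vec x) := by
    have : T.σ (T.ψ (T.ψ x)) = T.α x := by rw [← T.ψ3_symm hx]; simp
    rw [this, d.vec_α]; simp [cx, Complex.ext_iff]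
  have n1 := cx_ne (d.vec_ne x)
  have n2 := cx_ne (d.vec_ne (T.σ x))
  have n3 := cx_ne (d.vec_ne (T.σ (T.ψ x)))
  rw [e2] at n3
  have key : ((d.ca x + d.ca (T.ψ x) + d.ca (T.ψ (T.ψ x)) : ℝ) : Real.Angle) = (Real.pi : ℝ) := by
    rw [Real.Angle.coe_add, Real.Angle.coe_add, d.ca_arg hx, d.ca_arg h1, d.ca_arg h2, e1, e2, e3, e4]
    have m1 : cx (d.vec (T.σ x)) / cx (d.vec x) ≠ 0 := div_ne_zero n2 n1
    have m2 : (cx (d.vec x) - cx (d.vec (T.σ x))) / -cx (d.vec (T.σ x)) ≠ 0 :=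
      div_ne_zero n3 (neg_ne_zero.2 n2)
    have m3 : -cx (d.vec x) / -(cx (d.vec x) - cx (d.vec (T.σ x))) ≠ 0 :=
      div_ne_zero (neg_ne_zero.2 n1) (neg_ne_zero.2 n3)
    rw [← Complex.arg_mul_coe_angle m1 m2, ← Complex.arg_mul_coe_angle (mul_ne_zero m1 m2) m3]
    have : cx (d.vec (T.σ x)) / cx (d.vec x) * ((cx (d.vec x) - cx (d.vec (T.σ x))) / -cx (d.vec (T.σ x)))
      * (-cx (d.vec x) / -(cx (d.vec x) - cx (d.vec (T.σ x)))) = -1 := by field_simp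
    rw [this, Complex.arg_neg_one]
  rcases le_or_gt (d.ca x + d.ca (T.ψ x) + d.ca (T.ψ (T.ψ x))) (2 * Real.pi) with h | h
  · exact angle_eq key (by linarith) h hp (by linarith)
  · have := angle_eq (a := d.ca x + d.ca (T.ψ x) + d.ca (T.ψ (T.ψ x)) - 2 * Real.pi) (b := Real.pi)
      (by rw [Real.Angle.coe_sub, key]; simp) (by linarith) (by linarith) hp (by linarith)
    linarith

end Dr

set_option linter.unusedSectionVars false

namespace Dr
variable {V : Type} [Fintype V] [DecidableEq V] {G : SimpleGraph V} [DecidableRel G.Adj]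
  {E : PlaneEmb G} {big : G.Dart → Prop} {T : Tri E big} (d : Dr T)

open scoped Classical in
lemma tele (h : T.D → ℝ) (e : G.Dart) :
    ∑ x with T.ang x = e, (h (T.σ x) - h x) = h (T.ι (E.rot e)) - h (T.ι e) := by
  have key : ∀ y : T.D, (if T.ang (T.σ.symm y) = e then h y else 0) + (if y = T.ι e then h y else 0)
      = (if T.ang y = e then h y else 0) + (if y = T.ι (E.rot e) then h y else 0) := by
    intro y
    rcases T.angσ (T.σ.symm y) with h1 | ⟨h1, h2⟩
    · rw [Equiv.apply_symm_apply] at h1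
      set a := T.ang (T.σ.symm y) with ha
      have e1 : T.ang y = E.rot a := by rw [h1, T.ang_ι]
      have e2 : y = T.ι e ↔ E.rot a = e :=
        ⟨fun hh => by rw [← e1, hh, T.ang_ι], fun hh => by rw [h1, hh]⟩
      have e3 : y = T.ι (E.rot e) ↔ a = e :=
        ⟨fun hh => E.rot.injective (by rw [← e1, hh, T.ang_ι]), fun hh => by rw [h1, hh]⟩
      rw [e1]; simp only [e2, e3]; ring
    · rw [Equiv.apply_symm_apply] at h1 h2
      have e2 : y ≠ T.ι e := fun hh => h1 ⟨_, hh.symm⟩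
      have e3 : y ≠ T.ι (E.rot e) := fun hh => h1 ⟨_, hh.symm⟩
      rw [h2]; simp [e2, e3]
  have hs := Finset.sum_congr rfl (fun y (_ : y ∈ (Finset.univ : Finset T.D)) => key y)
  rw [Finset.sum_add_distrib, Finset.sum_add_distrib, Finset.sum_ite_eq' , Finset.sum_ite_eq'] at hs
  simp only [Finset.mem_univ, if_true] at hs
  have hσ : ∑ y, (if T.ang (T.σ.symm y) = e then h y else 0) =
      ∑ x, (if T.ang x = e then h (T.σ x) else 0) := by
    rw [← Equiv.sum_comp T.σ]; simp
  rw [hσ] at hs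
  rw [Finset.sum_sub_distrib, Finset.sum_filter, Finset.sum_filter]
  linarith

/-- total angle in a dart angle -/
noncomputable def S (e : G.Dart) : ℝ := by
  classical exact ∑ x with T.ang x = e, d.ca x

open scoped Classical in
lemma S_def (e : G.Dart) : d.S e = ∑ x with T.ang x = e, d.ca x := rfl

open scoped Classical in
lemma S_pa {c} (hg : d.gn c) (e : G.Dart) : d.S e = pa c (d.vec (T.ι (E.rot e))) -
    pa c (d.vec (T.ι e)) + 2 * Real.pi * ∑ x with T.ang x = e, d.J c x := by
  rw [S_def, Finset.sum_congr rfl (fun x _ => d.ca_pa hg x), Finset.sum_add_distrib,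
    tele (fun x => pa c (d.vec x)), Finset.mul_sum]

lemma S_ge {x : T.D} {e : G.Dart} (h : T.ang x = e) : d.ca x ≤ d.S e := by
  classical
  exact Finset.single_le_sum (f := d.ca) (fun y _ => (d.ca_pos y).le) (by simpa using h)

lemma S_pos (e : G.Dart) : 0 < d.S e :=
  (d.ca_pos (T.ι e)).trans_le (d.S_ge (T.ang_ι e))

lemma S_le (e : G.Dart) : d.S e ≤ 2 * Real.pi := by
  classical
  rw [← d.sum_vertex e.fst, S_def]
  refine Finset.sum_le_sum_of_subset_of_nonneg (fun x hx => ?_) (fun y _ _ => (d.ca_pos y).le)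
  simp only [Finset.mem_filter, Finset.mem_univ, true_and] at hx ⊢
  rw [← hx]; rfl

lemma dartAngle_eq (e : G.Dart) : dartAngle E d.p e = d.S e := by
  classical
  obtain ⟨c, hg, -⟩ := d.genL 0 0 [] (by simp)
  have hv : ∀ e : G.Dart, d.p e.snd - d.p e.fst = d.vec (T.ι e) := fun e => by simp [vec]
  have hm := ccw_mem (d.vec (T.ι e)) (d.vec (T.ι (E.rot e)))
  rw [dartAngle, hv, hv]
  refine angle_eq ?_ hm.1 hm.2 (d.S_pos e) (d.S_le e)
  rw [ccw_coe_pa hg.1 (d.vec_ne _) (d.vec_ne _), d.S_pa hg]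
  have hJ : ∃ n : ℕ, ∑ x with T.ang x = e, d.J c x = n :=
    ⟨∑ x with T.ang x = e, if pa c (d.vec (T.σ x)) ≤ pa c (d.vec x) then 1 else 0, by
      push_cast; rfl⟩
  obtain ⟨n, hn⟩ := hJ
  rw [hn, Real.Angle.angle_eq_iff_two_pi_dvd_sub]
  exact ⟨-n, by push_cast; ring⟩

lemma sum_dart (v : V) : ∑ e ∈ Finset.univ.filter (fun e : G.Dart => e.fst = v), dartAngle E d.p e
    = 2 * Real.pi := by
  classical
  rw [← d.sum_vertex v, Finset.sum_congr rfl (fun e _ => d.dartAngle_eq e)]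
  have := Finset.sum_fiberwise_of_maps_to (s := Finset.univ.filter (fun x : T.D => T.src x = v))
    (t := Finset.univ.filter (fun e : G.Dart => e.fst = v)) (g := T.ang)
    (fun x hx => by
      simp only [Finset.mem_filter, Finset.mem_univ, true_and] at hx ⊢; exact hx) d.ca
  rw [← this]
  refine Finset.sum_congr rfl fun e he => ?_
  rw [S_def, Finset.filter_filter]
  refine Finset.sum_congr ?_ fun _ _ => rfl
  ext x
  simp only [Finset.mem_filter, Finset.mem_univ, true_and] at he ⊢
  refine ⟨fun h => ⟨?_, h⟩, fun h => h.2⟩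
  rw [← he, ← h]; rfl

lemma big_angle {e : G.Dart} (hb : big e) : Real.pi < d.S e := by
  classical
  by_cases ho : E.angleFace e = E.outer
  · refine (d.ca_gt (x := T.ι e) ?_).trans_le (d.S_ge (T.ang_ι e))
    simpa [TMap.isOut, TMap.fc, T.ang_ι] using ho
  · have hv : ¬ T.OV e.fst := by
      rintro ⟨x, hx, hxe⟩
      have := d.hc.one_big _ _ (T.out_Big d.hc hx) hb hxe
      exact ho (this ▸ hx)
    have hr : (E.rot e).snd ≠ e.fst := by
      rw [← E.rot_fst]; exact (E.rot e).adj.ne'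
    obtain ⟨c0, h1, h2⟩ := d.exists_both (v := e.fst) e.adj.ne' hr
    obtain ⟨c, hg, h⟩ := d.genL c0 0 [d.vec (T.ι e), d.vec (T.ι (E.rot e))] (by
      intro z hz
      left
      simp only [List.mem_cons, List.not_mem_nil, or_false] at hz
      rcases hz with rfl | rfl
      · simpa [vec] using h1
      · simpa [vec, E.rot_fst] using h2)
    have u1 : d.up c (T.ι e) := d.up_iff.2 (h _ (by simp))
    have u2 : d.up c (T.ι (E.rot e)) := d.up_iff.2 (h _ (by simp))
    have p1 := d.pa_of_up u1
    have p2 := d.pa_of_up u2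
    have hJ0 : ∀ x, 0 ≤ d.J c x := fun x => by unfold J; split_ifs <;> norm_num
    by_cases hex : ∃ x, T.ang x = e ∧ d.J c x = 1
    · obtain ⟨x, hx, hx1⟩ := hex
      have : d.J c x ≤ ∑ x with T.ang x = e, d.J c x :=
        Finset.single_le_sum (f := d.J c) (fun y _ => hJ0 y) (by simpa using hx)
      rw [hx1] at this
      rw [d.S_pa hg]
      have := Real.pi_pos
      nlinarith
    · exfalso
      have hnj : ∀ x, T.ang x = e → pa c (d.vec x) < pa c (d.vec (T.σ x)) := by
        intro x hx
        by_contra hn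
        exact hex ⟨x, hx, by rw [J, if_pos (not_lt.1 hn)]⟩
      have hmin : ∀ x, T.ang x = e → pa c (d.vec (T.ι e)) ≤ pa c (d.vec x) := by
        obtain ⟨m, hm, hmm⟩ := Finset.exists_min_image (Finset.univ.filter fun x => T.ang x = e)
          (fun x => pa c (d.vec x)) ⟨T.ι e, by simp [T.ang_ι]⟩
        simp only [Finset.mem_filter, Finset.mem_univ, true_and] at hm hmm
        have : m = T.ι e := by
          by_contra hne
          have := T.angσ (T.σ.symm m)
          rw [Equiv.apply_symm_apply] at this
          rcases this with h1 | ⟨-, h2⟩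
          · exact hne (by rw [h1] at hm; rw [T.ang_ι] at hm; rw [h1, hm])
          · have h3 : T.ang (T.σ.symm m) = e := by rw [← h2, hm]
            have h4 := hnj _ h3
            rw [Equiv.apply_symm_apply] at h4
            exact absurd (hmm _ h3) (not_le.2 h4)
        intro x hx
        rw [← this]; exact hmm x hx
      obtain ⟨y, hy, hys, hyd⟩ := d.exists_down hg.1 hv
      have hny : ¬ d.up c y := by
        unfold up; rw [hys]; exact not_lt.2 hyd.le
      have py := d.pa_of_not_up hg hny
      rcases hy with hy | hy | hy
      · exact hy (by rw [hys]; exact ⟨e, hb, rfl⟩)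
      · have := d.hc.one_big _ _ hy hb hys
        linarith [hmin y this, py.2]
      · have := d.hc.one_big _ _ hy hb (by rw [← hys]; exact T.src_σsymm y)
        have h3 := hnj _ this
        rw [Equiv.apply_symm_apply] at h3
        linarith [hmin _ this, py.2]

open scoped Classical in
lemma face_sum {P : E.Face} (hP : P ≠ E.outer) :
    ∑ e : G.Dart, (if E.angleFace e = P then d.S e else 0) =
      Real.pi * (1 + Nat.card {e : G.Dart // E.angleFace e = P ∧ big e}) := by
  classical
  have h1 : ∑ e : G.Dart, (if E.angleFace e = P then d.S e else 0) =
      ∑ x, if T.fc x = P then d.ca x else 0 := by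
    rw [← Finset.sum_fiberwise (s := (Finset.univ : Finset T.D)) T.ang]
    refine Finset.sum_congr rfl fun e _ => ?_
    split_ifs with h
    · refine Finset.sum_congr rfl fun x hx => ?_
      simp only [Finset.mem_filter, Finset.mem_univ, true_and] at hx
      rw [if_pos]; rw [← h, ← hx]; rfl
    · symm
      refine Finset.sum_eq_zero fun x hx => ?_
      simp only [Finset.mem_filter, Finset.mem_univ, true_and] at hx
      rw [if_neg]; intro hh; apply h; rw [← hh, ← hx]; rfl
  set F : T.D → ℝ := fun x => if T.fc x = P then d.ca x else 0 with hF
  have s1 : ∑ x, F (T.ψ x) = ∑ x, F x := Equiv.sum_comp T.ψP F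
  have s2 : ∑ x, F (T.ψ (T.ψ x)) = ∑ x, F x :=
    (Equiv.sum_comp T.ψP (fun x => F (T.ψ x))).trans s1
  have s3 : ∑ x, (F x + F (T.ψ x) + F (T.ψ (T.ψ x))) =
      ((Finset.univ.filter fun x => T.fc x = P).card : ℝ) * Real.pi := by
    rw [← nsmul_eq_mul, ← Finset.sum_const, Finset.sum_filter]
    refine Finset.sum_congr rfl fun x _ => ?_
    simp only [hF, T.fc_ψ]
    split_ifs with h
    · exact d.tri_sum (fun ho => hP (h ▸ ho))
    · simp
  rw [Finset.sum_add_distrib, Finset.sum_add_distrib, s1, s2] at s3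
  have hc : ((Finset.univ.filter fun x => T.fc x = P).card : ℝ) =
      3 + 3 * Nat.card {e : G.Dart // E.angleFace e = P ∧ big e} := by
    have := T.cnt P hP
    rw [Nat.card_eq_fintype_card, Fintype.card_subtype] at this
    exact_mod_cast this
  rw [hc] at s3
  rw [h1]
  linarith

lemma small_angle {e : G.Dart} (hb : ¬ big e) : d.S e < Real.pi := by
  classical
  set P := E.angleFace e with hP
  have hPo : P ≠ E.outer := fun h => hb (d.hc.outer_big e h)
  have h3 := d.hc.bounded_small P hPo
  obtain ⟨e', he', hne⟩ : ∃ e', (E.angleFace e' = P ∧ ¬ big e') ∧ e' ≠ e := by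
    by_contra hcon
    push Not at hcon
    have : Nat.card {d : G.Dart | E.angleFace d = P ∧ ¬ big d} ≤ 1 :=
      Finite.card_le_one_iff_subsingleton.2 ⟨fun a b => Subtype.ext
        ((hcon _ a.2).trans (hcon _ b.2).symm)⟩
    omega
  have hs := d.face_sum hPo
  have hle : ∑ a : G.Dart, ((if a = e then d.S e else 0) + (if a = e' then d.S e' else 0) +
      (if E.angleFace a = P ∧ big a then Real.pi else 0)) ≤
      ∑ e : G.Dart, (if E.angleFace e = P then d.S e else 0) := by
    refine Finset.sum_le_sum fun a _ => ?_
    by_cases h1 : a = e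
    · subst h1; simp [hb, hne.symm, ← hP]
    by_cases h2 : a = e'
    · subst h2; simp [he', hne]
    by_cases h3 : E.angleFace a = P ∧ big a
    · simp [h1, h2, h3]; exact (d.big_angle h3.2).le
    · simp only [h1, h2, h3, if_false, add_zero]
      split_ifs
      · exact (d.S_pos a).le
      · exact le_rfl
  rw [hs, Finset.sum_add_distrib, Finset.sum_add_distrib, Finset.sum_ite_eq', Finset.sum_ite_eq',
    ← Finset.sum_filter, Finset.sum_const, nsmul_eq_mul, Nat.card_eq_fintype_card,
    Fintype.card_subtype] at hle
  simp only [Finset.mem_univ, if_true] at hle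
  have := d.S_pos e'
  linarith

end Dr

set_option linter.unusedSectionVars false

lemma det3_collinear {a b c : ℝ × ℝ} (h : Collinear ℝ ({a, b, c} : Set (ℝ × ℝ))) : det3 a b c = 0 := by
  obtain ⟨v, hv⟩ := (collinear_iff_of_mem (p₀ := a) (by simp)).1 h
  obtain ⟨r, hr⟩ := hv b (by simp)
  obtain ⟨s, hs⟩ := hv c (by simp)
  rw [hr, hs]
  simp only [det3, vadd_eq_add, Prod.fst_add, Prod.snd_add, Prod.smul_fst, Prod.smul_snd, smul_eq_mul]
  ring

lemma det3_segment {a b z : ℝ × ℝ} (h : z ∈ segment ℝ a b) : det3 a b z = 0 := by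
  obtain ⟨s, t, -, -, hst, rfl⟩ := h
  have : s = 1 - t := by linarith
  subst this
  simp only [det3, Prod.fst_add, Prod.snd_add, Prod.smul_fst, Prod.smul_snd, smul_eq_mul]
  ring

/-- height of a crossing -/
noncomputable def crs (t fA HA fB HB : ℝ) : ℝ := HA + (HB - HA) * (t - fA) / (fB - fA)

lemma crs_case1 {t fA HA fB HB fC HC : ℝ} (hA : fA < t) (hB : t < fB) (hC : t < fC)
    (hD : 0 < (fB - fA) * (HC - HA) - (HB - HA) * (fC - fA)) :
    crs t fA HA fB HB < crs t fA HA fC HC := by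
  unfold crs
  have h1 : 0 < fB - fA := by linarith
  have h2 : 0 < fC - fA := by linarith
  have h3 : 0 < t - fA := by linarith
  have : (HB - HA) * (t - fA) / (fB - fA) < (HC - HA) * (t - fA) / (fC - fA) := by
    rw [div_lt_div_iff₀ h1 h2]
    nlinarith [mul_pos h3 hD]
  linarith

lemma crs_alt {t fA HA fB HB : ℝ} (h : fA < fB) :
    crs t fA HA fB HB = HB + (HA - HB) * (fB - t) / (fB - fA) := by
  have : fB - fA ≠ 0 := by linarith
  unfold crs; field_simp; ring

lemma crs_case2 {t fA HA fB HB fC HC : ℝ} (hA : fA < t) (hB : t < fB) (hC : fC < t)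
    (hD : 0 < (fB - fA) * (HC - HA) - (HB - HA) * (fC - fA)) :
    crs t fA HA fB HB < crs t fC HC fB HB := by
  rw [crs_alt (by linarith), crs_alt (by linarith)]
  have h1 : 0 < fB - fA := by linarith
  have h2 : 0 < fB - fC := by linarith
  have h3 : 0 < fB - t := by linarith
  have : (HA - HB) * (fB - t) / (fB - fA) < (HC - HB) * (fB - t) / (fB - fC) := by
    rw [div_lt_div_iff₀ h1 h2]
    nlinarith [mul_pos h3 hD]
  linarith

lemma quad_alt {a b t x1 x2 x3 x4 : ℝ} (s : ℝ) (h12 : x1 < x2) (h23 : x2 < x3) (h34 : x3 < x4)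
    (q1 : 0 < s * (a * x1 + b * x1 ^ 2 - t)) (q2 : s * (a * x2 + b * x2 ^ 2 - t) < 0)
    (q3 : 0 < s * (a * x3 + b * x3 ^ 2 - t)) (q4 : s * (a * x4 + b * x4 ^ 2 - t) < 0) : False := by
  have e1 : s * (a + b * (x1 + x2)) < 0 := by
    by_contra h; push Not at h
    nlinarith [mul_nonneg h (sub_pos.2 h12).le]
  have e2 : 0 < s * (a + b * (x2 + x3)) := by
    by_contra h; push Not at h
    nlinarith [mul_nonneg (neg_nonneg.2 h) (sub_pos.2 h23).le]
  have e3 : s * (a + b * (x3 + x4)) < 0 := by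
    by_contra h; push Not at h
    nlinarith [mul_nonneg h (sub_pos.2 h34).le]
  have p1 : 0 < s * b * (x3 - x1) := by linarith
  have p2 : s * b * (x4 - x2) < 0 := by linarith
  have p3 : 0 < s * b := pos_of_mul_pos_left p1 (by linarith)
  have := mul_pos p3 (show 0 < x4 - x2 by linarith)
  linarith

namespace Dr
variable {V : Type} [Fintype V] [DecidableEq V] {G : SimpleGraph V} [DecidableRel G.Adj]
  {E : PlaneEmb G} {big : G.Dart → Prop} {T : Tri E big} (d : Dr T)

/-- darts crossing a level -/
def X (c : ℝ × ℝ) (t : ℝ) (x : T.D) : Prop := d.f c (T.src x) < t ∧ t < d.f c (T.tgt x)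

/-- crossing coordinate -/
noncomputable def h (c : ℝ × ℝ) (t : ℝ) (x : T.D) : ℝ :=
  crs t (d.f c (T.src x)) (d.f (rot90 c) (T.src x)) (d.f c (T.tgt x)) (d.f (rot90 c) (T.tgt x))

open scoped Classical in
/-- next crossing dart -/
noncomputable def nxt (c : ℝ × ℝ) (t : ℝ) (x : T.D) : T.D :=
  if t < d.f c (T.tgt (T.σ x)) then T.σ x else T.σ (T.ψ x)

lemma det_f {c} (hc : c ≠ 0) {x : T.D} (hx : ¬ T.isOut x) :
    0 < (d.f c (T.tgt x) - d.f c (T.src x)) *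
        (d.f (rot90 c) (T.tgt (T.σ x)) - d.f (rot90 c) (T.src x)) -
      (d.f (rot90 c) (T.tgt x) - d.f (rot90 c) (T.src x)) *
        (d.f c (T.tgt (T.σ x)) - d.f c (T.src x)) := by
  have := mul_pos (dot2_self_pos hc) (d.det_pos hx)
  refine this.trans_eq ?_
  simp only [det, det3, f, dot2, rot90]; ring

lemma nxt_spec {c t} (hc : c ≠ 0) (ht : ∀ v, d.f c v ≠ t) {x : T.D} (hx : d.X c t x)
    (ho : ¬ T.isOut x) : d.X c t (d.nxt c t x) ∧ d.h c t x < d.h c t (d.nxt c t x) := by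
  have hD := d.det_f hc ho
  unfold nxt
  split_ifs with h1
  · refine ⟨⟨by simpa using hx.1, h1⟩, ?_⟩
    simp only [h, T.src_σ]
    exact crs_case1 hx.1 hx.2 h1 hD
  · have h2 : d.f c (T.tgt (T.σ x)) < t := lt_of_le_of_ne (not_lt.1 h1) (ht _)
    refine ⟨⟨by rw [T.src_σ, T.src_ψ]; exact h2, by rw [T.tgt_σψ ho]; exact hx.2⟩, ?_⟩
    simp only [h, T.src_σ, T.src_ψ, T.tgt_σψ ho]
    exact crs_case2 hx.1 hx.2 h2 hD

lemma nxt_inj {c t} {x y : T.D} (hx : d.X c t x) (hy : d.X c t y)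
    (h : d.nxt c t x = d.nxt c t y) : x = y := by
  unfold nxt at h
  split_ifs at h
  · exact T.σ.injective h
  · have := T.σ.injective h
    have h2 := hx.2
    rw [this, T.tgt_ψ] at h2
    linarith [hy.1]
  · have := T.σ.injective h
    have h2 := hy.2
    rw [← this, T.tgt_ψ] at h2
    linarith [hx.1]
  · exact T.ψ_inj (T.σ.injective h)

lemma out_X {c t} {x y : T.D} (hx : d.X c t x) (hy : d.X c t y) (ox : T.isOut x) (oy : T.isOut y) :
    x = y := by
  wlog hlt : d.j x < d.j y generalizing x y
  · rcases lt_or_eq_of_le (not_lt.1 hlt) with h | h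
    · exact (this hy hx oy ox h).symm
    · exact d.j_inj _ _ ox oy h.symm
  exfalso
  obtain ⟨x1, x2⟩ := hx
  obtain ⟨y1, y2⟩ := hy
  have px := isOut_prev ox
  have py := isOut_prev oy
  have jx := d.j_ψ _ px
  have jy := d.j_ψ _ py
  have lx := d.j_lt _ px
  have ly := d.j_lt _ py
  have l := d.j_lt _ oy
  rw [ψ_prev] at jx jy
  rw [← src_prev, d.f_out px] at x2
  rw [← src_prev, d.f_out py] at y2
  rw [d.f_out ox] at x1
  rw [d.f_out oy] at y1
  set a := d.j x
  set b := d.j y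
  set a' := d.j (prev T x)
  set b' := d.j (prev T y)
  have hb : b = b' + 1 := by split_ifs at jy <;> omega
  have hne : a ≠ b' := by
    intro h
    rw [h] at x1
    linarith
  have hab : (a:ℝ) < b' := by exact_mod_cast (by omega : a < b')
  have hbb : (b':ℝ) < b := by exact_mod_cast (by omega : b' < b)
  split_ifs at jx with h1
  · have hne2 : a' ≠ b := by
      intro h
      rw [h] at x2
      linarith
    have : (b:ℝ) < a' := by exact_mod_cast (by omega : b < a')
    exact quad_alt (-1) hab hbb this (a := c.1) (b := c.2) (t := t) (by linarith) (by linarith)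
      (by linarith) (by linarith)
  · have : (a':ℝ) < a := by exact_mod_cast (by omega : a' < a)
    exact quad_alt 1 this hab hbb (a := c.1) (b := c.2) (t := t) (by linarith) (by linarith)
      (by linarith) (by linarith)

lemma h_inj {c t} (hc : c ≠ 0) (ht : ∀ v, d.f c v ≠ t) {x y : T.D} (hx : d.X c t x)
    (hy : d.X c t y) (hh : d.h c t x = d.h c t y) : x = y := by
  classical
  let r : T.D → T.D → Prop := fun b a => d.X c t a ∧ ¬ T.isOut a ∧ b = d.nxt c t a
  have ru : Relator.RightUnique r := by
    rintro b a a' ⟨h1, -, h2⟩ ⟨h3, -, h4⟩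
    exact d.nxt_inj h1 h3 (h2.symm.trans h4)
  have dec : ∀ {a b}, Relation.ReflTransGen r b a → a = b ∨ d.h c t a < d.h c t b := by
    intro a b hab
    induction hab with
    | refl => exact Or.inl rfl
    | tail _ h ih =>
      have := (d.nxt_spec hc ht h.1 h.2.1).2
      rw [← h.2.2] at this
      right
      rcases ih with rfl | ih
      · exact this
      · exact this.trans ih
  have reach : ∀ x, d.X c t x → ∃ e, d.X c t e ∧ T.isOut e ∧ Relation.ReflTransGen r e x := by
    by_contra hcon
    push Not at hcon
    obtain ⟨x0, hx0, hb0⟩ := hcon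
    obtain ⟨m, hm, hmm⟩ := Finset.exists_max_image (Finset.univ.filter fun x => d.X c t x ∧
      ∀ e, d.X c t e → T.isOut e → ¬ Relation.ReflTransGen r e x) (d.h c t)
      ⟨x0, by simp only [Finset.mem_filter, Finset.mem_univ, true_and]; exact ⟨hx0, hb0⟩⟩
    simp only [Finset.mem_filter, Finset.mem_univ, true_and] at hm hmm
    have mo : ¬ T.isOut m := fun h => hm.2 m hm.1 h Relation.ReflTransGen.refl
    have hs := d.nxt_spec hc ht hm.1 mo
    refine absurd (hmm _ ⟨hs.1, fun e he ho hr => hm.2 e he ho (hr.tail ⟨hm.1, mo, rfl⟩)⟩) (not_le.2 hs.2)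
  obtain ⟨e, he, heo, hex⟩ := reach x hx
  obtain ⟨e', he', heo', hey⟩ := reach y hy
  obtain rfl := d.out_X he he' heo heo'
  rcases Relation.ReflTransGen.total_of_right_unique ru hex hey with h | h
  · rcases dec h with h | h
    · exact h.symm
    · linarith
  · rcases dec h with h | h
    · exact h
    · linarith

lemma genPos : GenPos d.p := fun u v w h1 h2 h3 h => d.gp u v w h1 h2 h3 (det3_collinear h)

lemma not_on (x a b : V) (hab : a ≠ b) (h1 : x ≠ a) (h2 : x ≠ b) : d.p x ∉ segment ℝ (d.p a) (d.p b) :=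
  fun h => d.gp a b x hab h1.symm h2.symm (det3_segment h)

lemma h_of_mem {c t} {x : T.D} (hx : d.X c t x) {z : ℝ × ℝ}
    (hz : z ∈ segment ℝ (d.p (T.src x)) (d.p (T.tgt x))) (hzt : dot2 c z = t) :
    d.h c t x = dot2 (rot90 c) z := by
  obtain ⟨s, r, -, -, hsr, rfl⟩ := hz
  have : s = 1 - r := by linarith
  subst this
  obtain ⟨h1, h2⟩ := hx
  have hne : d.f c (T.tgt x) - d.f c (T.src x) ≠ 0 := by linarith
  have : t - d.f c (T.src x) = r * (d.f c (T.tgt x) - d.f c (T.src x)) := by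
    rw [← hzt]
    simp only [f, dot2, Prod.fst_add, Prod.snd_add, Prod.smul_fst, Prod.smul_snd, smul_eq_mul]
    ring
  rw [h, crs, this, ← mul_assoc, mul_div_assoc, div_self hne]
  simp only [f, dot2, rot90, Prod.fst_add, Prod.snd_add, Prod.smul_fst, Prod.smul_snd, smul_eq_mul]
  ring

lemma exists_X {c t} {a b : V} (hab : G.Adj a b) (ha : d.f c a ≠ t) (hb : d.f c b ≠ t) {z : ℝ × ℝ}
    (hz : z ∈ segment ℝ (d.p a) (d.p b)) (hzt : dot2 c z = t) :
    ∃ x : T.D, d.X c t x ∧ z ∈ segment ℝ (d.p (T.src x)) (d.p (T.tgt x)) ∧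
      ({a, b} : Set V) = {T.src x, T.tgt x} := by
  have hz' := hz
  obtain ⟨s, r, hs, hr, hsr, rfl⟩ := hz
  have e : s * d.f c a + r * d.f c b = t := by
    rw [← hzt]
    simp only [f, dot2, Prod.fst_add, Prod.snd_add, Prod.smul_fst, Prod.smul_snd, smul_eq_mul]
    ring
  have hs' : s = 1 - r := by linarith
  subst hs'
  rcases lt_or_gt_of_ne ha with h1 | h1
  · have h2 : t < d.f c b := by
      by_contra hh
      have hb' : d.f c b < t := lt_of_le_of_ne (not_lt.1 hh) hb
      rcases hr.eq_or_lt with h0 | h0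
      · rw [← h0] at e; linarith
      · linarith [mul_pos h0 (sub_pos.2 hb'), mul_nonneg hs (sub_pos.2 h1).le]
    exact ⟨T.ι ⟨(a, b), hab⟩, ⟨by simpa using h1, by simpa using h2⟩, by simpa using hz', by simp⟩
  · have h2 : d.f c b < t := by
      by_contra hh
      have hb' : t < d.f c b := lt_of_le_of_ne (not_lt.1 hh) hb.symm
      rcases hr.eq_or_lt with h0 | h0
      · rw [← h0] at e; linarith
      · linarith [mul_pos h0 (sub_pos.2 hb'), mul_nonneg hs (sub_pos.2 h1).le]
    refine ⟨T.ι ⟨(b, a), hab.symm⟩, ⟨by simpa using h2, by simpa using h1⟩, ?_, ?_⟩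
    · rw [segment_symm]; simpa using hz'
    · simp [Set.pair_comm]

lemma nonCrossing : NonCrossing G d.p := by
  refine ⟨?_, fun x a b hab h1 h2 => d.not_on x a b hab.ne h1 h2⟩
  rintro a b u w hab huw hne z ⟨hz1, hz2⟩
  by_cases hv : ∃ v, d.p v = z
  · obtain ⟨v, rfl⟩ := hv
    refine ⟨v, ⟨?_, ?_⟩, rfl⟩
    · by_contra hh
      simp only [Set.mem_insert_iff, Set.mem_singleton_iff, not_or] at hh
      exact d.not_on v a b hab.ne hh.1 hh.2 hz1
    · by_contra hh
      simp only [Set.mem_insert_iff, Set.mem_singleton_iff, not_or] at hh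
      exact d.not_on v u w huw.ne hh.1 hh.2 hz2
  · exfalso
    push Not at hv
    obtain ⟨c, hg, -, hw⟩ := d.gen 0 0 (ι := Empty) (κ := V) (fun e => e.elim) (fun e => e.elim)
      (fun v => d.p v - z) (fun v => sub_ne_zero.2 (hv v))
    have ht : ∀ v, d.f c v ≠ dot2 c z := fun v h => hw v (by
      rw [dot2_sub_right]; simp only [f] at h; linarith)
    obtain ⟨x, hx, hxz, ex⟩ := d.exists_X hab (ht a) (ht b) hz1 rfl
    obtain ⟨y, hy, hyz, ey⟩ := d.exists_X huw (ht u) (ht w) hz2 rfl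
    have := d.h_inj hg.1 ht hx hy (by rw [d.h_of_mem hx hxz rfl, d.h_of_mem hy hyz rfl])
    rw [ex, ey, this] at hne
    exact hne rfl

lemma stretches : Stretches G E big d.p :=
  ⟨⟨d.p_inj, d.nonCrossing, fun v _ => d.sum_dart v⟩, d.genPos, fun e => by
    rw [d.dartAngle_eq]; exact ⟨d.big_angle, d.small_angle⟩⟩

end Dr

set_option linter.unusedSectionVars false

lemma ccw_self {u : ℝ × ℝ} (h : u ≠ 0) : ccwAngle u u = 2 * Real.pi := by
  rw [ccwAngle_def, div_self (cx_ne h)]; simp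

lemma two_case {V : Type} [Fintype V] [DecidableEq V] {G : SimpleGraph V} [DecidableRel G.Adj]
    {E : PlaneEmb G} {big : G.Dart → Prop} (T : Tri E big) (hc : IsCPTLabelling E big)
    {x : T.D} (hx : T.isOut x) (h2 : T.ψ (T.ψ x) = x) : ∃ p : V → ℝ × ℝ, Stretches G E big p := by
  classical
  set e := T.ang x with he
  have hxe : x = T.ι e := T.out_range hx
  have h1 : T.ψ x = T.ι (E.rot e).symm := by rw [T.ψ_def, T.σ_out hx, T.α_ι]
  have ho : T.isOut (T.ψ x) := by simpa using hx
  have ha : T.ang (T.ψ x) = (E.rot e).symm := by rw [h1, T.ang_ι]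
  have h3 : T.ψ (T.ψ x) = T.ι (E.rot (E.rot e).symm).symm := by
    rw [T.ψ_def, T.σ_out ho, T.α_ι, ha]
  have h4 : (E.rot (E.rot e).symm).symm = e := by
    apply T.ι_inj; rw [← h3, h2, ← hxe]
  have h5 : E.rot (E.rot e).symm = e.symm := by
    have := congrArg SimpleGraph.Dart.symm h4
    rwa [SimpleGraph.Dart.symm_symm] at this
  have h6 : (E.rot e).snd = e.snd := by
    have := congrArg (fun a : G.Dart => a.fst) h5
    simpa [E.rot_fst] using this
  have h7 : E.rot e = e := by
    ext1; exact Prod.ext (E.rot_fst e) h6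
  rw [h7] at h5
  have b1 : big e := hc.outer_big e hx
  have b2 : big e.symm := hc.outer_big _ (by
    have := ho
    unfold TMap.isOut TMap.fc at this
    rwa [ha, h7] at this)
  have fx : ∀ a b : G.Dart, E.rot a = a → a.fst = b.fst → b = a := by
    intro a b hr hf
    obtain ⟨n, hn⟩ := E.rot_vertex a b hf
    rw [← hn, Equiv.Perm.coe_pow]
    exact Function.IsFixedPt.iterate hr n
  have hV : ∀ v, v = e.fst ∨ v = e.snd := by
    intro v
    have key : ∀ v w : V, G.Adj v w → (v = e.fst ∨ v = e.snd) → (w = e.fst ∨ w = e.snd) := by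
      rintro v w hvw (h | h)
      · have := fx e ⟨(v, w), hvw⟩ h7 h.symm
        right; rw [← this]
      · have := fx e.symm ⟨(v, w), hvw⟩ h5 h.symm
        left
        have := congrArg (fun a : G.Dart => a.snd) this
        simpa using this
    obtain ⟨W⟩ := E.connected.preconnected e.fst v
    have gen : ∀ u w : V, G.Walk u w → (u = e.fst ∨ u = e.snd) → (w = e.fst ∨ w = e.snd) := by
      intro u w W
      induction W with
      | nil => exact id
      | cons hadj _ ih => exact fun h => ih (key _ _ hadj h)
    exact gen _ _ W (Or.inl rfl)
  have hD : ∀ a : G.Dart, a = e ∨ a = e.symm := by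
    intro a
    rcases hV a.fst with h | h
    · exact Or.inl (fx e a h7 h.symm)
    · exact Or.inr (fx e.symm a h5 h.symm)
  have hne : e.fst ≠ e.snd := e.adj.ne
  let p : V → ℝ × ℝ := fun v => if v = e.fst then (0, 0) else (1, 0)
  have hp : Function.Injective p := by
    intro v w hvw
    have q1 : p e.fst = (0, 0) := if_pos rfl
    have q2 : p e.snd = (1, 0) := if_neg hne.symm
    rcases hV v with hv | hv <;> rcases hV w with hw | hw
    · rw [hv, hw]
    · rw [hv, hw, q1, q2] at hvw; simp at hvw
    · rw [hv, hw, q1, q2] at hvw; simp at hvw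
    · rw [hv, hw]
  have hrot : ∀ a, E.rot a = a := by
    intro a; rcases hD a with rfl | rfl
    · exact h7
    · exact h5
  have hbig : ∀ a, big a := by
    intro a; rcases hD a with rfl | rfl
    · exact b1
    · exact b2
  have hang : ∀ a, dartAngle E p a = 2 * Real.pi := by
    intro a
    rw [dartAngle, hrot]
    exact ccw_self (sub_ne_zero.2 fun h => a.adj.ne' (hp h))
  have hpair : ∀ a b, G.Adj a b → ({a, b} : Set V) = {e.fst, e.snd} := by
    intro a b hab
    rcases hD ⟨(a, b), hab⟩ with h | h
    · rw [← h]
    · have h' : e = (⟨(a, b), hab⟩ : G.Dart).symm := by rw [h]; simp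
      rw [h']; simp [Set.pair_comm]
  refine ⟨p, ⟨hp, ⟨fun a b u w hab huw hh => absurd ((hpair _ _ hab).trans (hpair _ _ huw).symm) hh,
    fun x a b hab h1 h2 => ?_⟩, ?_⟩, ?_, fun a => ⟨fun _ => ?_, fun h => absurd (hbig a) h⟩⟩
  · have : x ∈ ({a, b} : Set V) := by
      rw [hpair a b hab]; exact hV x
    simp [h1, h2] at this
  · rintro v ⟨a, rfl⟩
    have : Finset.univ.filter (fun b : G.Dart => b.fst = a.fst) = {a} := by
      ext b
      simp only [Finset.mem_filter, Finset.mem_univ, true_and, Finset.mem_singleton]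
      exact ⟨fun h => fx a b (hrot a) h.symm, fun h => by rw [h]⟩
    rw [this, Finset.sum_singleton, hang]
  · intro u v w h1 h2 h3
    rcases hV u with hu | hu <;> rcases hV v with hv | hv <;> rcases hV w with hw | hw <;>
      first
      | exact absurd (hu.trans hv.symm) (by assumption)
      | exact absurd (hu.trans hw.symm) (by assumption)
      | exact absurd (hv.trans hw.symm) (by assumption)
  · rw [hang]; linarith [Real.pi_pos]

theorem genLaman_cpt_stretchable
    {V : Type} [Fintype V] [DecidableEq V] (G : SimpleGraph V) [DecidableRel G.Adj]
    (E : PlaneEmb G) (big : G.Dart → Prop) (hcpt : IsCPTLabelling E big)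
    (hgl : GenLaman G big) :
    ∃ p : V → ℝ × ℝ, Stretches G E big p := by
  obtain ⟨T⟩ := exists_tri hcpt
  by_cases h3 : ∀ x, T.isOut x → T.ψ (T.ψ x) ≠ x
  · obtain ⟨d⟩ := Tri.exists_dr (T := T) hcpt h3 hgl
    exact ⟨d.p, d.stretches⟩
  · push Not at h3
    obtain ⟨x, hx, h2⟩ := h3
    exact two_case T hcpt hx h2
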